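/- Let d ≥ 2, λ ∈ (0,1], M > 0, Ñ > 1, k ≥ 1, A ∈ 𝒜(λ,M) and ε > 0. Let u_ε be a nonzero weak solution of div(A(x/ε)∇u_ε) = 0 in B_2 satisfying the doubling condition ⨍_{B(y,r)} |u_ε|² dx ≤ Ñ ⨍_{B(y,r/2)} |u_ε|² dx for all y with |y| ≤ √λ/2 and all 0 < r < 3/4. Then for every r with 0 < r < kε and r < 3/8, and every x_0 with |x_0| ≤ √λ/2, ℋ^{d−1}(Z(u_ε) ∩ B(x_0, r)) ≤ C(Ñ,k) r^{d−1}, where Z(u_ε) = {x ∈ B_2 : u_ε(x) = 0} and C(Ñ,k) depends only on d, λ, k, M and Ñ. -/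

import Mathlib

open MeasureTheory Metric Set
open scoped ENNReal NNReal

noncomputable section

/-- The bilinear form `⟨A ξ, η⟩ = ∑ i j, A i j * ξ j * η i`. -/
def bform {d : ℕ} (A : Matrix (Fin d) (Fin d) ℝ) (ξ η : EuclideanSpace ℝ (Fin d)) : ℝ :=
  ∑ i, ∑ j, A i j * ξ j * η i

/-- The point of `ℝᵈ` (as `EuclideanSpace`) with integer coordinates `z`. -/
def perPt {d : ℕ} (z : Fin d → ℤ) : EuclideanSpace ℝ (Fin d) :=
  (WithLp.equiv 2 (Fin d → ℝ)).symm fun i => (z i : ℝ)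

/-- The class `𝒜(λ, M)`: symmetric, elliptic, `ℤᵈ`-periodic, `M`-Lipschitz coefficients. -/
structure MemA (d : ℕ) (lam M : ℝ)
    (A : EuclideanSpace ℝ (Fin d) → Matrix (Fin d) (Fin d) ℝ) : Prop where
  symm : ∀ y, (A y).IsSymm
  ellip_low : ∀ y ξ, lam * ‖ξ‖ ^ 2 ≤ bform (A y) ξ ξ
  ellip_high : ∀ y ξ, bform (A y) ξ ξ ≤ ‖ξ‖ ^ 2
  periodic : ∀ (y : EuclideanSpace ℝ (Fin d)) (z : Fin d → ℤ), A (y + perPt z) = A y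
  lipschitz : ∀ x y i j, |A x i j - A y i j| ≤ M * ‖x - y‖

/-- `u` is a weak solution of `div (A ∇u) = 0` in the open set `Ω`:
`u` is `C¹` on `Ω` and the weak formulation holds against all test functions. -/
def IsWeakSol {d : ℕ} (A : EuclideanSpace ℝ (Fin d) → Matrix (Fin d) (Fin d) ℝ)
    (Ω : Set (EuclideanSpace ℝ (Fin d))) (u : EuclideanSpace ℝ (Fin d) → ℝ) : Prop :=
  ContDiffOn ℝ 1 u Ω ∧
  ∀ ψ : EuclideanSpace ℝ (Fin d) → ℝ, ContDiff ℝ (⊤ : ℕ∞) ψ → HasCompactSupport ψ →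
    tsupport ψ ⊆ Ω →
    ∫ x in Ω, bform (A x) (gradient u x) (gradient ψ x) = 0

/-- The unit cube `[0,1]^d`. -/
def unitCube (d : ℕ) : Set (EuclideanSpace ℝ (Fin d)) := {y | ∀ i, y i ∈ Set.Icc (0 : ℝ) 1}

/-- `χ` is the corrector for the operator with coefficient matrix `A`. -/
def IsCorrector {d : ℕ} (A : EuclideanSpace ℝ (Fin d) → Matrix (Fin d) (Fin d) ℝ)
    (χ : Fin d → EuclideanSpace ℝ (Fin d) → ℝ) : Prop :=
  ∀ j, ContDiff ℝ 1 (χ j) ∧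
    (∀ (y : EuclideanSpace ℝ (Fin d)) (z : Fin d → ℤ), χ j (y + perPt z) = χ j y) ∧
    (∫ y in unitCube d, χ j y) = 0 ∧
    (∀ ψ : EuclideanSpace ℝ (Fin d) → ℝ, ContDiff ℝ (⊤ : ℕ∞) ψ → HasCompactSupport ψ →
      ∫ y, bform (A y) (gradient (χ j) y + EuclideanSpace.single j 1) (gradient ψ y) = 0)

/-- The homogenized matrix `Â`, `â_ij = ∫_{[0,1]^d} (a_ij + a_ik ∂χ_j/∂y_k) dy`. -/
def homMatrix {d : ℕ} (A : EuclideanSpace ℝ (Fin d) → Matrix (Fin d) (Fin d) ℝ)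
    (χ : Fin d → EuclideanSpace ℝ (Fin d) → ℝ) : Matrix (Fin d) (Fin d) ℝ :=
  Matrix.of fun i j => ∫ y in unitCube d, (A y i j + ∑ k, A y i k * gradient (χ j) y k)

/-- The ellipsoid `E_r = {x : ⟨Â⁻¹ x, x⟩ < r²}` associated with a homogenized matrix `Â`. -/
def ellipsoid {d : ℕ} (Ahat : Matrix (Fin d) (Fin d) ℝ) (r : ℝ) :
    Set (EuclideanSpace ℝ (Fin d)) := {x | bform Ahat⁻¹ x x < r ^ 2}

/-- The class `ℱ(N)` of normalized solutions of constant-coefficient equations in `B₁`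
satisfying an `N`-doubling condition. -/
def MemF (d : ℕ) (lam N : ℝ) (u : EuclideanSpace ℝ (Fin d) → ℝ) : Prop :=
  (∃ A : Matrix (Fin d) (Fin d) ℝ, A.IsSymm ∧
      (∀ ξ : EuclideanSpace ℝ (Fin d), lam * ‖ξ‖ ^ 2 ≤ bform A ξ ξ ∧ bform A ξ ξ ≤ ‖ξ‖ ^ 2) ∧
      IsWeakSol (fun _ => A) (ball 0 1) u) ∧
  (⨍ x in ball (0 : EuclideanSpace ℝ (Fin d)) 1, (u x) ^ 2) = 1 ∧
  (⨍ x in ball (0 : EuclideanSpace ℝ (Fin d)) 1, (u x) ^ 2) ≤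
    N * ⨍ x in ball (0 : EuclideanSpace ℝ (Fin d)) (1 / 2), (u x) ^ 2

/-- `w` is harmonic on `Ω`: it is `C²` there and its Laplacian vanishes. -/
def IsHarmonicOn {d : ℕ} (w : EuclideanSpace ℝ (Fin d) → ℝ)
    (Ω : Set (EuclideanSpace ℝ (Fin d))) : Prop :=
  ContDiffOn ℝ 2 w Ω ∧ ∀ x ∈ Ω, (∑ i, gradient (fun y => gradient w y i) x i) = 0

/-- `F_ε(y, r) = ℋ^{d-1}(Z(u) ∩ B(y,r)) / r^{d-1}` where `Z(u)` is the nodal set of `u` in `B₂`. -/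
def nodalRatio {d : ℕ} (u : EuclideanSpace ℝ (Fin d) → ℝ)
    (y : EuclideanSpace ℝ (Fin d)) (r : ℝ) : ℝ≥0∞ :=
  μH[(d : ℝ) - 1] ({x ∈ ball (0 : EuclideanSpace ℝ (Fin d)) 2 | u x = 0} ∩ ball y r) /
    ENNReal.ofReal (r ^ (d - 1))

open scoped ContDiff Topology

/-- Euclidean space. -/
abbrev Eu (d : ℕ) := EuclideanSpace ℝ (Fin d)

/-- basis vector -/
def ev {d : ℕ} (i : Fin d) : Eu d := EuclideanSpace.single i (1 : ℝ)

/-- partial derivative -/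
def pd {d : ℕ} (i : Fin d) (f : Eu d → ℝ) (x : Eu d) : ℝ := fderiv ℝ f x (ev i)

variable {d : ℕ}

lemma norm_ev (i : Fin d) : ‖(ev i : Eu d)‖ = 1 := by simp [ev]

lemma ev_apply (i j : Fin d) : (ev i : Eu d) j = if j = i then 1 else 0 := by
  simp [ev]

lemma abs_coord_le (x : Eu d) (i : Fin d) : |x i| ≤ ‖x‖ := by
  have := PiLp.norm_apply_le x i
  simpa using this

lemma sum_ev (x : Eu d) : x = ∑ i, x i • ev i := by
  ext j
  simp [ev_apply, Finset.sum_apply]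

lemma gradient_apply (f : Eu d → ℝ) (x : Eu d) (i : Fin d) : gradient f x i = pd i f x := by
  have h : inner ℝ (gradient f x) (ev i) = fderiv ℝ f x (ev i) := by
    rw [gradient, InnerProductSpace.toDual_symm_apply]
  rw [pd, ← h, ev, EuclideanSpace.inner_single_right]
  simp

lemma fderiv_apply_eq (f : Eu d → ℝ) (x v : Eu d) : fderiv ℝ f x v = ∑ i, v i * pd i f x := by
  conv_lhs => rw [sum_ev v]
  simp [pd]

lemma abs_pd_le (f : Eu d → ℝ) (x : Eu d) (i : Fin d) : |pd i f x| ≤ ‖fderiv ℝ f x‖ := by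
  have := (fderiv ℝ f x).le_opNorm (ev i)
  rw [norm_ev, mul_one] at this
  simpa [pd] using this

lemma norm_fderiv_le (f : Eu d → ℝ) (x : Eu d) {G : ℝ} (h : ∀ i, |pd i f x| ≤ G) :
    ‖fderiv ℝ f x‖ ≤ d * G := by
  have hG : 0 ≤ (d : ℝ) * G := by
    rcases Nat.eq_zero_or_pos d with h0 | h0
    · subst h0; simp
    · have := (abs_nonneg _).trans (h ⟨0, h0⟩)
      positivity
  refine ContinuousLinearMap.opNorm_le_bound _ hG fun v => ?_
  rw [fderiv_apply_eq, Real.norm_eq_abs]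
  calc |∑ i, v i * pd i f x| ≤ ∑ i, |v i * pd i f x| := Finset.abs_sum_le_sum_abs _ _
    _ ≤ ∑ i : Fin d, ‖v‖ * G := by
        refine Finset.sum_le_sum fun i _ => ?_
        rw [abs_mul]
        exact mul_le_mul (abs_coord_le v i) (h i) (abs_nonneg _) (norm_nonneg _)
    _ = d * G * ‖v‖ := by simp; ring

lemma HasFDerivAt.pd_eq {f : Eu d → ℝ} {x : Eu d} {L : Eu d →L[ℝ] ℝ} (h : HasFDerivAt f L x)
    (i : Fin d) : pd i f x = L (ev i) := by rw [pd, h.fderiv]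

lemma pd_add {f g : Eu d → ℝ} {x : Eu d} (i : Fin d) (hf : DifferentiableAt ℝ f x)
    (hg : DifferentiableAt ℝ g x) : pd i (fun y => f y + g y) x = pd i f x + pd i g x := by
  rw [(hf.hasFDerivAt.fun_add hg.hasFDerivAt).pd_eq]; rfl

lemma pd_sub {f g : Eu d → ℝ} {x : Eu d} (i : Fin d) (hf : DifferentiableAt ℝ f x)
    (hg : DifferentiableAt ℝ g x) : pd i (fun y => f y - g y) x = pd i f x - pd i g x := by
  rw [(hf.hasFDerivAt.fun_sub hg.hasFDerivAt).pd_eq]; rfl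

lemma pd_mul {f g : Eu d → ℝ} {x : Eu d} (i : Fin d) (hf : DifferentiableAt ℝ f x)
    (hg : DifferentiableAt ℝ g x) :
    pd i (fun y => f y * g y) x = pd i f x * g x + f x * pd i g x := by
  rw [(hf.hasFDerivAt.fun_mul hg.hasFDerivAt).pd_eq]
  simp [pd]; ring

lemma pd_const (i : Fin d) (c : ℝ) (x : Eu d) : pd i (fun _ : Eu d => c) x = 0 := by
  simp [pd]

lemma pd_const_mul {f : Eu d → ℝ} {x : Eu d} (i : Fin d) (c : ℝ) (hf : DifferentiableAt ℝ f x) :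
    pd i (fun y => c * f y) x = c * pd i f x := by
  rw [(hf.hasFDerivAt.const_mul c).pd_eq]; simp [pd]

lemma pd_mul_const {f : Eu d → ℝ} {x : Eu d} (i : Fin d) (c : ℝ) (hf : DifferentiableAt ℝ f x) :
    pd i (fun y => f y * c) x = pd i f x * c := by
  rw [(hf.hasFDerivAt.mul_const c).pd_eq]; simp [pd]; ring

lemma pd_sum {ι : Type*} (s : Finset ι) {f : ι → Eu d → ℝ} {x : Eu d} (i : Fin d)
    (hf : ∀ k ∈ s, DifferentiableAt ℝ (f k) x) :
    pd i (fun y => ∑ k ∈ s, f k y) x = ∑ k ∈ s, pd i (f k) x := by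
  have h := HasFDerivAt.fun_sum (u := s) (A := f) (A' := fun k => fderiv ℝ (f k) x) (x := x)
    (fun k hk => (hf k hk).hasFDerivAt)
  rw [h.pd_eq]; simp [pd]

lemma pd_comp {f : Eu d → ℝ} {g : ℝ → ℝ} {g' : ℝ} {x : Eu d} (i : Fin d)
    (hg : HasDerivAt g g' (f x)) (hf : DifferentiableAt ℝ f x) :
    pd i (fun y => g (f y)) x = g' * pd i f x := by
  have := hg.comp_hasFDerivAt x hf.hasFDerivAt
  rw [show (fun y => g (f y)) = g ∘ f from rfl, this.pd_eq]; simp [pd]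

lemma pd_coord (i j : Fin d) (x : Eu d) : pd i (fun y : Eu d => y j) x = if j = i then 1 else 0 := by
  have h : HasFDerivAt (fun y : Eu d => y j) (EuclideanSpace.proj j : Eu d →L[ℝ] ℝ) x :=
    (EuclideanSpace.proj j : Eu d →L[ℝ] ℝ).hasFDerivAt
  rw [h.pd_eq, ← ev_apply]; rfl

lemma contDiff_coord {n : WithTop ℕ∞} (j : Fin d) : ContDiff ℝ n (fun y : Eu d => y j) :=
  (EuclideanSpace.proj j : Eu d →L[ℝ] ℝ).contDiff

lemma pd_affine {f : Eu d → ℝ} {x y : Eu d} (i : Fin d) (r : ℝ)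
    (hf : DifferentiableAt ℝ f (y + r • x)) :
    pd i (fun z => f (y + r • z)) x = r * pd i f (y + r • x) := by
  have h1 : HasFDerivAt (fun z : Eu d => y + r • z) (r • ContinuousLinearMap.id ℝ (Eu d)) x :=
    ((hasFDerivAt_id x).const_smul r).const_add y
  have := hf.hasFDerivAt.comp x h1
  rw [show (fun z => f (y + r • z)) = f ∘ (fun z => y + r • z) from rfl, this.pd_eq]; simp [pd]

lemma contDiff_pd {f : Eu d → ℝ} {n m : WithTop ℕ∞} (hf : ContDiff ℝ n f) (h : m + 1 ≤ n)
    (i : Fin d) : ContDiff ℝ m (pd i f) :=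
  (hf.fderiv_right h).clm_apply contDiff_const

lemma contDiff_pd_top {f : Eu d → ℝ} (hf : ContDiff ℝ ∞ f) (i : Fin d) :
    ContDiff ℝ ∞ (pd i f) := contDiff_pd hf (by simp) i

lemma continuous_pd {f : Eu d → ℝ} (hf : ContDiff ℝ 1 f) (i : Fin d) : Continuous (pd i f) :=
  (contDiff_pd (m := 0) hf (by simp) i).continuous

lemma pd_eq_zero_of_eventually {f : Eu d → ℝ} {x : Eu d} (i : Fin d) {c : ℝ}
    (h : f =ᶠ[𝓝 x] fun _ => c) : pd i f x = 0 := by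
  rw [pd, h.fderiv_eq]; simp

lemma pd_congr {f g : Eu d → ℝ} {x : Eu d} (i : Fin d)
    (h : f =ᶠ[𝓝 x] g) : pd i f x = pd i g x := by
  rw [pd, h.fderiv_eq]; rfl

lemma tsupport_pd (f : Eu d → ℝ) (i : Fin d) : tsupport (pd i f) ⊆ tsupport f := by
  refine closure_minimal ?_ (isClosed_tsupport f)
  intro x hx
  by_contra hn
  exact hx (pd_eq_zero_of_eventually i (c := 0)
    ((isClosed_tsupport f).isOpen_compl.mem_nhds hn |> fun h => by
      filter_upwards [h] with y hy
      exact image_eq_zero_of_notMem_tsupport hy))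

lemma hasCompactSupport_pd {f : Eu d → ℝ} (hf : HasCompactSupport f) (i : Fin d) :
    HasCompactSupport (pd i f) :=
  HasCompactSupport.of_compactSpace_or hf i
where
  HasCompactSupport.of_compactSpace_or {f : Eu d → ℝ} (hf : HasCompactSupport f) (i : Fin d) :
      HasCompactSupport (pd i f) := hf.of_isClosed_subset (isClosed_tsupport _) (tsupport_pd f i)

lemma pd_comm {f : Eu d → ℝ} (hf : ContDiff ℝ 2 f) (i j : Fin d) (x : Eu d) :
    pd i (pd j f) x = pd j (pd i f) x := by
  have hd : DifferentiableAt ℝ (fderiv ℝ f) x :=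
    ((hf.fderiv_right (m := 1) (by norm_num)).differentiable (by norm_num)) x
  have key : ∀ a b : Fin d, pd a (pd b f) x = fderiv ℝ (fderiv ℝ f) x (ev a) (ev b) := by
    intro a b
    have h := hd.hasFDerivAt.clm_apply (hasFDerivAt_const (ev b) x)
    have : pd b f = fun y => fderiv ℝ f y (ev b) := rfl
    rw [this, h.pd_eq]; simp
  rw [key, key]
  have hs : IsSymmSndFDerivAt ℝ f x := hf.contDiffAt.isSymmSndFDerivAt (by simp)
  exact hs _ _

lemma integral_pd_eq_zero {f : Eu d → ℝ} (hf : ContDiff ℝ 1 f) (hc : HasCompactSupport f)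
    (i : Fin d) : ∫ x, pd i f x = 0 := by
  have h := integral_mul_fderiv_eq_neg_fderiv_mul_of_integrable (μ := (volume : Measure (Eu d)))
    (f := fun _ => (1 : ℝ)) (g := f) (v := ev i)
    (by simp) (by
      have := (continuous_pd hf i).integrable_of_hasCompactSupport
        (μ := (volume : Measure (Eu d))) (hasCompactSupport_pd hc i)
      refine this.congr (Filter.Eventually.of_forall fun x => ?_)
      simp [pd])
    (by simpa using hf.continuous.integrable_of_hasCompactSupport hc)
    (fun x _ => differentiableAt_const _) (fun x _ => hf.differentiable (by norm_num) x)
  simpa [pd] using h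

lemma integral_pd_mul {f g : Eu d → ℝ} (hf : ContDiff ℝ 1 f) (hg : ContDiff ℝ 1 g)
    (hc : HasCompactSupport g) (i : Fin d) :
    ∫ x, pd i f x * g x = - ∫ x, f x * pd i g x := by
  have h0 := integral_pd_eq_zero (hf.mul hg) (hc.mul_left (f := f)) i
  have e : (fun x => pd i (fun y => f y * g y) x) = fun x => pd i f x * g x + f x * pd i g x := by
    funext x
    exact pd_mul i (hf.differentiable (by norm_num) x) (hg.differentiable (by norm_num) x)
  have e2 : ∫ x, pd i (fun y => f y * g y) x = 0 := h0
  rw [e, integral_add] at e2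
  · linarith
  · exact ((continuous_pd hf i).mul hg.continuous).integrable_of_hasCompactSupport hc.mul_left
  · exact (hf.continuous.mul (continuous_pd hg i)).integrable_of_hasCompactSupport
      (hasCompactSupport_pd hc i).mul_left

/-- Lipschitz bound from bounds on partial derivatives on a convex set. -/
lemma abs_sub_le_of_pd {f : Eu d → ℝ} (hf : ContDiff ℝ 1 f) {s : Set (Eu d)} (hs : Convex ℝ s)
    {G : ℝ} (h : ∀ x ∈ s, ∀ i, |pd i f x| ≤ G) {x y : Eu d} (hx : x ∈ s) (hy : y ∈ s) :
    |f x - f y| ≤ d * G * ‖x - y‖ := by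
  have := hs.norm_image_sub_le_of_norm_fderiv_le (𝕜 := ℝ) (f := f) (C := d * G)
    (fun z _ => hf.differentiable (by norm_num) z) (fun z hz => norm_fderiv_le f z (h z hz)) hy hx
  simpa using this

/-- matrix times vector in Euclidean space -/
def mv (A : Matrix (Fin d) (Fin d) ℝ) (ξ : Eu d) : Eu d := WithLp.toLp 2 (fun i => ∑ j, A i j * ξ j)

lemma mv_apply (A : Matrix (Fin d) (Fin d) ℝ) (ξ : Eu d) (i : Fin d) :
    mv A ξ i = ∑ j, A i j * ξ j := rfl

lemma bform_eq_inner (A : Matrix (Fin d) (Fin d) ℝ) (ξ η : Eu d) :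
    bform A ξ η = inner ℝ (mv A ξ) η := by
  simp [bform, PiLp.inner_apply, mv_apply, Finset.mul_sum]
  refine Finset.sum_congr rfl fun i _ => Finset.sum_congr rfl fun j _ => by ring

lemma mv_mul (A B : Matrix (Fin d) (Fin d) ℝ) (ξ : Eu d) : mv A (mv B ξ) = mv (A * B) ξ := by
  ext i
  simp only [mv_apply, Matrix.mul_apply, Finset.mul_sum, Finset.sum_mul]
  rw [Finset.sum_comm]
  refine Finset.sum_congr rfl fun j _ => Finset.sum_congr rfl fun k _ => by ring

lemma mv_one (ξ : Eu d) : mv (1 : Matrix (Fin d) (Fin d) ℝ) ξ = ξ := by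
  ext i
  simp [mv_apply, Matrix.one_apply]

/-- uniformly elliptic symmetric matrices -/
structure Ell (lam : ℝ) (A : Matrix (Fin d) (Fin d) ℝ) : Prop where
  symm : ∀ i j, A i j = A j i
  low : ∀ ξ : Eu d, lam * ‖ξ‖ ^ 2 ≤ bform A ξ ξ
  high : ∀ ξ : Eu d, bform A ξ ξ ≤ ‖ξ‖ ^ 2

lemma bform_comm {A : Matrix (Fin d) (Fin d) ℝ} (h : ∀ i j, A i j = A j i) (ξ η : Eu d) :
    bform A ξ η = bform A η ξ := by
  rw [bform, bform, Finset.sum_comm]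
  refine Finset.sum_congr rfl fun i _ => Finset.sum_congr rfl fun j _ => ?_
  rw [h j i]; ring

lemma bform_add_smul {A : Matrix (Fin d) (Fin d) ℝ} (h : ∀ i j, A i j = A j i) (ξ η : Eu d) (t : ℝ) :
    bform A (ξ + t • η) (ξ + t • η) = bform A ξ ξ + 2 * t * bform A ξ η + t ^ 2 * bform A η η := by
  have e : 2 * t * bform A ξ η = t * bform A ξ η + t * bform A η ξ := by
    rw [bform_comm h η ξ]; ring
  rw [e]
  simp only [bform, Finset.mul_sum, ← Finset.sum_add_distrib]
  refine Finset.sum_congr rfl fun i _ => Finset.sum_congr rfl fun j _ => ?_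
  simp; ring

lemma bform_cs {A : Matrix (Fin d) (Fin d) ℝ} (h : ∀ i j, A i j = A j i)
    (hp : ∀ ξ : Eu d, 0 ≤ bform A ξ ξ) (ξ η : Eu d) :
    (bform A ξ η) ^ 2 ≤ bform A ξ ξ * bform A η η := by
  have h1 : ∀ t : ℝ, 0 ≤ bform A η η * (t * t) + (2 * bform A ξ η) * t + bform A ξ ξ := by
    intro t
    have := hp (ξ + t • η)
    rw [bform_add_smul h] at this
    linarith
  have h2 := discrim_le_zero h1
  rw [discrim] at h2
  nlinarith

namespace Ell
variable {lam : ℝ} {A : Matrix (Fin d) (Fin d) ℝ}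

lemma nonneg (hA : Ell lam A) (hl : 0 < lam) (ξ : Eu d) : 0 ≤ bform A ξ ξ :=
  (by positivity : 0 ≤ lam * ‖ξ‖ ^ 2).trans (hA.low ξ)

lemma norm_mv_sq_le (hA : Ell lam A) (hl : 0 < lam) (ξ : Eu d) : ‖mv A ξ‖ ^ 2 ≤ bform A ξ ξ := by
  have h1 := bform_cs hA.symm (hA.nonneg hl) ξ (mv A ξ)
  have h2 : bform A ξ (mv A ξ) = ‖mv A ξ‖ ^ 2 := by rw [bform_eq_inner, real_inner_self_eq_norm_sq]
  have h3 := hA.high (mv A ξ)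
  have h4 := hA.nonneg hl ξ
  rw [h2] at h1
  by_cases h0 : ‖mv A ξ‖ ^ 2 = 0
  · rw [h0]; exact h4
  · have hpos : 0 < ‖mv A ξ‖ ^ 2 := lt_of_le_of_ne (by positivity) (Ne.symm h0)
    have : ‖mv A ξ‖ ^ 2 * ‖mv A ξ‖ ^ 2 ≤ bform A ξ ξ * ‖mv A ξ‖ ^ 2 := by
      nlinarith [mul_le_mul_of_nonneg_left h3 h4]
    exact le_of_mul_le_mul_right this hpos

lemma norm_mv_le (hA : Ell lam A) (hl : 0 < lam) (ξ : Eu d) : ‖mv A ξ‖ ≤ ‖ξ‖ := by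
  have h1 := hA.norm_mv_sq_le hl ξ
  have h2 := hA.high ξ
  exact (sq_le_sq₀ (norm_nonneg _) (norm_nonneg _)).1 (h1.trans h2)

lemma le_norm_mv (hA : Ell lam A) (ξ : Eu d) : lam * ‖ξ‖ ≤ ‖mv A ξ‖ := by
  have h1 := hA.low ξ
  rw [bform_eq_inner] at h1
  have h2 := real_inner_le_norm (mv A ξ) ξ
  by_cases h0 : ‖ξ‖ = 0
  · rw [h0, mul_zero]; exact norm_nonneg _
  · have hpos : 0 < ‖ξ‖ := lt_of_le_of_ne (norm_nonneg _) (Ne.symm h0)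
    refine le_of_mul_le_mul_right ?_ hpos
    nlinarith

lemma isUnit_det (hA : Ell lam A) (hl : 0 < lam) : IsUnit A.det := by
  rw [← Matrix.isUnit_iff_isUnit_det, ← Matrix.mulVec_injective_iff_isUnit]
  intro x y hxy
  have h : A.mulVec (x - y) = 0 := by rw [Matrix.mulVec_sub, hxy, sub_self]
  have h2 := hA.le_norm_mv (WithLp.toLp 2 (x - y))
  have h3 : mv A (WithLp.toLp 2 (x - y)) = 0 := by
    ext i
    have := congrFun h i
    simpa [mv_apply, Matrix.mulVec, dotProduct] using this
  rw [h3, norm_zero] at h2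
  have h4 : ‖(WithLp.toLp 2 (x - y) : Eu d)‖ = 0 := by
    have := norm_nonneg (WithLp.toLp 2 (x - y) : Eu d)
    nlinarith
  have h5 := norm_eq_zero.1 h4
  have h6 : x - y = 0 := by
    have := congrArg (WithLp.ofLp) h5
    simpa using this
  exact sub_eq_zero.1 h6

lemma mul_inv (hA : Ell lam A) (hl : 0 < lam) : A * A⁻¹ = 1 :=
  Matrix.mul_nonsing_inv A (hA.isUnit_det hl)

lemma mv_mv_inv (hA : Ell lam A) (hl : 0 < lam) (x : Eu d) : mv A (mv A⁻¹ x) = x := by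
  rw [mv_mul, hA.mul_inv hl, mv_one]

lemma inv_symm (hA : Ell lam A) (i j : Fin d) : A⁻¹ i j = A⁻¹ j i := by
  have h : Matrix.transpose A = A := by ext i j; exact hA.symm j i
  have h2 := Matrix.transpose_nonsing_inv A
  rw [h] at h2
  calc A⁻¹ i j = Matrix.transpose (A⁻¹) j i := rfl
    _ = A⁻¹ j i := by rw [h2]

lemma norm_inv_le (hA : Ell lam A) (hl : 0 < lam) (x : Eu d) : ‖mv A⁻¹ x‖ ≤ ‖x‖ / lam := by
  have := hA.le_norm_mv (mv A⁻¹ x)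
  rw [hA.mv_mv_inv hl] at this
  rw [le_div_iff₀ hl]; linarith

lemma le_norm_inv (hA : Ell lam A) (hl : 0 < lam) (x : Eu d) : ‖x‖ ≤ ‖mv A⁻¹ x‖ := by
  have := hA.norm_mv_le hl (mv A⁻¹ x)
  rwa [hA.mv_mv_inv hl] at this

lemma q_ge (hA : Ell lam A) (hl : 0 < lam) (x : Eu d) : ‖x‖ ^ 2 ≤ bform A⁻¹ x x := by
  have h := hA.norm_mv_sq_le hl (mv A⁻¹ x)
  rw [bform_eq_inner, hA.mv_mv_inv hl, real_inner_comm, ← bform_eq_inner] at h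
  exact h

lemma q_le (hA : Ell lam A) (hl : 0 < lam) (x : Eu d) : bform A⁻¹ x x ≤ ‖x‖ ^ 2 / lam := by
  rw [bform_eq_inner]
  refine (real_inner_le_norm _ _).trans ?_
  have := hA.norm_inv_le hl x
  calc _ ≤ ‖x‖ / lam * ‖x‖ := by gcongr
    _ = _ := by ring

lemma mv_ev (A : Matrix (Fin d) (Fin d) ℝ) (i j : Fin d) : mv A (ev j) i = A i j := by
  simp [mv_apply, ev_apply]

lemma abs_le (hA : Ell lam A) (hl : 0 < lam) (i j : Fin d) : |A i j| ≤ 1 := by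
  rw [← mv_ev A i j]
  exact (abs_coord_le _ _).trans ((hA.norm_mv_le hl _).trans (norm_ev j).le)

lemma abs_inv_le (hA : Ell lam A) (hl : 0 < lam) (i j : Fin d) : |A⁻¹ i j| ≤ 1 / lam := by
  rw [← mv_ev A⁻¹ i j]
  refine (abs_coord_le _ _).trans ((hA.norm_inv_le hl _).trans ?_)
  rw [norm_ev]

end Ell

/-- coefficient fields -/
structure Coef (lam M : ℝ) (A : Eu d → Matrix (Fin d) (Fin d) ℝ) : Prop where
  ell : ∀ y, Ell lam (A y)
  lip : ∀ x y i j, |A x i j - A y i j| ≤ M * ‖x - y‖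

/-- globally defined `C¹` functions with compact support solving the equation in `Ω` -/
structure Sol (lam M : ℝ) (Ω : Set (Eu d)) (A : Eu d → Matrix (Fin d) (Fin d) ℝ)
    (u : Eu d → ℝ) : Prop extends Coef lam M A where
  c1 : ContDiff ℝ 1 u
  cs : HasCompactSupport u
  weak : ∀ ψ : Eu d → ℝ, ContDiff ℝ ∞ ψ → HasCompactSupport ψ → tsupport ψ ⊆ Ω →
    ∫ x, ∑ i, ∑ j, A x i j * pd j u x * pd i ψ x = 0

lemma Coef.cont {lam M : ℝ} {A : Eu d → Matrix (Fin d) (Fin d) ℝ} (h : Coef lam M A) (i j : Fin d) :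
    Continuous fun x => A x i j := by
  refine (LipschitzWith.of_dist_le_mul (K := (|M|).toNNReal) fun x y => ?_).continuous
  rw [Real.dist_eq, dist_eq_norm, Real.coe_toNNReal _ (abs_nonneg _)]
  exact (h.lip x y i j).trans (by gcongr; exact le_abs_self M)

lemma integral_affine (f : Eu d → ℝ) (y : Eu d) {r : ℝ} (hr : 0 < r) :
    ∫ x, f (y + r • x) = (r ^ d)⁻¹ * ∫ x, f x := by
  have h := Measure.integral_comp_smul (volume : Measure (Eu d)) (fun x => f (y + x)) r
  rw [h, integral_add_left_eq_self f y]
  simp [abs_of_pos hr]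

lemma affine_inv (y x : Eu d) {r : ℝ} (hr : r ≠ 0) : (-(r⁻¹ • y)) + r⁻¹ • (y + r • x) = x := by
  rw [smul_add, smul_smul, inv_mul_cancel₀ hr, one_smul]; abel

lemma affine_inv2 (y x : Eu d) {r : ℝ} (hr : r ≠ 0) : y + r • ((-(r⁻¹ • y)) + r⁻¹ • x) = x := by
  rw [smul_add, smul_smul, smul_neg, smul_smul, mul_inv_cancel₀ hr, one_smul, one_smul]; abel

/-- affine homeomorphism -/
def affHomeo (y : Eu d) {r : ℝ} (hr : r ≠ 0) : Eu d ≃ₜ Eu d where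
  toFun x := y + r • x
  invFun x := -(r⁻¹ • y) + r⁻¹ • x
  left_inv x := affine_inv y x hr
  right_inv x := affine_inv2 y x hr
  continuous_toFun := by fun_prop
  continuous_invFun := by fun_prop

lemma Sol.affine {lam M : ℝ} {Ω : Set (Eu d)} {A : Eu d → Matrix (Fin d) (Fin d) ℝ} {u : Eu d → ℝ}
    (h : Sol lam M Ω A u) (y : Eu d) {r : ℝ} (hr : 0 < r) (c : ℝ) :
    Sol lam (M * r) {x | y + r • x ∈ Ω} (fun x => A (y + r • x)) (fun x => c * u (y + r • x)) where
  ell x := h.ell _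
  lip x z i j := by
    refine (h.lip _ _ i j).trans ?_
    rw [add_sub_add_left_eq_sub, ← smul_sub, norm_smul, Real.norm_eq_abs, abs_of_pos hr, mul_assoc]
  c1 := contDiff_const.mul (h.c1.comp (contDiff_const.add (contDiff_id.const_smul _)))
  cs := by
    have := h.cs.comp_homeomorph (affHomeo y hr.ne')
    exact HasCompactSupport.mul_left (f := fun _ => c) this
  weak ψ hψ hc hs := by
    have hr0 : r ≠ 0 := hr.ne'
    set φ : Eu d → ℝ := fun z => ψ (-(r⁻¹ • y) + r⁻¹ • z) with hφ
    have hφc : ContDiff ℝ ∞ φ :=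
      hψ.comp (contDiff_const.add (contDiff_id.const_smul _))
    have e : φ = ψ ∘ (affHomeo y hr0).symm := rfl
    have hφs : HasCompactSupport φ := hc.comp_homeomorph (affHomeo y hr0).symm
    have hφt : tsupport φ ⊆ Ω := by
      intro z hz
      have hz1 : (affHomeo y hr0).symm z ∈ tsupport ψ :=
        tsupport_comp_subset_preimage ψ (affHomeo y hr0).symm.continuous hz
      have := hs hz1
      have h2 : (affHomeo y hr0) ((affHomeo y hr0).symm z) ∈ Ω := this
      rwa [Homeomorph.apply_symm_apply] at h2
    have hw := h.weak φ hφc hφs hφt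
    have h2 := integral_affine (fun x => ∑ i, ∑ j, A x i j * pd j u x * pd i φ x) y hr
    rw [hw, mul_zero] at h2
    have h3 : ∀ x, (∑ i, ∑ j, A (y + r • x) i j * pd j (fun x => c * u (y + r • x)) x * pd i ψ x)
        = (c * r ^ 2) * (∑ i, ∑ j, A (y + r • x) i j * pd j u (y + r • x) * pd i φ (y + r • x)) := by
      intro x
      simp only [Finset.mul_sum]
      refine Finset.sum_congr rfl fun i _ => Finset.sum_congr rfl fun j _ => ?_
      have hdu : DifferentiableAt ℝ u (y + r • x) := h.c1.differentiable (by norm_num) _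
      have e1 : pd j (fun x => c * u (y + r • x)) x = c * (r * pd j u (y + r • x)) := by
        rw [pd_const_mul (f := fun x => u (y + r • x)), pd_affine j r hdu]
        exact (h.c1.comp (contDiff_const.add (contDiff_id.const_smul _))).differentiable
          (by norm_num) x
      have e2 : pd i φ (y + r • x) = r⁻¹ * pd i ψ x := by
        rw [hφ, pd_affine i r⁻¹ (hψ.differentiable (by simp) _), affine_inv y x hr0]
      rw [e1, e2]; field_simp
    simp only [h3]
    rw [integral_const_mul, h2, mul_zero]

lemma two_le_inf : (2 : WithTop ℕ∞) ≤ (∞ : WithTop ℕ∞) := by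
  change (((2 : ℕ∞) : WithTop ℕ∞)) ≤ _
  exact WithTop.coe_le_coe.2 le_top

lemma one_le_inf : (1 : WithTop ℕ∞) ≤ (∞ : WithTop ℕ∞) := by
  exact_mod_cast (WithTop.coe_le_coe.2 (le_top : (1 : ℕ∞) ≤ ⊤))

/-- kernel profile -/
def Kp (s : ℝ) : ℝ := expNegInvGlue (1 - s)
/-- minus the derivative of the kernel profile -/
def th (s : ℝ) : ℝ := -deriv Kp s

lemma contDiff_Kp : ContDiff ℝ ∞ Kp :=
  expNegInvGlue.contDiff.comp (contDiff_const.sub contDiff_id)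

lemma contDiff_th : ContDiff ℝ ∞ th := by
  have h : ContDiff ℝ ∞ (deriv Kp) := by
    have := contDiff_Kp.iterate_deriv 1
    simpa using this
  exact h.neg

lemma hasDerivAt_Kp (s : ℝ) : HasDerivAt Kp (-th s) s := by
  rw [th, neg_neg]
  exact (contDiff_Kp.differentiable (by simp) s).hasDerivAt

lemma th_eq (s : ℝ) : th s = ((1 - s)⁻¹) ^ 2 * expNegInvGlue (1 - s) := by
  have h := expNegInvGlue.hasDerivAt_polynomial_eval_inv_mul 1 (1 - s)
  simp only [Polynomial.eval_one, one_mul, Polynomial.derivative_one, sub_zero, mul_one,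
    Polynomial.eval_pow, Polynomial.eval_X] at h
  have h2 := h.comp s ((hasDerivAt_id s).const_sub 1)
  have h3 : HasDerivAt Kp (((1 - s)⁻¹) ^ 2 * expNegInvGlue (1 - s) * (-1)) s := h2
  rw [th, h3.deriv]; ring

lemma th_nonneg (s : ℝ) : 0 ≤ th s := by
  rw [th_eq]; exact mul_nonneg (sq_nonneg _) (expNegInvGlue.nonneg _)

lemma th_zero {s : ℝ} (hs : 1 ≤ s) : th s = 0 := by
  rw [th_eq, expNegInvGlue.zero_of_nonpos (by linarith), mul_zero]

lemma Kp_zero {s : ℝ} (hs : 1 ≤ s) : Kp s = 0 := expNegInvGlue.zero_of_nonpos (by linarith)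

lemma th_low {s : ℝ} (h0 : 0 ≤ s) (hs : s ≤ 1 / 2) : expNegInvGlue (1 / 2) ≤ th s := by
  rw [th_eq]
  have h1 : (1 : ℝ) ≤ (1 - s)⁻¹ := (one_le_inv₀ (by linarith)).2 (by linarith)
  have h2 : expNegInvGlue (1 / 2) ≤ expNegInvGlue (1 - s) := expNegInvGlue.monotone (by linarith)
  have h3 := expNegInvGlue.nonneg (1 - s)
  exact h2.trans (le_mul_of_one_le_left h3 (one_le_pow₀ h1))

lemma deriv_th_zero {s : ℝ} (hs : 1 < s) : deriv th s = 0 := by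
  have : th =ᶠ[𝓝 s] fun _ => 0 := by
    filter_upwards [lt_mem_nhds hs] with x hx using th_zero hx.le
  rw [this.deriv_eq]; simp

lemma exists_th_bound : ∃ C : ℝ, 0 < C ∧ ∀ s, 0 ≤ s → |th s| ≤ C ∧ |deriv th s| ≤ C := by
  have hd : Continuous (deriv th) := contDiff_th.continuous_deriv (by simp)
  obtain ⟨C1, h1⟩ := isCompact_Icc.exists_bound_of_continuousOn
    (contDiff_th.continuous.continuousOn (s := Icc (0 : ℝ) 1))
  obtain ⟨C2, h2⟩ := isCompact_Icc.exists_bound_of_continuousOn (hd.continuousOn (s := Icc (0 : ℝ) 1))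
  refine ⟨max (max C1 C2) 1, by positivity, fun s hs => ?_⟩
  rcases le_or_gt s 1 with h | h
  · exact ⟨(h1 s ⟨hs, h⟩).trans (by simp), (h2 s ⟨hs, h⟩).trans (by simp)⟩
  · rw [th_zero h.le, deriv_th_zero h]; simp

lemma contDiff_mv (B : Matrix (Fin d) (Fin d) ℝ) (k : Fin d) {n : WithTop ℕ∞} :
    ContDiff ℝ n (fun y : Eu d => mv B y k) := by
  simp only [mv_apply]
  exact ContDiff.sum fun j _ => contDiff_const.mul (contDiff_coord j)

lemma pd_mv (B : Matrix (Fin d) (Fin d) ℝ) (i k : Fin d) (y : Eu d) :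
    pd i (fun y : Eu d => mv B y k) y = B k i := by
  simp only [mv_apply]
  rw [pd_sum _ _ (fun j _ => ((contDiff_const.mul (contDiff_coord j)).differentiable
    (one_ne_zero)) y)]
  have : ∀ j, pd i (fun y : Eu d => B k j * y j) y = B k j * if j = i then 1 else 0 := by
    intro j
    rw [pd_const_mul (f := fun y : Eu d => y j) i _ ((contDiff_coord j).differentiable one_ne_zero y),
      pd_coord]
  simp [this]

lemma bform_eq_sum_mv (B : Matrix (Fin d) (Fin d) ℝ) (y z : Eu d) :
    bform B y z = ∑ k, mv B y k * z k := by
  rw [bform_eq_inner, PiLp.inner_apply]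
  refine Finset.sum_congr rfl fun i _ => by simp [mul_comm]

lemma contDiff_q (B : Matrix (Fin d) (Fin d) ℝ) {n : WithTop ℕ∞} :
    ContDiff ℝ n (fun y : Eu d => bform B y y) := by
  simp only [bform_eq_sum_mv]
  exact ContDiff.sum fun j _ => (contDiff_mv B j).mul (contDiff_coord j)

lemma pd_q {B : Matrix (Fin d) (Fin d) ℝ} (hB : ∀ i j, B i j = B j i) (i : Fin d) (y : Eu d) :
    pd i (fun y : Eu d => bform B y y) y = 2 * mv B y i := by
  simp only [bform_eq_sum_mv]
  rw [pd_sum _ _ (fun j _ => (((contDiff_mv B j).mul (contDiff_coord j)).differentiable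
    (one_ne_zero)) y)]
  have : ∀ j, pd i (fun y : Eu d => mv B y j * y j) y = B i j * y j + mv B y j * if j = i then 1 else 0 := by
    intro j
    rw [pd_mul (f := fun y : Eu d => mv B y j) (g := fun y : Eu d => y j) i
      ((contDiff_mv B j).differentiable one_ne_zero y)
      ((contDiff_coord j).differentiable one_ne_zero y), pd_coord, pd_mv, hB]
  simp only [this, Finset.sum_add_distrib]
  simp [mv_apply]; ring

/-- the kernel `η` -/
def eta (B : Matrix (Fin d) (Fin d) ℝ) (y : Eu d) : ℝ := th (bform B y y)
/-- the potential `κ` -/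
def kap (B : Matrix (Fin d) (Fin d) ℝ) (y : Eu d) : ℝ := 2⁻¹ * Kp (bform B y y)

lemma contDiff_eta (B : Matrix (Fin d) (Fin d) ℝ) : ContDiff ℝ ∞ (eta B) :=
  contDiff_th.comp (contDiff_q B)

lemma contDiff_kap (B : Matrix (Fin d) (Fin d) ℝ) : ContDiff ℝ ∞ (kap B) :=
  contDiff_const.mul (contDiff_Kp.comp (contDiff_q B))

lemma pd_kap {B : Matrix (Fin d) (Fin d) ℝ} (hB : ∀ i j, B i j = B j i) (i : Fin d) :
    pd i (kap B) = fun y => -(eta B y * mv B y i) := by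
  funext y
  have h1 : DifferentiableAt ℝ (fun y : Eu d => bform B y y) y :=
    (contDiff_q B).differentiable one_ne_zero y
  have h2 := pd_comp (f := fun y : Eu d => bform B y y) i (hasDerivAt_Kp (bform B y y)) h1
  have h3 : DifferentiableAt ℝ (fun y : Eu d => Kp (bform B y y)) y :=
    (contDiff_Kp.comp (contDiff_q B)).differentiable (by simp) y
  have h4 : pd i (kap B) y = 2⁻¹ * pd i (fun y => Kp (bform B y y)) y := pd_const_mul i _ h3
  rw [h4, h2, pd_q hB, eta]; ring

lemma pd_eta {B : Matrix (Fin d) (Fin d) ℝ} (hB : ∀ i j, B i j = B j i) (i : Fin d) (y : Eu d) :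
    pd i (eta B) y = deriv th (bform B y y) * (2 * mv B y i) := by
  have h1 : DifferentiableAt ℝ (fun y : Eu d => bform B y y) y :=
    (contDiff_q B).differentiable one_ne_zero y
  have h2 := pd_comp (f := fun y : Eu d => bform B y y) i ((contDiff_th.differentiable (by simp) (bform B y y)).hasDerivAt) h1
  rw [pd_q hB] at h2
  exact h2

lemma pd_pd_kap {B : Matrix (Fin d) (Fin d) ℝ} (hB : ∀ i j, B i j = B j i) (i k : Fin d) (y : Eu d) :
    pd k (pd i (kap B)) y = -(pd k (eta B) y * mv B y i + eta B y * B i k) := by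
  rw [pd_kap hB]
  have h1 : DifferentiableAt ℝ (eta B) y := (contDiff_eta B).differentiable (by simp) y
  have h2 : DifferentiableAt ℝ (fun y => mv B y i) y := (contDiff_mv B i).differentiable one_ne_zero y
  have h3 := pd_mul k h1 h2
  have h4 := pd_const_mul k (-1) (h1.fun_mul h2)
  rw [h3, pd_mv] at h4
  simpa using h4

namespace Ell
variable {lam : ℝ} {A : Matrix (Fin d) (Fin d) ℝ}

lemma q_nonneg (hA : Ell lam A) (hl : 0 < lam) (y : Eu d) : 0 ≤ bform A⁻¹ y y :=
  (sq_nonneg _).trans (hA.q_ge hl y)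

lemma one_lt_q (hA : Ell lam A) (hl : 0 < lam) {y : Eu d} (hy : y ∉ closedBall (0 : Eu d) 1) :
    1 < bform A⁻¹ y y := by
  have h := hA.q_ge hl y
  simp at hy
  nlinarith

lemma tsupport_eta (hA : Ell lam A) (hl : 0 < lam) : tsupport (eta A⁻¹) ⊆ closedBall 0 1 := by
  refine closure_minimal (fun y hy => ?_) isClosed_closedBall
  by_contra hn
  exact hy (th_zero (hA.one_lt_q hl hn).le)

lemma tsupport_kap (hA : Ell lam A) (hl : 0 < lam) : tsupport (kap A⁻¹) ⊆ closedBall 0 1 := by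
  refine closure_minimal (fun y hy => ?_) isClosed_closedBall
  by_contra hn
  exact hy (by rw [kap, Kp_zero (hA.one_lt_q hl hn).le, mul_zero])

lemma cs_eta (hA : Ell lam A) (hl : 0 < lam) : HasCompactSupport (eta A⁻¹) :=
  (isCompact_closedBall 0 1).of_isClosed_subset (isClosed_tsupport _) (hA.tsupport_eta hl)

lemma cs_kap (hA : Ell lam A) (hl : 0 < lam) : HasCompactSupport (kap A⁻¹) :=
  (isCompact_closedBall 0 1).of_isClosed_subset (isClosed_tsupport _) (hA.tsupport_kap hl)

lemma sum_pd_kap (hA : Ell lam A) (hl : 0 < lam) (j : Fin d) (y : Eu d) :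
    ∑ k, A j k * pd k (kap A⁻¹) y = -(eta A⁻¹ y * y j) := by
  have h := congrArg (fun z : Eu d => z j) (hA.mv_mv_inv hl y)
  simp only [mv_apply A] at h
  rw [← h]
  simp only [pd_kap hA.inv_symm, Finset.mul_sum, ← Finset.sum_neg_distrib]
  refine Finset.sum_congr rfl fun k _ => by ring

lemma sum_pd_pd_kap (hA : Ell lam A) (hl : 0 < lam) (i j : Fin d) (y : Eu d) :
    ∑ k, A j k * pd k (pd i (kap A⁻¹)) y =
      -(pd i (eta A⁻¹) y * y j + eta A⁻¹ y * if j = i then 1 else 0) := by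
  have hk : ∀ k, ContDiff ℝ ∞ (pd k (kap A⁻¹)) := fun k => contDiff_pd_top (contDiff_kap _) k
  have h1 : ∀ k, pd k (pd i (kap A⁻¹)) y = pd i (pd k (kap A⁻¹)) y := fun k =>
    pd_comm ((contDiff_kap _).of_le two_le_inf) k i y
  simp only [h1]
  have h2 : pd i (fun y => ∑ k, A j k * pd k (kap A⁻¹) y) y = ∑ k, A j k * pd i (pd k (kap A⁻¹)) y := by
    rw [pd_sum _ _ fun k _ => (contDiff_const.mul (hk k)).differentiable (by simp) y]
    refine Finset.sum_congr rfl fun k _ => ?_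
    exact pd_const_mul i _ ((hk k).differentiable (by simp) y)
  rw [← h2]
  simp only [hA.sum_pd_kap hl]
  have h3 := pd_mul i ((contDiff_eta A⁻¹).differentiable (by simp) y)
    ((contDiff_coord j).differentiable one_ne_zero y)
  rw [pd_coord] at h3
  have h4 := pd_const_mul i (-1) (((contDiff_eta A⁻¹).differentiable (by simp) y).fun_mul
    ((contDiff_coord j).differentiable one_ne_zero y))
  rw [h3] at h4
  simpa using h4
end Ell

/-- uniform bounds on the kernels -/
lemma exists_kernel_bounds {lam : ℝ} (hl : 0 < lam) : ∃ C : ℝ, 0 < C ∧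
    ∀ {d : ℕ} (A : Matrix (Fin d) (Fin d) ℝ), Ell lam A → ∀ (y : Eu d) (i k : Fin d),
      |eta A⁻¹ y| ≤ C ∧ |pd i (eta A⁻¹) y| ≤ C ∧ |pd i (kap A⁻¹) y| ≤ C ∧
      |pd k (pd i (kap A⁻¹)) y| ≤ C := by
  obtain ⟨C, hC, h⟩ := exists_th_bound
  refine ⟨C + 2 * C / lam + (C / lam) + (2 * C / lam / lam + C / lam), by positivity, ?_⟩
  intro d A hA y i k
  have hq := hA.q_nonneg hl y
  have e1 : |eta A⁻¹ y| ≤ C := (h _ hq).1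
  by_cases hy : y ∈ closedBall (0 : Eu d) 1
  · have hm : ∀ i, |mv A⁻¹ y i| ≤ 1 / lam := fun i => by
      refine (abs_coord_le _ _).trans ((hA.norm_inv_le hl y).trans ?_)
      have : ‖y‖ ≤ 1 := by simpa using hy
      gcongr
    have e2 : ∀ i, |pd i (eta A⁻¹) y| ≤ 2 * C / lam := fun i => by
      rw [pd_eta hA.inv_symm, abs_mul, abs_mul, abs_two]
      calc _ ≤ C * (2 * (1 / lam)) := by
            gcongr
            · exact (h _ hq).2
            · exact hm i
        _ = _ := by ring
    have e3 : |pd i (kap A⁻¹) y| ≤ C / lam := by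
      rw [pd_kap hA.inv_symm, abs_neg, abs_mul]
      calc _ ≤ C * (1 / lam) := by
            gcongr
            exact hm i
        _ = _ := by ring
    have e4 : |pd k (pd i (kap A⁻¹)) y| ≤ 2 * C / lam / lam + C / lam := by
      rw [pd_pd_kap hA.inv_symm, abs_neg]
      refine (abs_add_le _ _).trans ?_
      rw [abs_mul, abs_mul]
      calc _ ≤ (2 * C / lam) * (1 / lam) + C * (1 / lam) := by
            gcongr
            · exact e2 k
            · exact hm i
            · exact hA.abs_inv_le hl i k
        _ = _ := by ring
    have p1 : 0 < C / lam := by positivity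
    have p2 : 0 < 2 * C / lam := by positivity
    have p3 : 0 < 2 * C / lam / lam := by positivity
    refine ⟨by linarith, by linarith [e2 i], by linarith, by linarith⟩
  · have hs1 : y ∉ tsupport (eta A⁻¹) := fun hh => hy (hA.tsupport_eta hl hh)
    have hs2 : y ∉ tsupport (kap A⁻¹) := fun hh => hy (hA.tsupport_kap hl hh)
    rw [image_eq_zero_of_notMem_tsupport hs1,
      image_eq_zero_of_notMem_tsupport (fun hh => hs1 (tsupport_pd _ i hh)),
      image_eq_zero_of_notMem_tsupport (fun hh => hs2 (tsupport_pd _ i hh)),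
      image_eq_zero_of_notMem_tsupport (fun hh => hs2 (tsupport_pd _ i (tsupport_pd _ k hh)))]
    simp only [abs_zero]
    refine ⟨?_, ?_, ?_, ?_⟩ <;> positivity

lemma exists_eta_int (d : ℕ) {lam : ℝ} (hl : 0 < lam) : ∃ c : ℝ, 0 < c ∧
    ∀ A : Matrix (Fin d) (Fin d) ℝ, Ell lam A → c ≤ ∫ y, eta A⁻¹ y := by
  set m := expNegInvGlue (1 / 2) with hm
  have hm0 : 0 < m := expNegInvGlue.pos_of_pos (by norm_num)
  set s := closedBall (0 : Eu d) (Real.sqrt (lam / 2)) with hs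
  have hvol : 0 < volume.real s := by
    refine ENNReal.toReal_pos ?_ ?_
    · exact (Metric.measure_closedBall_pos _ _ (by positivity)).ne'
    · exact (isCompact_closedBall _ _).measure_lt_top.ne
  refine ⟨m * volume.real s, by positivity, fun A hA => ?_⟩
  have h_int0 : Integrable (eta A⁻¹) := (contDiff_eta _).continuous.integrable_of_hasCompactSupport
    (hA.cs_eta hl)
  calc m * volume.real s = ∫ y in s, m := by simp [mul_comm]
    _ ≤ ∫ y in s, eta A⁻¹ y := by
        refine setIntegral_mono_on ?_ h_int0.integrableOn measurableSet_closedBall fun y hy => ?_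
        · exact integrableOn_const (isCompact_closedBall _ _).measure_lt_top.ne
        · refine th_low (hA.q_nonneg hl y) ((hA.q_le hl y).trans ?_)
          have : ‖y‖ ≤ Real.sqrt (lam / 2) := by simpa [hs] using hy
          have h2 : ‖y‖ ^ 2 ≤ lam / 2 := by
            calc ‖y‖ ^ 2 ≤ Real.sqrt (lam / 2) ^ 2 := by gcongr
              _ = lam / 2 := Real.sq_sqrt (by positivity)
          rw [div_le_iff₀ hl]; linarith
    _ ≤ _ := setIntegral_le_integral h_int0 (Filter.Eventually.of_forall fun y => th_nonneg _)

lemma abs_integral_le_of_support {f : Eu d → ℝ} {s : Set (Eu d)} (hs : IsCompact s) {C : ℝ}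
    (h0 : ∀ x ∉ s, f x = 0) (h : ∀ x ∈ s, |f x| ≤ C) : |∫ x, f x| ≤ C * volume.real s := by
  rw [← setIntegral_eq_integral_of_forall_compl_eq_zero h0]
  exact norm_setIntegral_le_of_norm_le_const (f := f) hs.measure_lt_top h

lemma exists_pd_bound {v : Eu d → ℝ} (hv : ContDiff ℝ 1 v) (hc : HasCompactSupport v) :
    ∃ G : ℝ, 0 ≤ G ∧ ∀ x i, |pd i v x| ≤ G := by
  obtain ⟨C, hC⟩ := (hv.continuous_fderiv one_ne_zero).bounded_above_of_compact_support
    (hc.fderiv (𝕜 := ℝ))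
  exact ⟨C, (norm_nonneg _).trans (hC 0), fun x i => (abs_pd_le v x i).trans (hC x)⟩

lemma integrable_cs {f : Eu d → ℝ} (hf : Continuous f) (hc : HasCompactSupport f) : Integrable f :=
  hf.integrable_of_hasCompactSupport hc

lemma hasDerivAt_scale {v h : Eu d → ℝ} (hv : ContDiff ℝ 1 v) (hvc : HasCompactSupport v)
    (hh : Continuous h) (hc : HasCompactSupport h) (t : ℝ) :
    HasDerivAt (fun t : ℝ => ∫ y, v (t • y) * h y)
      (∫ y, (∑ j, y j * pd j v (t • y)) * h y) t := by
  obtain ⟨G, hG0, hG⟩ := exists_pd_bound hv hvc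
  have hcont : ∀ t : ℝ, Continuous fun y : Eu d => v (t • y) * h y := fun t =>
    (hv.continuous.comp (continuous_const_smul t)).mul hh
  have hcp : ∀ j, Continuous (pd j v) := fun j => continuous_pd hv j
  have hcoord : ∀ j : Fin d, Continuous fun y : Eu d => y j := fun j => (contDiff_coord (n := 0) j).continuous
  have hcont' : Continuous fun y : Eu d => (∑ j, y j * pd j v (t • y)) * h y :=
    (continuous_finsetSum _ fun j _ => (hcoord j).mul
      ((hcp j).comp (continuous_const_smul t))).mul hh
  have hb : Continuous fun y : Eu d => (∑ _j : Fin d, ‖y‖ * G) * |h y| := by fun_prop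
  refine (hasDerivAt_integral_of_dominated_loc_of_deriv_le (s := univ)
    (F := fun t y => v (t • y) * h y) (F' := fun t y => (∑ j, y j * pd j v (t • y)) * h y)
    (bound := fun y => (∑ _j : Fin d, ‖y‖ * G) * |h y|)
    Filter.univ_mem (Filter.Eventually.of_forall fun t => (hcont t).aestronglyMeasurable)
    (integrable_cs (hcont t) hc.mul_left) hcont'.aestronglyMeasurable
    (Filter.Eventually.of_forall fun y t _ => ?_)
    (integrable_cs hb ?_)
    (Filter.Eventually.of_forall fun y t _ => ?_)).2
  · rw [Real.norm_eq_abs, abs_mul]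
    gcongr
    refine (Finset.abs_sum_le_sum_abs _ _).trans (Finset.sum_le_sum fun j _ => ?_)
    rw [abs_mul]
    exact mul_le_mul (abs_coord_le y j) (hG _ j) (abs_nonneg _) (norm_nonneg _)
  · exact hc.abs.mul_left
  · have h1 : HasDerivAt (fun t : ℝ => t • y) ((1 : ℝ) • y) t := (hasDerivAt_id t).smul_const y
    have h2 := (hv.differentiable one_ne_zero (t • y)).hasFDerivAt.comp_hasDerivAt t h1
    rw [one_smul, fderiv_apply_eq] at h2
    exact h2.mul_const (h y)

lemma star_err {lam M : ℝ} {A : Eu d → Matrix (Fin d) (Fin d) ℝ} (hA : Coef lam M A)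
    {v : Eu d → ℝ} (hM : 0 ≤ M) {G C : ℝ} (hG : ∀ x ∈ closedBall (0 : Eu d) 1, ∀ k, |pd k v x| ≤ G)
    {g : Fin d → Eu d → ℝ} (hgC : ∀ k y, |g k y| ≤ C)
    (hgs : ∀ k, ∀ y ∉ closedBall (0 : Eu d) 1, g k y = 0) {t : ℝ} (h0 : 0 ≤ t) (h1 : t ≤ 1) :
    |∫ y, ∑ k, ∑ j, (A 0 k j - A (t • y) k j) * pd j v (t • y) * g k y|
      ≤ (∑ _k : Fin d, ∑ _j : Fin d, (M * t) * G * C) * volume.real (closedBall (0 : Eu d) 1) := by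
  refine abs_integral_le_of_support (isCompact_closedBall _ _) (fun y hy => ?_) (fun y hy => ?_)
  · simp [hgs _ y hy]
  · have hy1 : ‖y‖ ≤ 1 := by simpa using hy
    have hty : t • y ∈ closedBall (0 : Eu d) 1 := by
      simp only [mem_closedBall, dist_zero_right, norm_smul, Real.norm_eq_abs, abs_of_nonneg h0]
      nlinarith [norm_nonneg y]
    refine (Finset.abs_sum_le_sum_abs _ _).trans (Finset.sum_le_sum fun k _ => ?_)
    refine (Finset.abs_sum_le_sum_abs _ _).trans (Finset.sum_le_sum fun j _ => ?_)
    rw [abs_mul, abs_mul]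
    have e1 : |A 0 k j - A (t • y) k j| ≤ M * t := by
      refine (hA.lip _ _ k j).trans ?_
      rw [zero_sub, norm_neg, norm_smul, Real.norm_eq_abs, abs_of_nonneg h0]
      gcongr
      nlinarith [norm_nonneg y]
    have hG0 : 0 ≤ G := (abs_nonneg _).trans (hG _ hty j)
    gcongr
    · exact hG _ hty j
    · exact hgC k y

lemma Sol.weak_scale {lam M : ℝ} {Ω : Set (Eu d)} {A : Eu d → Matrix (Fin d) (Fin d) ℝ} {v : Eu d → ℝ}
    (h : Sol lam M Ω A v) (hΩ : closedBall (0 : Eu d) 1 ⊆ Ω) {ψ : Eu d → ℝ} (hψ : ContDiff ℝ ∞ ψ)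
    (hs : tsupport ψ ⊆ closedBall 0 1) {t : ℝ} (h0 : 0 < t) (h1 : t ≤ 1) :
    ∫ y, ∑ k, ∑ j, A (t • y) k j * pd j v (t • y) * pd k ψ y = 0 := by
  have hS := h.affine 0 h0 1
  have hc : HasCompactSupport ψ :=
    (isCompact_closedBall 0 1).of_isClosed_subset (isClosed_tsupport _) hs
  have hw := hS.weak ψ hψ hc (fun y hy => hΩ (by
    have hy1 : ‖y‖ ≤ 1 := by simpa using hs hy
    simp only [zero_add, mem_closedBall, dist_zero_right, norm_smul, Real.norm_eq_abs, abs_of_pos h0]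
    nlinarith [norm_nonneg y]))
  have e : ∀ y, (∑ i, ∑ j, A (0 + t • y) i j * pd j (fun x => 1 * v (0 + t • x)) y * pd i ψ y)
      = t * ∑ k, ∑ j, A (t • y) k j * pd j v (t • y) * pd k ψ y := by
    intro y
    simp only [Finset.mul_sum]
    refine Finset.sum_congr rfl fun i _ => Finset.sum_congr rfl fun j _ => ?_
    simp only [one_mul]
    rw [pd_affine (f := v) (y := 0) j t (h.c1.differentiable one_ne_zero _), zero_add]
    ring
  simp only [e] at hw
  rw [integral_const_mul] at hw
  exact (mul_eq_zero.1 hw).resolve_left h0.ne'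

lemma star_cont {v h : Eu d → ℝ} (hv : Continuous v) (hvc : HasCompactSupport v)
    (hh : Continuous h) (hc : HasCompactSupport h) :
    Continuous (fun t : ℝ => ∫ y, v (t • y) * h y) := by
  obtain ⟨G, hG⟩ := hv.bounded_above_of_compact_support hvc
  refine continuous_of_dominated (F := fun (t : ℝ) (y : Eu d) => v (t • y) * h y)
    (bound := fun y => G * |h y|) (fun t => ?_) (fun t => ?_) ?_ ?_
  · exact ((hv.comp (continuous_const_smul t)).mul hh).aestronglyMeasurable
  · refine Filter.Eventually.of_forall fun y => ?_
    rw [norm_mul]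
    exact mul_le_mul_of_nonneg_right (hG _) (abs_nonneg _)
  · exact integrable_cs (by fun_prop) (HasCompactSupport.mul_left hc.abs)
  · exact Filter.Eventually.of_forall fun y => by fun_prop

/-- the basic representation estimate (★) at unit scale -/
theorem star_unit (d : ℕ) {lam : ℝ} (hl : 0 < lam) : ∃ C : ℝ, 0 < C ∧
    ∀ (M : ℝ) (Ω : Set (Eu d)) (A : Eu d → Matrix (Fin d) (Fin d) ℝ) (v : Eu d → ℝ), 0 ≤ M →
      Sol lam M Ω A v → closedBall (0 : Eu d) 1 ⊆ Ω →
      ∀ G, 0 ≤ G → (∀ x ∈ closedBall (0 : Eu d) 1, ∀ k, |pd k v x| ≤ G) →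
      (∀ i, |(∫ y, eta (A 0)⁻¹ y) * pd i v 0 + ∫ y, v y * pd i (eta (A 0)⁻¹) y| ≤ C * M * G) ∧
      |(∫ y, eta (A 0)⁻¹ y) * v 0 - ∫ y, v y * eta (A 0)⁻¹ y| ≤ C * M * G := by
  obtain ⟨C, hC, hb⟩ := exists_kernel_bounds hl
  set V := volume.real (closedBall (0 : Eu d) 1) with hV
  have hV0 : 0 ≤ V := measureReal_nonneg
  refine ⟨(d * (d * C)) * V + 1, by positivity, ?_⟩
  intro M Ω A v hM hS hΩ G hG0 hG
  have hA0 : Ell lam (A 0) := hS.ell 0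
  set η := eta (A 0)⁻¹ with hη
  set κ := kap (A 0)⁻¹ with hκ
  have hηs := contDiff_eta (A 0)⁻¹
  have hκs := contDiff_kap (A 0)⁻¹
  have hηc := hA0.cs_eta hl
  have hκc := hA0.cs_kap hl
  rw [← hη] at hηs hηc
  rw [← hκ] at hκs hκc
  have hv1 := hS.c1
  have hvc := hS.cs
  have hvp : ∀ j, Continuous (pd j v) := fun j => continuous_pd hv1 j
  have hsup : ∀ {f : Eu d → ℝ}, tsupport f ⊆ closedBall (0 : Eu d) 1 →
      ∀ y ∉ closedBall (0 : Eu d) 1, f y = 0 := fun hf y hy =>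
    image_eq_zero_of_notMem_tsupport fun hh => hy (hf hh)
  have hcoord : ∀ j : Fin d, Continuous fun y : Eu d => y j :=
    fun j => (contDiff_coord (n := 0) j).continuous
  -- bound for the error
  have hsum : ∀ t : ℝ, (∑ _k : Fin d, ∑ _j : Fin d, (M * t) * G * C) * V = (d * (d * C)) * V * (M * G) * t := by
    intro t; simp; ring
  -- splitting
  have split : ∀ (ψ : Eu d → ℝ), ContDiff ℝ ∞ ψ → tsupport ψ ⊆ closedBall 0 1 →
      (∀ k y, |pd k ψ y| ≤ C) → ∀ t : ℝ, 0 < t → t ≤ 1 →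
      |∫ y, ∑ j, pd j v (t • y) * (∑ k, A 0 j k * pd k ψ y)| ≤ (d * (d * C)) * V * (M * G) * t := by
    intro ψ hψ hψs hψC t h0 h1
    have hψc : HasCompactSupport ψ :=
      (isCompact_closedBall 0 1).of_isClosed_subset (isClosed_tsupport _) hψs
    have hw := hS.weak_scale hΩ hψ hψs h0 h1
    have he := star_err hS.toCoef hM hG hψC
      (fun k => hsup ((tsupport_pd ψ k).trans hψs)) h0.le h1
    rw [hsum] at he
    refine le_trans (le_of_eq ?_) he
    congr 1
    have h_int0 : ∀ a : Fin d → Fin d → Eu d → ℝ, (∀ k j, Continuous (a k j)) →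
        Integrable fun y => ∑ k, ∑ j, a k j y * pd j v (t • y) * pd k ψ y := by
      intro a ha
      refine integrable_finsetSum _ fun k _ => integrable_finsetSum _ fun j _ => ?_
      refine integrable_cs ?_ ((hasCompactSupport_pd hψc k).mul_left)
      exact ((ha k j).mul ((hvp j).comp (continuous_const_smul t))).mul
        (continuous_pd (hψ.of_le one_le_inf) k)
    have hsub : (∫ y, ∑ k, ∑ j, (A 0 k j - A (t • y) k j) * pd j v (t • y) * pd k ψ y)
        = (∫ y, ∑ k, ∑ j, A 0 k j * pd j v (t • y) * pd k ψ y) -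
          ∫ y, ∑ k, ∑ j, A (t • y) k j * pd j v (t • y) * pd k ψ y := by
      rw [← integral_sub (h_int0 (fun k j _ => A 0 k j) fun k j => continuous_const)
        (h_int0 (fun k j y => A (t • y) k j) fun k j =>
          (hS.toCoef.cont k j).comp (continuous_const_smul t))]
      congr 1; funext y
      simp only [← Finset.sum_sub_distrib]
      refine Finset.sum_congr rfl fun i _ => Finset.sum_congr rfl fun j _ => by ring
    rw [hsub, hw, sub_zero]
    congr 1; funext y
    simp only [Finset.mul_sum]
    rw [Finset.sum_comm]
    refine Finset.sum_congr rfl fun i _ => Finset.sum_congr rfl fun j _ => ?_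
    rw [hA0.symm j i]; ring
  constructor
  · intro i
    -- g(t)
    set g : ℝ → ℝ := fun t => ∫ y, pd i v (t • y) * η y with hg
    have hgc : Continuous g := star_cont (hvp i) (hasCompactSupport_pd hvc i) hηs.continuous hηc
    set F : ℝ → ℝ := fun t => ∫ y, v (t • y) * pd i η y with hF
    have hηi : Continuous (pd i η) := continuous_pd (hηs.of_le one_le_inf) i
    have hηic := hasCompactSupport_pd hηc i
    have hFd : ∀ t, HasDerivAt F (∫ y, (∑ j, y j * pd j v (t • y)) * pd i η y) t :=
      fun t => hasDerivAt_scale hv1 hvc hηi hηic t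
    have hgF : ∀ t : ℝ, F t = - (t * g t) := by
      intro t
      have h1 : ContDiff ℝ 1 fun y : Eu d => v (0 + t • y) :=
        hv1.comp (contDiff_const.add (contDiff_id.const_smul t))
      have h2 := integral_pd_mul h1 (hηs.of_le one_le_inf) hηc i
      have h3 : ∀ y, pd i (fun y : Eu d => v (0 + t • y)) y = t * pd i v (t • y) := by
        intro y
        rw [pd_affine (f := v) (y := 0) i t (hv1.differentiable one_ne_zero _), zero_add]
      simp only [h3] at h2
      simp only [zero_add, mul_assoc] at h2
      rw [integral_const_mul] at h2
      simp only [hF, hg]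
      linarith
    have hR : ∀ t : ℝ, 0 < t → t ≤ 1 →
        |g t + ∫ y, (∑ j, y j * pd j v (t • y)) * pd i η y| ≤ (d * (d * C)) * V * (M * G) * t := by
      intro t h0 h1
      have hh := split (pd i κ) (contDiff_pd_top hκs i)
        ((tsupport_pd _ i).trans (hA0.tsupport_kap hl)) (fun k y => (hb (A 0) hA0 y i k).2.2.2) t h0 h1
      refine le_trans (le_of_eq ?_) hh
      rw [← abs_neg]
      congr 1
      have e : ∀ y, (∑ j, pd j v (t • y) * ∑ k, A 0 j k * pd k (pd i κ) y)
          = -(pd i v (t • y) * η y + (∑ j, y j * pd j v (t • y)) * pd i η y) := by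
        intro y
        simp only [hκ, hA0.sum_pd_pd_kap hl, mul_neg, mul_add, Finset.sum_neg_distrib,
          Finset.sum_add_distrib, Finset.sum_mul]
        rw [add_comm]
        congr 1; congr 1
        · simp [hη]
        · refine Finset.sum_congr rfl fun j _ => by ring
      simp only [e]
      rw [integral_neg, integral_add]
      · exact integrable_cs (((hvp i).comp (continuous_const_smul t)).mul hηs.continuous) hηc.mul_left
      · exact integrable_cs ((continuous_finsetSum _ fun j _ => (hcoord j).mul
          ((hvp j).comp (continuous_const_smul t))).mul hηi) hηic.mul_left
    -- derivative of g
    have hgd : ∀ t : ℝ, 0 < t → ∃ g', HasDerivAt g g' t ∧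
        t * g' = -(g t + ∫ y, (∑ j, y j * pd j v (t • y)) * pd i η y) := by
      intro t h0
      have h1 : HasDerivAt (fun s => -(F s) / s) _ t := (hFd t).neg.div (hasDerivAt_id t) h0.ne'
      refine ⟨_, h1.congr_of_eventuallyEq ?_, ?_⟩
      · filter_upwards [lt_mem_nhds h0] with s hs
        rw [hgF s]; field_simp
      · simp only [Pi.neg_apply, id, hgF t]
        field_simp; ring
    have hgb : ∀ t : ℝ, 0 < t → t ≤ 1 → ∀ g', HasDerivAt g g' t → |g'| ≤ (d * (d * C)) * V * (M * G) := by
      intro t h0 h1 g' hg'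
      obtain ⟨g'', h2, h3⟩ := hgd t h0
      rw [hg'.unique h2]
      have h4 := hR t h0 h1
      rw [← abs_neg, ← h3, abs_mul, abs_of_pos h0] at h4
      have : t * |g''| ≤ t * ((d * (d * C)) * V * (M * G)) := by linarith
      exact le_of_mul_le_mul_left this h0
    have hgs : ∀ s : ℝ, 0 < s → s ≤ 1 → |g 1 - g s| ≤ (d * (d * C)) * V * (M * G) := by
      intro s h0 h1
      have := (convex_Icc s 1).norm_image_sub_le_of_norm_hasDerivWithin_le (f := g) (f' := deriv g)
        (C := (d * (d * C)) * V * (M * G)) (x := s) (y := 1)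
        (fun x hx => by
          obtain ⟨g', h2, _⟩ := hgd x (h0.trans_le hx.1)
          rw [h2.deriv]; exact h2.hasDerivWithinAt)
        (fun x hx => by
          obtain ⟨g', h2, _⟩ := hgd x (h0.trans_le hx.1)
          rw [h2.deriv]; exact hgb x (h0.trans_le hx.1) hx.2 g' h2)
        ⟨le_rfl, h1⟩ ⟨h1, le_rfl⟩
      refine this.trans (mul_le_of_le_one_right (by positivity) ?_)
      rw [Real.norm_eq_abs, abs_of_nonneg (by linarith)]; linarith
    have hlim : |g 1 - g 0| ≤ (d * (d * C)) * V * (M * G) := by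
      have ht : Filter.Tendsto (fun s => |g 1 - g s|) (𝓝[>] 0) (𝓝 (|g 1 - g 0|)) :=
        ((continuous_const.sub hgc).abs.tendsto 0).mono_left nhdsWithin_le_nhds
      refine le_of_tendsto ht ?_
      have : Ioc (0 : ℝ) 1 ∈ 𝓝[>] (0 : ℝ) := Ioc_mem_nhdsGT one_pos
      filter_upwards [this] with s hs using hgs s hs.1 hs.2
    have hg0 : g 0 = (∫ y, η y) * pd i v 0 := by
      simp only [hg, zero_smul]
      rw [integral_const_mul, mul_comm]
    have hg1 : ∫ y, v y * pd i η y = - g 1 := by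
      have := hgF 1
      simp only [hF, one_smul, one_mul] at this
      exact this
    rw [hg1, ← hg0]
    calc |g 0 + -g 1| = |g 1 - g 0| := by rw [← abs_neg]; congr 1; ring
      _ ≤ _ := hlim
      _ ≤ _ := by nlinarith [mul_nonneg hM hG0]
  · set f : ℝ → ℝ := fun t => ∫ y, v (t • y) * η y with hf
    have hfc : Continuous f := star_cont hv1.continuous hvc hηs.continuous hηc
    have hfd : ∀ t, HasDerivAt f (∫ y, (∑ j, y j * pd j v (t • y)) * η y) t :=
      fun t => hasDerivAt_scale hv1 hvc hηs.continuous hηc t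
    have hfb : ∀ t : ℝ, 0 < t → t ≤ 1 → |∫ y, (∑ j, y j * pd j v (t • y)) * η y|
        ≤ (d * (d * C)) * V * (M * G) := by
      intro t h0 h1
      have hh := split κ hκs (hA0.tsupport_kap hl) (fun k y => (hb (A 0) hA0 y k k).2.2.1) t h0 h1
      have e : ∀ y, (∑ j, pd j v (t • y) * ∑ k, A 0 j k * pd k κ y)
          = -((∑ j, y j * pd j v (t • y)) * η y) := by
        intro y
        simp only [hκ, hA0.sum_pd_kap hl, mul_neg, Finset.sum_neg_distrib, Finset.sum_mul]
        congr 1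
        refine Finset.sum_congr rfl fun j _ => by rw [← hη]; ring
      simp only [e] at hh
      rw [integral_neg, abs_neg] at hh
      refine hh.trans (mul_le_of_le_one_right (by positivity) h1)
    have hfs : ∀ s : ℝ, 0 < s → s ≤ 1 → |f 1 - f s| ≤ (d * (d * C)) * V * (M * G) := by
      intro s h0 h1
      have := (convex_Icc s 1).norm_image_sub_le_of_norm_hasDerivWithin_le (f := f)
        (C := (d * (d * C)) * V * (M * G)) (x := s) (y := 1)
        (fun x hx => (hfd x).hasDerivWithinAt)
        (fun x hx => hfb x (h0.trans_le hx.1) hx.2)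
        ⟨le_rfl, h1⟩ ⟨h1, le_rfl⟩
      refine this.trans (mul_le_of_le_one_right (by positivity) ?_)
      rw [Real.norm_eq_abs, abs_of_nonneg (by linarith)]; linarith
    have hlim : |f 1 - f 0| ≤ (d * (d * C)) * V * (M * G) := by
      have ht : Filter.Tendsto (fun s => |f 1 - f s|) (𝓝[>] 0) (𝓝 (|f 1 - f 0|)) :=
        ((continuous_const.sub hfc).abs.tendsto 0).mono_left nhdsWithin_le_nhds
      refine le_of_tendsto ht ?_
      have : Ioc (0 : ℝ) 1 ∈ 𝓝[>] (0 : ℝ) := Ioc_mem_nhdsGT one_pos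
      filter_upwards [this] with s hs using hfs s hs.1 hs.2
    have hf0 : f 0 = (∫ y, η y) * v 0 := by
      simp only [hf, zero_smul]
      rw [integral_const_mul, mul_comm]
    have hf1 : ∫ y, v y * η y = f 1 := by simp only [hf, one_smul]
    rw [hf1, ← hf0]
    calc |f 0 - f 1| = |f 1 - f 0| := abs_sub_comm _ _
      _ ≤ _ := hlim
      _ ≤ _ := by nlinarith [mul_nonneg hM hG0]

/-- (★) at a general point and scale -/
theorem star (d : ℕ) {lam : ℝ} (hl : 0 < lam) : ∃ C : ℝ, 0 < C ∧
    ∀ (M : ℝ) (Ω : Set (Eu d)) (A : Eu d → Matrix (Fin d) (Fin d) ℝ) (u : Eu d → ℝ), 0 ≤ M →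
      Sol lam M Ω A u → ∀ (x : Eu d) (r : ℝ), 0 < r → closedBall x r ⊆ Ω →
      ∀ G, 0 ≤ G → (∀ z ∈ closedBall x r, ∀ k, |pd k u z| ≤ G) →
      (∀ i, |(∫ y, eta (A x)⁻¹ y) * (r * pd i u x) + ∫ y, u (x + r • y) * pd i (eta (A x)⁻¹) y|
        ≤ C * (M * r) * (r * G)) ∧
      |(∫ y, eta (A x)⁻¹ y) * u x - ∫ y, u (x + r • y) * eta (A x)⁻¹ y| ≤ C * (M * r) * (r * G) := by
  obtain ⟨C, hC, h⟩ := star_unit d hl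
  refine ⟨C, hC, ?_⟩
  intro M Ω A u hM hS x r hr hΩ G hG0 hG
  have hS' := hS.affine x hr 1
  have hin : ∀ y ∈ closedBall (0 : Eu d) 1, x + r • y ∈ closedBall x r := by
    intro y hy
    have hy1 : ‖y‖ ≤ 1 := by simpa using hy
    simp only [mem_closedBall, dist_self_add_left, norm_smul, Real.norm_eq_abs, abs_of_pos hr]
    nlinarith
  have hp : ∀ y i, pd i (fun y => 1 * u (x + r • y)) y = r * pd i u (x + r • y) := by
    intro y i
    simp only [one_mul]
    exact pd_affine i r (hS.c1.differentiable one_ne_zero _)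
  have h2 := h (M * r) _ _ _ (by positivity) hS' (fun y hy => hΩ (hin y hy)) (r * G) (by positivity)
    (fun y hy k => by
      rw [hp, abs_mul, abs_of_pos hr]
      exact mul_le_mul_of_nonneg_left (hG _ (hin y hy) k) hr.le)
  simp only [hp] at h2
  simpa only [smul_zero, add_zero, one_mul] using h2

lemma kernel_int_bound {f h : Eu d → ℝ} {s : Set (Eu d)} (hs : MeasurableSet s) {C : ℝ} (hC : 0 ≤ C)
    (hf : IntegrableOn f s) (hhC : ∀ y, |h y| ≤ C) (hh0 : ∀ y ∉ closedBall (0 : Eu d) 1, h y = 0)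
    {x : Eu d} {r : ℝ} (hr : 0 < r) (hx : closedBall x r ⊆ s) :
    |∫ y, f (x + r • y) * h y| ≤ C * (r ^ d)⁻¹ * ∫ y in s, |f y| := by
  set g : Eu d → ℝ := s.indicator fun y => |f y| with hg
  have hgi : Integrable g := (integrable_indicator_iff hs).2 hf.abs
  have h1 : ∫ y, g (x + r • y) = (r ^ d)⁻¹ * ∫ y in s, |f y| := by
    rw [integral_affine g x hr, hg, integral_indicator hs]
  rw [mul_assoc, ← h1, ← integral_const_mul]
  have hgi2 : Integrable fun y => g (x + r • y) := by
    have := (integrable_comp_smul_iff (volume : Measure (Eu d)) (fun y => g (x + y)) hr.ne').2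
      (hgi.comp_add_left x)
    exact this
  refine norm_integral_le_of_norm_le (f := fun y => f (x + r • y) * h y) (hgi2.const_mul C)
    (Filter.Eventually.of_forall fun y => ?_)
  rw [norm_mul, Real.norm_eq_abs, Real.norm_eq_abs]
  by_cases hy : y ∈ closedBall (0 : Eu d) 1
  · have hin : x + r • y ∈ s := by
      refine hx ?_
      have hy1 : ‖y‖ ≤ 1 := by simpa using hy
      simp only [mem_closedBall, dist_self_add_left, norm_smul, Real.norm_eq_abs, abs_of_pos hr]
      nlinarith
    rw [hg, indicator_of_mem hin, mul_comm]
    gcongr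
    exact hhC y
  · rw [hh0 y hy, abs_zero, mul_zero]
    have : 0 ≤ g (x + r • y) := indicator_nonneg (fun _ _ => abs_nonneg _) _
    positivity

lemma int_abs_le_sqrt {f : Eu d → ℝ} (hf : Continuous f) (x : Eu d) (r : ℝ) :
    ∫ y in ball x r, |f y| ≤ Real.sqrt (volume.real (ball x r)) * Real.sqrt (∫ y in ball x r, f y ^ 2) := by
  have hi : ∀ g : Eu d → ℝ, Continuous g → IntegrableOn g (ball x r) := fun g hg =>
    (hg.continuousOn.integrableOn_compact (isCompact_closedBall x r)).mono_set ball_subset_closedBall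
  set V := volume.real (ball x r)
  set I := ∫ y in ball x r, |f y|
  set J := ∫ y in ball x r, f y ^ 2
  have hI : 0 ≤ I := integral_nonneg fun _ => abs_nonneg _
  have hJ : 0 ≤ J := integral_nonneg fun _ => sq_nonneg _
  have hV : 0 ≤ V := measureReal_nonneg
  have key : ∀ t : ℝ, 0 ≤ V * (t * t) + (2 * I) * t + J := by
    intro t
    have e : ∫ y in ball x r, (|f y| + t) ^ 2 = V * (t * t) + (2 * I) * t + J := by
      have h1 : ∀ y, (|f y| + t) ^ 2 = (t * t) + (2 * t) * |f y| + f y ^ 2 := by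
        intro y; rw [add_sq, sq_abs]; ring
      simp only [h1]
      have h2 : ∫ y in ball x r, (2 * t) * |f y| = (2 * t) * I := integral_const_mul _ _
      rw [integral_add, integral_add, h2]
      · simp [V, J]; ring
      · exact hi _ continuous_const
      · exact hi _ (by fun_prop)
      · exact hi _ (by fun_prop)
      · exact hi _ (by fun_prop)
    rw [← e]
    exact integral_nonneg fun _ => sq_nonneg _
  have h2 := discrim_le_zero key
  rw [discrim] at h2
  rw [← Real.sqrt_mul hV]
  refine Real.le_sqrt_of_sq_le ?_
  nlinarith

theorem grad_bound (d : ℕ) (hd : 0 < d) {lam M : ℝ} (hl : 0 < lam) (hM : 0 ≤ M) : ∃ C : ℝ, 0 < C ∧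
    ∀ (Ω : Set (Eu d)) (A : Eu d → Matrix (Fin d) (Fin d) ℝ) (u : Eu d → ℝ),
      Sol lam M Ω A u → ball (0 : Eu d) 2 ⊆ Ω →
      (∀ x ∈ closedBall (0 : Eu d) (5 / 4), |u x| ≤ C * Real.sqrt (∫ y in ball (0 : Eu d) 2, u y ^ 2)) ∧
      ∀ x ∈ closedBall (0 : Eu d) (3 / 2), ∀ i,
        |pd i u x| ≤ C * Real.sqrt (∫ y in ball (0 : Eu d) 2, u y ^ 2) := by
  obtain ⟨C, hC, hstar⟩ := star d hl
  obtain ⟨K, hK, hker⟩ := exists_kernel_bounds hl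
  obtain ⟨c, hc, hcint⟩ := exists_eta_int d hl
  set V := Real.sqrt (volume.real (ball (0 : Eu d) 2))
  have hV : 0 ≤ V := Real.sqrt_nonneg _
  -- choice of θ
  obtain ⟨θ, hθ0, hθ1, hθ⟩ : ∃ θ : ℝ, 0 < θ ∧ θ ≤ 1 / 2 ∧
      d * (C * M * 2 ^ (d + 1)) * (2 * θ) ≤ c / 2 := by
    set Q := d * (C * M * 2 ^ (d + 1)) with hQ
    have hQ0 : 0 ≤ Q := by positivity
    refine ⟨min (1 / 2) (c / (4 * (Q + 1))), by positivity, min_le_left _ _, ?_⟩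
    calc Q * (2 * min (1 / 2) (c / (4 * (Q + 1)))) ≤ Q * (2 * (c / (4 * (Q + 1)))) := by
          gcongr; exact min_le_right _ _
      _ = (Q / (Q + 1)) * (c / 2) := by field_simp; ring
      _ ≤ 1 * (c / 2) := by
          gcongr
          rw [div_le_one (by positivity)]; linarith
      _ = _ := by ring
  set C1 := 2 ^ (d + 1) * ((θ ^ (d + 1))⁻¹ * (2 / c * (d * K))) * V with hC1
  have hC10 : 0 ≤ C1 := by positivity
  set C2 := (K * ((1 / 4 : ℝ) ^ d)⁻¹ * V + C * (M * (1 / 4)) * (1 / 4 * C1)) / c with hC2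
  have hC20 : 0 ≤ C2 := by positivity
  refine ⟨C1 + C2 + 1, by positivity, ?_⟩
  intro Ω A u hS hΩ
  set N := Real.sqrt (∫ y in ball (0 : Eu d) 2, u y ^ 2)
  have hN : 0 ≤ N := Real.sqrt_nonneg _
  have hL : ∫ y in ball (0 : Eu d) 2, |u y| ≤ V * N := int_abs_le_sqrt hS.c1.continuous 0 2
  have hui : IntegrableOn u (ball (0 : Eu d) 2) :=
    (hS.c1.continuous.continuousOn.integrableOn_compact (isCompact_closedBall 0 2)).mono_set
      ball_subset_closedBall
  -- maximum
  set m : Eu d → ℝ := fun x => ∑ i, |pd i u x| with hm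
  have hmc : Continuous m := continuous_finsetSum _ fun i _ => (continuous_pd hS.c1 i).abs
  have hm0 : ∀ x, 0 ≤ m x := fun x => Finset.sum_nonneg fun _ _ => abs_nonneg _
  have hpm : ∀ x i, |pd i u x| ≤ m x := fun x i =>
    Finset.single_le_sum (f := fun i => |pd i u x|) (fun _ _ => abs_nonneg _) (Finset.mem_univ i)
  obtain ⟨x0, hx0, hmax⟩ := (isCompact_closedBall (0 : Eu d) 2).exists_isMaxOn
    ⟨0, by simp⟩ (f := fun x => (2 - ‖x‖) ^ (d + 1) * m x) (by fun_prop)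
  have hx0' : ‖x0‖ ≤ 2 := by simpa using hx0
  set ρ := 2 - ‖x0‖ with hρ
  have hmain : ρ ^ (d + 1) * m x0 ≤ ((θ ^ (d + 1))⁻¹ * (2 / c * (d * K))) * (V * N) := by
    rcases (by linarith : 0 ≤ ρ).eq_or_lt with h0 | h0
    · rw [← h0, zero_pow (by omega), zero_mul]; positivity
    set r := θ * ρ with hr
    have hr0 : 0 < r := by positivity
    have hrρ : r ≤ ρ / 2 := by rw [hr]; nlinarith
    have hρ2 : ρ ≤ 2 := by have := norm_nonneg x0; linarith
    have hnz : ∀ z ∈ closedBall x0 r, ‖z‖ ≤ ‖x0‖ + r := by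
      intro z hz
      have : ‖z - x0‖ ≤ r := by simpa [dist_eq_norm] using hz
      calc ‖z‖ = ‖x0 + (z - x0)‖ := by congr 1; abel
        _ ≤ _ := (norm_add_le _ _).trans (by linarith)
    have hsub : closedBall x0 r ⊆ ball (0 : Eu d) 2 := by
      intro z hz
      have := hnz z hz
      simp only [mem_ball, dist_zero_right]; linarith
    have hGz : ∀ z ∈ closedBall x0 r, m z ≤ 2 ^ (d + 1) * m x0 := by
      intro z hz
      have h1 := hnz z hz
      have h2 : ρ / 2 ≤ 2 - ‖z‖ := by linarith
      have h3 : (2 - ‖z‖) ^ (d + 1) * m z ≤ ρ ^ (d + 1) * m x0 :=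
        hmax (ball_subset_closedBall (hsub hz))
      have h4 : (ρ / 2) ^ (d + 1) * m z ≤ ρ ^ (d + 1) * m x0 :=
        le_trans (mul_le_mul_of_nonneg_right (pow_le_pow_left₀ (by positivity) h2 _) (hm0 z)) h3
      rw [div_pow] at h4
      have h5 : 0 < ρ ^ (d + 1) := by positivity
      have h6 : ρ ^ (d + 1) * m z ≤ ρ ^ (d + 1) * (2 ^ (d + 1) * m x0) := by
        have h7 : ρ ^ (d + 1) / 2 ^ (d + 1) * m z * 2 ^ (d + 1) = ρ ^ (d + 1) * m z := by
          field_simp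
        rw [← h7]
        nlinarith [mul_le_mul_of_nonneg_right h4 (by positivity : (0 : ℝ) ≤ 2 ^ (d + 1))]
      exact le_of_mul_le_mul_left h6 h5
    have hA := hS.ell x0
    have hst := (hstar M Ω A u hM hS x0 r hr0 (hsub.trans hΩ) (2 ^ (d + 1) * m x0)
      (by have := hm0 x0; positivity) (fun z hz k => (hpm z k).trans (hGz z hz))).1
    have hci := hcint (A x0) hA
    have hi : ∀ i, c * r * |pd i u x0| ≤ K * (r ^ d)⁻¹ * (V * N) + C * (M * r) * (r * (2 ^ (d + 1) * m x0)) := by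
      intro i
      have h1 := hst i
      have h2 := kernel_int_bound (f := u) (h := pd i (eta (A x0)⁻¹)) measurableSet_ball hK.le hui
        (fun y => (hker (A x0) hA y i i).2.1)
        (fun y hy => image_eq_zero_of_notMem_tsupport fun hh => hy (hA.tsupport_eta hl (tsupport_pd _ i hh)))
        hr0 hsub
      have h3 : K * (r ^ d)⁻¹ * ∫ y in ball (0 : Eu d) 2, |u y| ≤ K * (r ^ d)⁻¹ * (V * N) := by gcongr
      have h4 : |(∫ y, eta (A x0)⁻¹ y) * (r * pd i u x0)| = (∫ y, eta (A x0)⁻¹ y) * (r * |pd i u x0|) := by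
        rw [abs_mul, abs_mul, abs_of_pos hr0, abs_of_pos (hc.trans_le hci)]
      have h5 : c * r * |pd i u x0| ≤ (∫ y, eta (A x0)⁻¹ y) * (r * |pd i u x0|) := by
        rw [mul_assoc]; gcongr
      set a := (∫ y, eta (A x0)⁻¹ y) * (r * pd i u x0)
      set b := ∫ y, u (x0 + r • y) * pd i (eta (A x0)⁻¹) y
      have h6 : |a| ≤ |a + b| + |b| := by
        calc |a| = |(a + b) - b| := by congr 1; ring
          _ ≤ _ := abs_sub _ _
      linarith
    have hsum : c * r * m x0 ≤ d * (K * (r ^ d)⁻¹ * (V * N) + C * (M * r) * (r * (2 ^ (d + 1) * m x0))) := by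
      have e : c * r * m x0 = ∑ i, c * r * |pd i u x0| := Finset.mul_sum _ _ _
      rw [e]
      refine (Finset.sum_le_sum fun i _ => hi i).trans (le_of_eq ?_)
      rw [Finset.sum_const, Finset.card_univ, Fintype.card_fin, nsmul_eq_mul]
    have habs : d * (C * (M * r) * (r * (2 ^ (d + 1) * m x0))) ≤ c / 2 * (r * m x0) := by
      have h1 : r ≤ 2 * θ := by rw [hr]; nlinarith
      have h2 : d * (C * M * 2 ^ (d + 1)) * r ≤ c / 2 := le_trans (by gcongr) hθ
      have h3 := mul_le_mul_of_nonneg_right h2 (mul_nonneg hr0.le (hm0 x0))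
      linarith
    have h7 : c / 2 * (r * m x0) ≤ d * (K * (r ^ d)⁻¹ * (V * N)) := by linarith
    have h8 : r ^ (d + 1) * m x0 ≤ 2 / c * (d * K) * (V * N) := by
      have h9 := mul_le_mul_of_nonneg_left h7 (by positivity : 0 ≤ 2 / c * r ^ d)
      calc r ^ (d + 1) * m x0 = 2 / c * r ^ d * (c / 2 * (r * m x0)) := by field_simp; ring
        _ ≤ _ := h9
        _ = _ := by field_simp
    have h10 : ρ ^ (d + 1) * m x0 = (θ ^ (d + 1))⁻¹ * (r ^ (d + 1) * m x0) := by
      rw [hr, mul_pow]; field_simp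
    rw [h10, mul_assoc]
    gcongr
  have hgrad : ∀ x ∈ closedBall (0 : Eu d) (3 / 2), ∀ i, |pd i u x| ≤ C1 * N := by
    intro x hx i
    have hx1 : ‖x‖ ≤ 3 / 2 := by simpa using hx
    have h1 : (2 - ‖x‖) ^ (d + 1) * m x ≤ ρ ^ (d + 1) * m x0 :=
      hmax (closedBall_subset_closedBall (by norm_num) hx)
    have h2 : (1 / 2 : ℝ) ^ (d + 1) * m x ≤ (2 - ‖x‖) ^ (d + 1) * m x :=
      mul_le_mul_of_nonneg_right (pow_le_pow_left₀ (by norm_num) (by linarith) _) (hm0 x)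
    have h3 := (h2.trans h1).trans hmain
    have h4 : m x = 2 ^ (d + 1) * ((1 / 2 : ℝ) ^ (d + 1) * m x) := by
      rw [← mul_assoc, ← mul_pow]; norm_num
    calc |pd i u x| ≤ m x := hpm x i
      _ ≤ 2 ^ (d + 1) * (((θ ^ (d + 1))⁻¹ * (2 / c * (d * K))) * (V * N)) := by
          rw [h4]; gcongr
      _ = C1 * N := by rw [hC1]; ring
  refine ⟨fun x hx => ?_, fun x hx i => (hgrad x hx i).trans (by gcongr; linarith)⟩
  have hx1 : ‖x‖ ≤ 5 / 4 := by simpa using hx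
  have hsub3 : closedBall x (1 / 4) ⊆ closedBall (0 : Eu d) (3 / 2) := by
    intro z hz
    have : ‖z - x‖ ≤ 1 / 4 := by simpa [dist_eq_norm] using hz
    have : ‖z‖ ≤ ‖x‖ + ‖z - x‖ := by
      calc ‖z‖ = ‖x + (z - x)‖ := by congr 1; abel
        _ ≤ _ := norm_add_le _ _
    simp only [mem_closedBall, dist_zero_right]; linarith
  have hsub2 : closedBall x (1 / 4) ⊆ ball (0 : Eu d) 2 :=
    hsub3.trans (closedBall_subset_ball (by norm_num))
  have hA := hS.ell x
  have hst := (hstar M Ω A u hM hS x (1 / 4) (by norm_num) (hsub2.trans hΩ) (C1 * N) (by positivity)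
    (fun z hz k => hgrad z (hsub3 hz) k)).2
  have h2 := kernel_int_bound (f := u) (h := eta (A x)⁻¹) measurableSet_ball hK.le hui
    (fun y => (hker (A x) hA y ⟨0, hd⟩ ⟨0, hd⟩).1)
    (fun y hy => image_eq_zero_of_notMem_tsupport fun hh => hy (hA.tsupport_eta hl hh))
    (by norm_num : (0 : ℝ) < 1 / 4) hsub2
  have h3 : K * ((1 / 4 : ℝ) ^ d)⁻¹ * ∫ y in ball (0 : Eu d) 2, |u y| ≤ K * ((1 / 4 : ℝ) ^ d)⁻¹ * (V * N) := by
    gcongr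
  have hci := hcint (A x) hA
  set a := (∫ y, eta (A x)⁻¹ y) with ha
  set b := ∫ y, u (x + (1 / 4 : ℝ) • y) * (eta (A x)⁻¹) y
  have h4 : |a * u x| ≤ |a * u x - b| + |b| := by
    calc |a * u x| = |(a * u x - b) + b| := by congr 1; ring
      _ ≤ _ := abs_add_le _ _
  have h5 : c * |u x| ≤ |a * u x| := by
    rw [abs_mul, abs_of_pos (hc.trans_le hci)]; gcongr
  have h6 : c * |u x| ≤ (K * ((1 / 4 : ℝ) ^ d)⁻¹ * V + C * (M * (1 / 4)) * (1 / 4 * C1)) * N := by linarith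
  have h7 : |u x| ≤ C2 * N := by
    rw [hC2, div_mul_eq_mul_div, le_div_iff₀ hc]; linarith
  exact h7.trans (by gcongr; linarith)

/-- radii of the mollifiers -/
def mr (n : ℕ) : ℝ := 1 / ((n : ℝ) + 1)

lemma mr_pos (n : ℕ) : 0 < mr n := by unfold mr; positivity

lemma mr_tendsto : Filter.Tendsto mr Filter.atTop (𝓝 0) := tendsto_one_div_add_atTop_nhds_zero_nat

def bn (d n : ℕ) : ContDiffBump (0 : Eu d) where
  rIn := mr n / 2
  rOut := mr n
  rIn_pos := by have := mr_pos n; positivity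
  rIn_lt_rOut := by have := mr_pos n; linarith

def mol (n : ℕ) (f : Eu d → ℝ) : Eu d → ℝ :=
  convolution ((bn d n).normed volume) f (ContinuousLinearMap.lsmul ℝ ℝ) volume

lemma mol_eq (n : ℕ) (f : Eu d → ℝ) (x : Eu d) :
    mol n f x = ∫ t, (bn d n).normed volume t * f (x - t) := rfl

lemma mol_contDiff (n : ℕ) {f : Eu d → ℝ} (hf : Continuous f) : ContDiff ℝ ∞ (mol n f) :=
  HasCompactSupport.contDiff_convolution_left _ (bn d n).hasCompactSupport_normed
    (bn d n).contDiff_normed hf.locallyIntegrable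

lemma mol_tendsto {f : Eu d → ℝ} (hf : Continuous f) (x : Eu d) :
    Filter.Tendsto (fun n => mol n f x) Filter.atTop (𝓝 (f x)) :=
  ContDiffBump.convolution_tendsto_right_of_continuous (φ := bn d) (μ := volume) mr_tendsto hf x

lemma mol_integrable (n : ℕ) {f : Eu d → ℝ} (hf : Continuous f) (x : Eu d) :
    Integrable fun t => (bn d n).normed volume t * f (x - t) :=
  integrable_cs ((bn d n).continuous_normed.mul (hf.comp (continuous_const.sub continuous_id)))
    (bn d n).hasCompactSupport_normed.mul_right

lemma mol_abs_le' (n : ℕ) {g : Eu d → ℝ} {C : ℝ} 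
    (h : ∀ t, ‖t‖ ≤ mr n → |g t| ≤ C) : |∫ t, (bn d n).normed volume t * g t| ≤ C := by
  have h1 : |∫ t, (bn d n).normed volume t * g t| ≤ ∫ t, (bn d n).normed volume t * C := by
    refine norm_integral_le_of_norm_le (f := fun t => (bn d n).normed volume t * g t)
      ((bn d n).integrable_normed.mul_const C) (Filter.Eventually.of_forall fun t => ?_)
    rw [norm_mul, Real.norm_eq_abs, Real.norm_eq_abs, abs_of_nonneg ((bn d n).nonneg_normed t)]
    by_cases ht : ‖t‖ ≤ mr n
    · exact mul_le_mul_of_nonneg_left (h t ht) ((bn d n).nonneg_normed t)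
    · have : t ∉ Function.support ((bn d n).normed volume) := by
        rw [(bn d n).support_normed_eq, mem_ball, dist_zero_right]
        exact fun h => ht (le_of_lt h)
      rw [Function.notMem_support.1 this]; simp
  rwa [integral_mul_const, (bn d n).integral_normed, one_mul] at h1

lemma mol_abs_le (n : ℕ) {f : Eu d → ℝ} {x : Eu d} {C : ℝ}
    (h : ∀ t, ‖t‖ ≤ mr n → |f (x - t)| ≤ C) : |mol n f x| ≤ C := mol_abs_le' n h

lemma mol_lip (n : ℕ) {f : Eu d → ℝ} (hf : Continuous f) {x y : Eu d} {C : ℝ}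
    (h : ∀ t, ‖t‖ ≤ mr n → |f (x - t) - f (y - t)| ≤ C) : |mol n f x - mol n f y| ≤ C := by
  have e : mol n f x - mol n f y = ∫ t, (bn d n).normed volume t * (f (x - t) - f (y - t)) := by
    rw [mol_eq, mol_eq, ← integral_sub (mol_integrable n hf x) (mol_integrable n hf y)]
    simp only [mul_sub]
  rw [e]
  exact mol_abs_le' n h

lemma mol_pd (n : ℕ) {f : Eu d → ℝ} (hf : ContDiff ℝ 1 f) (hc : HasCompactSupport f) (i : Fin d)
    (x : Eu d) : pd i (mol n f) x = mol n (pd i f) x := by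
  have h := hc.hasFDerivAt_convolution_right (ContinuousLinearMap.lsmul ℝ ℝ) (μ := volume)
    ((bn d n).integrable_normed (μ := volume)).locallyIntegrable hf x
  have h2 : pd i (mol n f) x = _ := HasFDerivAt.pd_eq h i
  rw [h2]
  have h_int0 : ConvolutionExistsAt ((bn d n).normed volume) (fderiv ℝ f) x
    ((ContinuousLinearMap.lsmul ℝ ℝ).precompR (Eu d)) volume :=
    (hc.fderiv (𝕜 := ℝ)).convolutionExists_right _ 
      ((bn d n).integrable_normed (μ := volume)).locallyIntegrable (hf.continuous_fderiv one_ne_zero) x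
  rw [convolution_def, ContinuousLinearMap.integral_apply h_int0]
  rfl

lemma mol_tsupport (n : ℕ) {f : Eu d → ℝ} {δ : ℝ} (hδ : mr n ≤ δ) :
    tsupport (mol n f) ⊆ cthickening δ (tsupport f) := by
  refine closure_minimal ?_ isClosed_cthickening
  intro x hx
  by_contra hn
  apply hx
  have : |mol n f x| ≤ 0 := by
    refine mol_abs_le n fun t ht => ?_
    have : x - t ∉ tsupport f := by
      intro hm
      apply hn
      refine mem_cthickening_of_dist_le x (x - t) δ _ hm ?_
      rw [dist_eq_norm]; simp; linarith
    rw [image_eq_zero_of_notMem_tsupport this]; simp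
  exact abs_nonpos_iff.1 this

/-- the weak formulation with `C¹` test functions -/
theorem Sol.weak1 {lam M : ℝ} {Ω : Set (Eu d)} {A : Eu d → Matrix (Fin d) (Fin d) ℝ} {u : Eu d → ℝ}
    (h : Sol lam M Ω A u) (hl : 0 < lam) (hΩ : IsOpen Ω) {ψ : Eu d → ℝ} (hψ : ContDiff ℝ 1 ψ) (hc : HasCompactSupport ψ)
    (hs : tsupport ψ ⊆ Ω) : ∫ x, ∑ i, ∑ j, A x i j * pd j u x * pd i ψ x = 0 := by
  obtain ⟨δ, hδ, hsub⟩ := IsCompact.exists_cthickening_subset_open hc hΩ hs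
  obtain ⟨G, hG0, hG⟩ := exists_pd_bound hψ hc
  have hlim : Filter.Tendsto (fun n => ∫ x, ∑ i, ∑ j, A x i j * pd j u x * pd i (mol n ψ) x) Filter.atTop
      (𝓝 (∫ x, ∑ i, ∑ j, A x i j * pd j u x * pd i ψ x)) := by
    refine tendsto_integral_of_dominated_convergence
      (fun x => ∑ i : Fin d, ∑ j, |pd j u x| * G) (fun n => ?_) ?_ (fun n => ?_) ?_
    · refine Continuous.aestronglyMeasurable ?_
      exact continuous_finsetSum _ fun i _ => continuous_finsetSum _ fun j _ =>
        ((h.cont i j).mul (continuous_pd h.c1 j)).mul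
          (continuous_pd ((mol_contDiff n hψ.continuous).of_le one_le_inf) i)
    · exact integrable_finsetSum _ fun i _ => integrable_finsetSum _ fun j _ =>
        ((integrable_cs (continuous_pd h.c1 j) (hasCompactSupport_pd h.cs j)).abs).mul_const G
    · refine Filter.Eventually.of_forall fun x => ?_
      refine (norm_sum_le _ _).trans (Finset.sum_le_sum fun i _ => (norm_sum_le _ _).trans
        (Finset.sum_le_sum fun j _ => ?_))
      rw [norm_mul, norm_mul, Real.norm_eq_abs, Real.norm_eq_abs, Real.norm_eq_abs, mol_pd n hψ hc]
      have h1 := (h.ell x).abs_le hl i j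
      have h2 := mol_abs_le n (f := pd i ψ) (x := x) (C := G) fun t _ => hG _ i
      calc _ ≤ 1 * |pd j u x| * G := by gcongr
        _ = _ := by ring
    · refine Filter.Eventually.of_forall fun x => ?_
      refine tendsto_finsetSum _ fun i _ => tendsto_finsetSum _ fun j _ => ?_
      refine Filter.Tendsto.const_mul _ ?_
      simp only [mol_pd _ hψ hc]
      exact mol_tendsto (continuous_pd hψ i) x
  have hz : ∀ᶠ n in Filter.atTop, ∫ x, ∑ i, ∑ j, A x i j * pd j u x * pd i (mol n ψ) x = 0 := by
    filter_upwards [mr_tendsto.eventually (gt_mem_nhds hδ)] with n hn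
    have hts := mol_tsupport n (f := ψ) hn.le
    exact h.weak _ (mol_contDiff n hψ.continuous)
      (hc.cthickening.of_isClosed_subset (isClosed_tsupport _) hts) (hts.trans hsub)
  exact tendsto_nhds_unique (hlim.congr' hz) tendsto_const_nhds

lemma dq_bound {f : Eu d → ℝ} (hf : ContDiff ℝ 1 f) {G : ℝ} (hG : ∀ x i, |pd i f x| ≤ G) (x v : Eu d) :
    |f (x + v) - f x| ≤ d * G * ‖v‖ := by
  have := abs_sub_le_of_pd hf convex_univ (fun x _ i => hG x i) (mem_univ (x + v)) (mem_univ x)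
  simpa using this

lemma dq_tendsto {f : Eu d → ℝ} (hf : ContDiff ℝ 1 f) (x : Eu d) (k : Fin d) (c : ℝ) :
    Filter.Tendsto (fun n => (f (x + (c * mr n) • ev k) - f x) / mr n) Filter.atTop (𝓝 (c * pd k f x)) := by
  have h1 : HasDerivAt (fun t : ℝ => f (x + (c * t) • ev k)) (c * pd k f x) 0 := by
    have h2 : HasDerivAt (fun t : ℝ => x + (c * t) • ev k) (c • ev k) 0 := by
      have := (((hasDerivAt_id (0 : ℝ)).const_mul c).smul_const (ev k : Eu d)).const_add x
      simpa using this
    have h3 : HasFDerivAt f (fderiv ℝ f x) (x + (c * 0) • ev k) := by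
      simp only [mul_zero, zero_smul, add_zero]
      exact (hf.differentiable one_ne_zero x).hasFDerivAt
    have h4 := h3.comp_hasDerivAt (0 : ℝ) h2
    rw [map_smul, smul_eq_mul] at h4
    exact h4
  have h4 := h1.tendsto_slope_zero
  have h5 : Filter.Tendsto mr Filter.atTop (𝓝[≠] 0) :=
    tendsto_nhdsWithin_iff.2 ⟨mr_tendsto, Filter.Eventually.of_forall fun n => (mr_pos n).ne'⟩
  refine (h4.comp h5).congr fun n => ?_
  simp only [Function.comp, zero_add, mul_zero, zero_smul, add_zero, smul_eq_mul]
  rw [div_eq_inv_mul]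

/-- energy density -/
def en (A : Eu d → Matrix (Fin d) (Fin d) ℝ) (u : Eu d → ℝ) (x : Eu d) : ℝ :=
  ∑ i, ∑ j, A x i j * pd j u x * pd i u x

/-- flux -/
def fl (A : Eu d → Matrix (Fin d) (Fin d) ℝ) (u : Eu d → ℝ) (i : Fin d) (x : Eu d) : ℝ :=
  ∑ j, A x i j * pd j u x

lemma en_eq (A : Eu d → Matrix (Fin d) (Fin d) ℝ) (u : Eu d → ℝ) (x : Eu d) :
    en A u x = ∑ i, fl A u i x * pd i u x := by
  simp only [en, fl, Finset.sum_mul]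

def dabs (u : Eu d → ℝ) (x : Eu d) : ℝ := ∑ i, |pd i u x|

section
variable {lam M : ℝ} {Ω : Set (Eu d)} {A : Eu d → Matrix (Fin d) (Fin d) ℝ} {u : Eu d → ℝ}

lemma Sol.cont_fl (h : Sol lam M Ω A u) (i : Fin d) : Continuous (fl A u i) :=
  continuous_finsetSum _ fun j _ => (h.cont i j).mul (continuous_pd h.c1 j)

lemma Sol.cont_en (h : Sol lam M Ω A u) : Continuous (en A u) := by
  rw [show en A u = fun x => ∑ i, fl A u i x * pd i u x from funext (en_eq A u)]
  exact continuous_finsetSum _ fun i _ => (h.cont_fl i).mul (continuous_pd h.c1 i)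

lemma Sol.cont_dabs (h : Sol lam M Ω A u) : Continuous (dabs u) :=
  continuous_finsetSum _ fun i _ => (continuous_pd h.c1 i).abs

lemma pd_le_dabs (u : Eu d → ℝ) (x : Eu d) (i : Fin d) : |pd i u x| ≤ dabs u x :=
  Finset.single_le_sum (f := fun i => |pd i u x|) (fun _ _ => abs_nonneg _) (Finset.mem_univ i)

lemma dabs_nonneg (u : Eu d → ℝ) (x : Eu d) : 0 ≤ dabs u x := Finset.sum_nonneg fun _ _ => abs_nonneg _

lemma Sol.cs_en (h : Sol lam M Ω A u) : HasCompactSupport (en A u) := by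
  refine HasCompactSupport.intro h.cs fun x hx => ?_
  have : ∀ i, pd i u x = 0 := fun i => image_eq_zero_of_notMem_tsupport fun hh => hx (tsupport_pd u i hh)
  simp [en, this]

lemma Sol.fl_le (h : Sol lam M Ω A u) (hl : 0 < lam) (i : Fin d) (x : Eu d) : |fl A u i x| ≤ dabs u x := by
  refine (Finset.abs_sum_le_sum_abs _ _).trans (Finset.sum_le_sum fun j _ => ?_)
  rw [abs_mul]
  have := (h.ell x).abs_le hl i j
  nlinarith [abs_nonneg (pd j u x)]

lemma Sol.weak2 (h : Sol lam M Ω A u) (hl : 0 < lam) (hΩ : IsOpen Ω) {ψ : Eu d → ℝ} (hψ : ContDiff ℝ 1 ψ)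
    (hc : HasCompactSupport ψ) (hs : tsupport ψ ⊆ Ω) : ∫ x, ∑ i, fl A u i x * pd i ψ x = 0 := by
  rw [← h.weak1 hl hΩ hψ hc hs]
  simp only [fl, Finset.sum_mul]

lemma pd_shift (f : Eu d → ℝ) (v x : Eu d) (i : Fin d) : pd i (fun y => f (y + v)) x = pd i f (x + v) := by
  rw [pd, pd, fderiv_comp_add_right]

lemma rellich_shift (h : Sol lam M Ω A u) (hl : 0 < lam) (hΩ : IsOpen Ω) {ζ : Eu d → ℝ}
    (hζ : ContDiff ℝ 1 ζ) (hc : HasCompactSupport ζ) {t : ℝ} (hs : cthickening t (tsupport ζ) ⊆ Ω)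
    (v : Eu d) (hv : ‖v‖ ≤ t) :
    |∫ x, ((ζ (x - v) - ζ x) * en A u x
      + (∑ i, (fl A u i x + fl A u i (x + v)) * pd i ζ x) * (u (x + v) - u x))| ≤
      (M * ‖v‖) * ∫ x, |ζ x| * (dabs u x * dabs u (x + v)) := by
  set ψ : Eu d → ℝ := fun x => ζ x * (u (x + v) - u x) with hψ
  have hcu : ContDiff ℝ 1 fun x => u (x + v) := h.c1.comp (contDiff_id.add contDiff_const)
  have hψ1 : ContDiff ℝ 1 ψ := hζ.mul (hcu.sub h.c1)
  have hψc : HasCompactSupport ψ := hc.mul_right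
  have hψs : tsupport ψ ⊆ tsupport ζ := tsupport_mul_subset_left
  have hpd : ∀ i x, pd i ψ x = pd i ζ x * (u (x + v) - u x) + ζ x * (pd i u (x + v) - pd i u x) := by
    intro i x
    rw [hψ, pd_mul, pd_sub, pd_shift]
    · exact hcu.differentiable one_ne_zero x
    · exact h.c1.differentiable one_ne_zero x
    · exact hζ.differentiable one_ne_zero x
    · exact (hcu.sub h.c1).differentiable one_ne_zero x
  have e1 := h.weak2 hl hΩ hψ1 hψc (hψs.trans ((self_subset_cthickening _).trans hs))
  have e2 := h.weak2 hl hΩ (ψ := fun x => ψ (x + -v)) (hψ1.comp (contDiff_id.add contDiff_const))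
    (hψc.comp_homeomorph (Homeomorph.addRight (-v))) (by
      refine Subset.trans ?_ hs
      refine closure_minimal (fun x hx => ?_) isClosed_cthickening
      refine mem_cthickening_of_dist_le x (x + -v) t _ (hψs (subset_tsupport _ hx)) ?_
      simpa using hv)
  rw [← integral_add_right_eq_self _ v] at e2
  simp only [pd_shift, add_neg_cancel_right] at e2
  have cfl := fun i => h.cont_fl i
  have cflv : ∀ i, Continuous fun x => fl A u i (x + v) := fun i => (cfl i).comp (by fun_prop)
  have cpd := fun i => continuous_pd h.c1 i
  have cpdv : ∀ i, Continuous fun x => pd i u (x + v) := fun i => (cpd i).comp (by fun_prop)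
  have cuv : Continuous fun x => u (x + v) := hcu.continuous
  have cu := h.c1.continuous
  have cen := h.cont_en
  have cenv : Continuous fun x => en A u (x + v) := cen.comp (by fun_prop)
  have cζ := hζ.continuous
  have cpζ := fun i => continuous_pd hζ i
  have cpψ := fun i => continuous_pd hψ1 i
  have sψ : ∀ x ∉ tsupport ζ, ∀ i, pd i ψ x = 0 := fun x hx i =>
    image_eq_zero_of_notMem_tsupport fun hh => hx (hψs (tsupport_pd ψ i hh))
  have sζ : ∀ x ∉ tsupport ζ, ζ x = 0 := fun x hx => image_eq_zero_of_notMem_tsupport hx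
  have spζ : ∀ x ∉ tsupport ζ, ∀ i, pd i ζ x = 0 := fun x hx i =>
    image_eq_zero_of_notMem_tsupport fun hh => hx (tsupport_pd ζ i hh)
  have i1 : Integrable fun x => ∑ i, fl A u i x * pd i ψ x :=
    integrable_cs (continuous_finsetSum _ fun i _ => (cfl i).mul (cpψ i))
      (HasCompactSupport.intro hc fun x hx => by simp [sψ x hx])
  have i2 : Integrable fun x => ∑ i, fl A u i (x + v) * pd i ψ x :=
    integrable_cs (continuous_finsetSum _ fun i _ => (cflv i).mul (cpψ i))
      (HasCompactSupport.intro hc fun x hx => by simp [sψ x hx])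
  have e3 : ∫ x, (∑ i, fl A u i x * pd i ψ x + ∑ i, fl A u i (x + v) * pd i ψ x) = 0 := by
    rw [integral_add i1 i2, e1, e2, add_zero]
  -- shift of ζ
  have i3 : Integrable fun x => ζ (x - v) * en A u x := integrable_cs (by fun_prop) h.cs_en.mul_left
  have i4 : Integrable fun x => ζ x * en A u x := integrable_cs (by fun_prop) h.cs_en.mul_left
  have i5 : Integrable fun x => ζ x * en A u (x + v) := integrable_cs (by fun_prop) hc.mul_right
  have e4 : ∫ x, ζ (x - v) * en A u x = ∫ x, ζ x * en A u (x + v) := by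
    rw [← integral_add_right_eq_self _ v]; simp
  have i6 : Integrable fun x => (∑ i, (fl A u i x + fl A u i (x + v)) * pd i ζ x) * (u (x + v) - u x) :=
    integrable_cs ((continuous_finsetSum _ fun i _ => ((cfl i).add (cflv i)).mul (cpζ i)).mul (cuv.sub cu))
      (HasCompactSupport.intro hc fun x hx => by simp [spζ x hx])
  have e5 : ∫ x, ((ζ (x - v) - ζ x) * en A u x
      + (∑ i, (fl A u i x + fl A u i (x + v)) * pd i ζ x) * (u (x + v) - u x))
      = ∫ x, -(ζ x * ∑ i, (fl A u i x * pd i u (x + v) - fl A u i (x + v) * pd i u x)) := by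
    have : ∀ x, -(ζ x * ∑ i, (fl A u i x * pd i u (x + v) - fl A u i (x + v) * pd i u x)) = 
       (ζ x * en A u (x + v) - ζ x * en A u x + (∑ i, (fl A u i x + fl A u i (x + v)) * pd i ζ x) * (u (x + v) - u x))
        - (∑ i, fl A u i x * pd i ψ x + ∑ i, fl A u i (x + v) * pd i ψ x) := by
      intro x
      simp only [hpd, en_eq, Finset.sum_mul, Finset.mul_sum, ← Finset.sum_add_distrib, ← Finset.sum_sub_distrib,
        ← Finset.sum_neg_distrib]
      refine Finset.sum_congr rfl fun i _ => ?_
      ring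
    simp only [this]
    have j1 : Integrable fun x => ζ x * en A u (x + v) - ζ x * en A u x := i5.sub i4
    have j2 : Integrable fun x => ζ (x - v) * en A u x - ζ x * en A u x := i3.sub i4
    have j3 : Integrable fun x => ζ x * en A u (x + v) - ζ x * en A u x +
      (∑ i, (fl A u i x + fl A u i (x + v)) * pd i ζ x) * (u (x + v) - u x) := j1.add i6
    have j4 : Integrable fun x => ∑ i, fl A u i x * pd i ψ x + ∑ i, fl A u i (x + v) * pd i ψ x := i1.add i2
    rw [integral_sub j3 j4, e3, sub_zero, integral_add j1 i6, 
      integral_sub i5 i4, ← e4, ← integral_sub i3 i4, ← integral_add j2 i6]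
    simp only [sub_mul]
  rw [e5, ← integral_const_mul]
  have cdv : Continuous fun x => dabs u (x + v) := h.cont_dabs.comp (by fun_prop)
  refine norm_integral_le_of_norm_le (f := fun x => 
    -(ζ x * ∑ i, (fl A u i x * pd i u (x + v) - fl A u i (x + v) * pd i u x))) 
    ((integrable_cs (f := fun x => |ζ x| * (dabs u x * dabs u (x + v))) 
      (cζ.abs.mul (h.cont_dabs.mul cdv)) (HasCompactSupport.intro hc fun x hx => by simp [sζ x hx])).const_mul _)
    (Filter.Eventually.of_forall fun x => ?_)
  rw [norm_neg, norm_mul, Real.norm_eq_abs, Real.norm_eq_abs]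
  have e6 : ∑ i, (fl A u i x * pd i u (x + v) - fl A u i (x + v) * pd i u x)
      = ∑ i, ∑ j, (A x i j - A (x + v) i j) * pd j u x * pd i u (x + v) := by
    have : ∑ i, fl A u i (x + v) * pd i u x = ∑ i, ∑ j, A (x + v) i j * pd j u x * pd i u (x + v) := by
      simp only [fl, Finset.sum_mul]
      rw [Finset.sum_comm]
      refine Finset.sum_congr rfl fun i _ => Finset.sum_congr rfl fun j _ => ?_
      rw [show A (x + v) j i = A (x + v) i j from (h.ell (x + v)).symm j i]
      ring
    rw [Finset.sum_sub_distrib, this]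
    simp only [fl, Finset.sum_mul, ← Finset.sum_sub_distrib]
    refine Finset.sum_congr rfl fun i _ => Finset.sum_congr rfl fun j _ => ?_
    ring
  have e7 : |∑ i, ∑ j, (A x i j - A (x + v) i j) * pd j u x * pd i u (x + v)| ≤ 
      (M * ‖v‖) * (dabs u x * dabs u (x + v)) := by
    calc _ ≤ ∑ i, ∑ j, (M * ‖v‖) * (|pd j u x| * |pd i u (x + v)|) := by
          refine (Finset.abs_sum_le_sum_abs _ _).trans (Finset.sum_le_sum fun i _ =>
            (Finset.abs_sum_le_sum_abs _ _).trans (Finset.sum_le_sum fun j _ => ?_))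
          rw [abs_mul, abs_mul, mul_assoc]
          have := h.lip x (x + v) i j
          rw [sub_add_cancel_left, norm_neg] at this
          gcongr
      _ = _ := by
          simp only [dabs, Finset.sum_mul_sum]
          rw [Finset.sum_comm]
          simp only [Finset.mul_sum]
  rw [e6]
  calc _ ≤ |ζ x| * ((M * ‖v‖) * (dabs u x * dabs u (x + v))) := by gcongr
    _ = _ := by ring

/-- Rellich type inequality -/
theorem rellich (h : Sol lam M Ω A u) (hl : 0 < lam) (hΩ : IsOpen Ω) {ζ : Eu d → ℝ}
    (hζ : ContDiff ℝ 1 ζ) (hc : HasCompactSupport ζ) (hs : tsupport ζ ⊆ Ω) (k : Fin d) :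
    |2 * (∫ x, (∑ i, fl A u i x * pd i ζ x) * pd k u x) - ∫ x, pd k ζ x * en A u x| ≤
      M * ∫ x, |ζ x| * dabs u x ^ 2 := by
  obtain ⟨δ, hδ, hsub⟩ := IsCompact.exists_cthickening_subset_open hc hΩ hs
  obtain ⟨Gu, hGu0, hGu⟩ := exists_pd_bound h.c1 h.cs
  obtain ⟨Gz, hGz0, hGz⟩ := exists_pd_bound hζ hc
  have cfl := fun i => h.cont_fl i
  have cpd := fun i => continuous_pd h.c1 i
  have cu := h.c1.continuous
  have cen := h.cont_en
  have cζ := hζ.continuous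
  have cpζ := fun i => continuous_pd hζ i
  have sζ : ∀ x ∉ tsupport ζ, ζ x = 0 := fun x hx => image_eq_zero_of_notMem_tsupport hx
  have spζ : ∀ x ∉ tsupport ζ, ∀ i, pd i ζ x = 0 := fun x hx i =>
    image_eq_zero_of_notMem_tsupport fun hh => hx (tsupport_pd ζ i hh)
  have hdu : ∀ x, dabs u x ≤ d * Gu := fun x => by
    refine (Finset.sum_le_sum fun i _ => hGu x i).trans ?_
    simp
  set vv : ℕ → Eu d := fun n => mr n • ev k with hvv
  have hvn : ∀ n, ‖vv n‖ = mr n := fun n => by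
    rw [hvv]; simp only [norm_smul, norm_ev, Real.norm_eq_abs, abs_of_pos (mr_pos n), mul_one]
  have hv0 : Filter.Tendsto vv Filter.atTop (𝓝 0) := by
    have := mr_tendsto.smul_const (ev k : Eu d); simpa using this
  have hshift : ∀ {f : Eu d → ℝ}, Continuous f → ∀ x, Filter.Tendsto (fun n => f (x + vv n)) Filter.atTop (𝓝 (f x)) := by
    intro f hf x
    have : Filter.Tendsto (fun n => x + vv n) Filter.atTop (𝓝 (x + 0)) := hv0.const_add x
    rw [add_zero] at this
    exact (hf.tendsto x).comp this
  -- main limit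
  have L1 : Filter.Tendsto (fun n => ∫ x, (((ζ (x - vv n) - ζ x) / mr n) * en A u x
      + (∑ i, (fl A u i x + fl A u i (x + vv n)) * pd i ζ x) * ((u (x + vv n) - u x) / mr n))) Filter.atTop
      (𝓝 (∫ x, ((-1 * pd k ζ x) * en A u x + (∑ i, (fl A u i x + fl A u i x) * pd i ζ x) * (1 * pd k u x)))) := by
    refine tendsto_integral_of_dominated_convergence
      (fun x => (d * Gz) * |en A u x| + (∑ i, (2 * (d * Gu)) * |pd i ζ x|) * (d * Gu)) (fun n => ?_) ?_ (fun n => ?_) ?_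
    · refine Continuous.aestronglyMeasurable ?_
      have : ∀ i, Continuous fun x => fl A u i (x + vv n) := fun i => (cfl i).comp (by fun_prop)
      fun_prop
    · refine Integrable.add ((integrable_cs cen h.cs_en).abs.const_mul _) (Integrable.mul_const ?_ _)
      exact integrable_finsetSum _ fun i _ => (integrable_cs (cpζ i) (hasCompactSupport_pd hc i)).abs.const_mul _
    · refine Filter.Eventually.of_forall fun x => ?_
      refine (norm_add_le _ _).trans ?_
      rw [norm_mul, norm_mul]
      simp only [Real.norm_eq_abs]
      have q1 : |(ζ (x - vv n) - ζ x) / mr n| ≤ d * Gz := by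
        have := dq_bound hζ hGz x (-vv n)
        rw [norm_neg, hvn, ← sub_eq_add_neg] at this
        rw [abs_div, abs_of_pos (mr_pos n), div_le_iff₀ (mr_pos n)]
        exact this
      have q2 : |(u (x + vv n) - u x) / mr n| ≤ d * Gu := by
        have := dq_bound h.c1 hGu x (vv n)
        rw [hvn] at this
        rw [abs_div, abs_of_pos (mr_pos n), div_le_iff₀ (mr_pos n)]
        exact this
      have q3 : |∑ i, (fl A u i x + fl A u i (x + vv n)) * pd i ζ x| ≤ ∑ i, (2 * (d * Gu)) * |pd i ζ x| := by
        refine (Finset.abs_sum_le_sum_abs _ _).trans (Finset.sum_le_sum fun i _ => ?_)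
        rw [abs_mul]
        gcongr
        refine (abs_add_le _ _).trans ?_
        have := (h.fl_le hl i x).trans (hdu x)
        have := (h.fl_le hl i (x + vv n)).trans (hdu _)
        linarith
      gcongr
    · refine Filter.Eventually.of_forall fun x => ?_
      refine Filter.Tendsto.add (Filter.Tendsto.mul_const _ ?_) (Filter.Tendsto.mul ?_ ?_)
      · have := dq_tendsto hζ x k (-1)
        refine this.congr fun n => ?_
        rw [hvv]; simp [sub_eq_add_neg]
      · exact tendsto_finsetSum _ fun i _ => Filter.Tendsto.mul_const _ ((hshift (cfl i) x).const_add _)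
      · have := dq_tendsto h.c1 x k 1
        refine this.congr fun n => ?_
        rw [hvv]; simp
  have L2 : Filter.Tendsto (fun n => M * ∫ x, |ζ x| * (dabs u x * dabs u (x + vv n))) Filter.atTop
      (𝓝 (M * ∫ x, |ζ x| * (dabs u x * dabs u x))) := by
    refine Filter.Tendsto.const_mul _ ?_
    refine tendsto_integral_of_dominated_convergence
      (fun x => |ζ x| * ((d * Gu) * (d * Gu))) (fun n => ?_) ?_ (fun n => ?_) ?_
    · refine Continuous.aestronglyMeasurable ?_
      have : Continuous fun x => dabs u (x + vv n) := h.cont_dabs.comp (by fun_prop)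
      have := h.cont_dabs
      fun_prop
    · exact (integrable_cs cζ hc).abs.mul_const _
    · refine Filter.Eventually.of_forall fun x => ?_
      rw [norm_mul, norm_mul]
      simp only [Real.norm_eq_abs, abs_abs, abs_of_nonneg (dabs_nonneg u _)]
      gcongr
      · exact dabs_nonneg u _
      · exact hdu x
      · exact hdu _
    · refine Filter.Eventually.of_forall fun x => ?_
      exact Filter.Tendsto.const_mul _ (Filter.Tendsto.const_mul _ (hshift h.cont_dabs x))
  have hev : ∀ᶠ n in Filter.atTop, |∫ x, (((ζ (x - vv n) - ζ x) / mr n) * en A u x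
      + (∑ i, (fl A u i x + fl A u i (x + vv n)) * pd i ζ x) * ((u (x + vv n) - u x) / mr n))| ≤ 
      M * ∫ x, |ζ x| * (dabs u x * dabs u (x + vv n)) := by
    filter_upwards [mr_tendsto.eventually (gt_mem_nhds hδ)] with n hn
    have hh := rellich_shift h hl hΩ hζ hc hsub (vv n) (by rw [hvn]; exact hn.le)
    have e : ∀ x, (((ζ (x - vv n) - ζ x) / mr n) * en A u x
      + (∑ i, (fl A u i x + fl A u i (x + vv n)) * pd i ζ x) * ((u (x + vv n) - u x) / mr n)) = 
        (mr n)⁻¹ * ((ζ (x - vv n) - ζ x) * en A u x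
      + (∑ i, (fl A u i x + fl A u i (x + vv n)) * pd i ζ x) * (u (x + vv n) - u x)) := by
      intro x; ring
    simp only [e]
    rw [integral_const_mul, abs_mul, abs_of_pos (inv_pos.2 (mr_pos n)), inv_mul_le_iff₀ (mr_pos n)]
    rw [hvn] at hh
    linarith
  have := le_of_tendsto_of_tendsto L1.abs L2 hev
  have e1 : ∀ x, ((-1 * pd k ζ x) * en A u x + (∑ i, (fl A u i x + fl A u i x) * pd i ζ x) * (1 * pd k u x))
     = 2 * ((∑ i, fl A u i x * pd i ζ x) * pd k u x) - pd k ζ x * en A u x := by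
    intro x
    have : ∑ i, (fl A u i x + fl A u i x) * pd i ζ x = 2 * ∑ i, fl A u i x * pd i ζ x := by
      rw [Finset.mul_sum]; exact Finset.sum_congr rfl fun i _ => by ring
    rw [this]; ring
  simp only [e1, ← pow_two] at this
  rwa [integral_sub, integral_const_mul] at this
  · refine Integrable.const_mul (integrable_cs (by fun_prop) (HasCompactSupport.intro hc fun x hx => ?_)) _
    simp [spζ x hx]
  · exact integrable_cs (by fun_prop) h.cs_en.mul_left
end

/-- functions behaving like homogeneous Lipschitz functions of degree `n+1` on the ball of radius `R` -/
def LO (R : ℝ) (n : ℕ) (C : ℝ) (f : Eu d → ℝ) : Prop :=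
  f 0 = 0 ∧ ∀ x y : Eu d, ‖y‖ ≤ ‖x‖ → ‖x‖ ≤ R → |f x - f y| ≤ C * ‖x‖ ^ n * ‖x - y‖

namespace LO
variable {R C C1 C2 : ℝ} {n m : ℕ} {f g : Eu d → ℝ}

lemma bd (h : LO R n C f) {x : Eu d} (hx : ‖x‖ ≤ R) : |f x| ≤ C * ‖x‖ ^ (n + 1) := by
  have := h.2 x 0 (by simp) hx
  rw [h.1, sub_zero, sub_zero] at this
  rw [pow_succ, ← mul_assoc]; exact this

lemma mono (h : LO R n C1 f) (hC : C1 ≤ C2) : LO R n C2 f :=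
  ⟨h.1, fun x y h1 h2 => (h.2 x y h1 h2).trans (by gcongr)⟩

lemma add (hf : LO R n C1 f) (hg : LO R n C2 g) : LO R n (C1 + C2) fun x => f x + g x := by
  refine ⟨by simp [hf.1, hg.1], fun x y h1 h2 => ?_⟩
  have a := hf.2 x y h1 h2
  have b := hg.2 x y h1 h2
  calc |f x + g x - (f y + g y)| = |(f x - f y) + (g x - g y)| := by congr 1; ring
    _ ≤ _ := (abs_add_le _ _).trans (by linarith)

lemma neg (hf : LO R n C f) : LO R n C fun x => - f x := by
  refine ⟨by simp [hf.1], fun x y h1 h2 => ?_⟩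
  rw [neg_sub_neg, abs_sub_comm]; exact hf.2 x y h1 h2

lemma sub (hf : LO R n C1 f) (hg : LO R n C2 g) : LO R n (C1 + C2) fun x => f x - g x := by
  simpa [sub_eq_add_neg] using hf.add hg.neg

lemma sum {ι : Type*} [Fintype ι] {f : ι → Eu d → ℝ} (hf : ∀ i, LO R n C (f i)) :
    LO R n (Fintype.card ι * C) fun x => ∑ i, f i x := by
  refine ⟨by simp [(hf _).1], fun x y h1 h2 => ?_⟩
  rw [← Finset.sum_sub_distrib]
  refine (Finset.abs_sum_le_sum_abs _ _).trans ((Finset.sum_le_sum fun i _ => (hf i).2 x y h1 h2).trans ?_)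
  simp [mul_assoc]

lemma mul (hf : LO R n C1 f) (hg : LO R m C2 g) :
    LO R (n + m + 1) (2 * C1 * C2) fun x => f x * g x := by
  refine ⟨by simp [hf.1], fun x y h1 h2 => ?_⟩
  have a := hf.2 x y h1 h2
  have b := hg.2 x y h1 h2
  have c := hg.bd h2
  have e := hf.bd (h1.trans h2)
  by_cases hx : ‖x‖ = 0
  · have hy : ‖y‖ = 0 := le_antisymm (h1.trans hx.le) (norm_nonneg _)
    rw [norm_eq_zero] at hx hy
    rw [hx, hy]; simp
  by_cases hxy : ‖x - y‖ = 0
  · have : x = y := by rwa [norm_sub_eq_zero_iff] at hxy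
    rw [this]; simp
  have hx0 : 0 < ‖x‖ := lt_of_le_of_ne (norm_nonneg _) (Ne.symm hx)
  have hxy0 : 0 < ‖x - y‖ := lt_of_le_of_ne (norm_nonneg _) (Ne.symm hxy)
  have hC1 : 0 ≤ C1 := by
    by_contra hn
    push Not at hn
    have : C1 * ‖x‖ ^ n * ‖x - y‖ < 0 := by
      have : 0 < ‖x‖ ^ n * ‖x - y‖ := by positivity
      nlinarith
    linarith [abs_nonneg (f x - f y)]
  have hC2 : 0 ≤ C2 := by
    by_contra hn
    push Not at hn
    have : C2 * ‖x‖ ^ m * ‖x - y‖ < 0 := by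
      have : 0 < ‖x‖ ^ m * ‖x - y‖ := by positivity
      nlinarith
    linarith [abs_nonneg (g x - g y)]
  calc |f x * g x - f y * g y| = |(f x - f y) * g x + f y * (g x - g y)| := by congr 1; ring
    _ ≤ |f x - f y| * |g x| + |f y| * |g x - g y| := by
        refine (abs_add_le _ _).trans ?_; rw [abs_mul, abs_mul]
    _ ≤ (C1 * ‖x‖ ^ n * ‖x - y‖) * (C2 * ‖x‖ ^ (m + 1)) + (C1 * ‖x‖ ^ (n + 1)) * (C2 * ‖x‖ ^ m * ‖x - y‖) := by
        gcongr
        exact e.trans (by gcongr)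
    _ = _ := by ring

lemma lower (hR : 0 ≤ R) (hC : 0 ≤ C) (hf : LO R (n + 1) C f) : LO R n (C * R) f := by
  refine ⟨hf.1, fun x y h1 h2 => (hf.2 x y h1 h2).trans ?_⟩
  rw [pow_succ]
  calc C * (‖x‖ ^ n * ‖x‖) * ‖x - y‖ ≤ C * (‖x‖ ^ n * R) * ‖x - y‖ := by gcongr
    _ = _ := by ring

lemma div {c : ℝ} (hc : 0 < c) (hC1 : 0 ≤ C1) (hC2 : 0 ≤ C2) (hf : LO R 2 C1 f) (hg : LO R 1 C2 g)
    (hlow : ∀ x : Eu d, c * ‖x‖ ^ 2 ≤ g x) : LO R 0 (C1 / c + C1 * C2 / c ^ 2) fun x => f x / g x := by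
  refine ⟨by simp [hf.1], fun x y h1 h2 => ?_⟩
  have a := hf.2 x y h1 h2
  have b := hg.2 x y h1 h2
  have e := hf.bd (h1.trans h2)
  simp only [pow_zero, mul_one, pow_one] at *
  by_cases hx : x = 0
  · have hy : y = 0 := by simpa [hx] using h1
    rw [hx, hy]; simp
  have hx0 : 0 < ‖x‖ := norm_pos_iff.2 hx
  have gx : 0 < g x := lt_of_lt_of_le (by positivity) (hlow x)
  have e1 : |(f x - f y) / g x| ≤ C1 / c * ‖x - y‖ := by
    rw [abs_div, abs_of_pos gx, div_le_iff₀ gx]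
    calc _ ≤ _ := a
      _ = C1 / c * ‖x - y‖ * (c * ‖x‖ ^ 2) := by field_simp
      _ ≤ _ := by gcongr; exact hlow x
  by_cases hy : y = 0
  · subst hy
    simp only [hf.1, zero_div, sub_zero] at e1 ⊢
    refine e1.trans ?_
    have : 0 ≤ C1 * C2 / c ^ 2 := by positivity
    gcongr; linarith
  have hy0 : 0 < ‖y‖ := norm_pos_iff.2 hy
  have gy : 0 < g y := lt_of_lt_of_le (by positivity) (hlow y)
  have e2 : |f y * (g y - g x) / (g x * g y)| ≤ C1 * C2 / c ^ 2 * ‖x - y‖ := by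
    rw [abs_div, abs_of_pos (mul_pos gx gy), div_le_iff₀ (mul_pos gx gy), abs_mul, abs_sub_comm (g y)]
    calc |f y| * |g x - g y| ≤ (C1 * ‖y‖ ^ (2 + 1)) * (C2 * ‖x‖ * ‖x - y‖) := by gcongr
      _ = C1 * C2 / c ^ 2 * ‖x - y‖ * ((c * (‖y‖ * ‖x‖)) * (c * ‖y‖ ^ 2)) := by field_simp; ring
      _ ≤ C1 * C2 / c ^ 2 * ‖x - y‖ * (g x * g y) := by
          gcongr
          · refine le_trans ?_ (hlow x)
            rw [pow_two]; gcongr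
          · exact hlow y
  calc |f x / g x - f y / g y| = |(f x - f y) / g x + f y * (g y - g x) / (g x * g y)| := by
        congr 1; field_simp; ring
    _ ≤ _ := (abs_add_le _ _).trans (by linarith)

lemma cont (h : ∀ R : ℝ, 0 ≤ R → ∃ C, LO R n C f) : Continuous f := by
  rw [continuous_iff_continuousAt]
  intro x
  obtain ⟨C, hC⟩ := h (‖x‖ + 1) (by positivity)
  have hl : LipschitzOnWith ((|C| * (‖x‖ + 1) ^ n).toNNReal) f (ball 0 (‖x‖ + 1)) := by
    refine LipschitzOnWith.of_dist_le_mul fun y hy z hz => ?_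
    rw [Real.coe_toNNReal _ (by positivity), Real.dist_eq, dist_eq_norm]
    simp only [mem_ball, dist_zero_right] at hy hz
    have key : ∀ y z : Eu d, ‖z‖ ≤ ‖y‖ → ‖y‖ < ‖x‖ + 1 → |f y - f z| ≤ |C| * (‖x‖ + 1) ^ n * ‖y - z‖ := by
      intro y z h1 h2
      refine (hC.2 y z h1 h2.le).trans ?_
      gcongr
      exact le_abs_self C
    rcases le_total ‖z‖ ‖y‖ with h1 | h1
    · exact key y z h1 hy
    · rw [abs_sub_comm, norm_sub_rev]; exact key z y h1 hz
  exact hl.continuousOn.continuousAt (isOpen_ball.mem_nhds (by simp))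

lemma mol_pd_le (hC : 0 ≤ C) (hc : Continuous f) (h : LO 3 1 C f) (k : ℕ) {x : Eu d} (hx : ‖x‖ ≤ 1) (i : Fin d) :
    |pd i (mol k f) x| ≤ C * (‖x‖ + 2 * mr k) := by
  have hm := mr_pos k
  have hm1 : mr k ≤ 1 := by
    unfold mr; rw [div_le_one (by positivity)]
    have : (0 : ℝ) ≤ k := by positivity
    linarith
  refine (abs_pd_le _ _ _).trans (norm_fderiv_le_of_lip' ℝ (by positivity) ?_)
  filter_upwards [ball_mem_nhds x hm] with y hy
  rw [mem_ball, dist_eq_norm] at hy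
  have hy' : ‖y‖ ≤ ‖x‖ + mr k := by
    calc ‖y‖ = ‖x + (y - x)‖ := by congr 1; abel
      _ ≤ _ := (norm_add_le _ _).trans (by linarith)
  refine mol_lip k hc fun t ht => ?_
  have e1 : ‖y - t‖ ≤ ‖x‖ + 2 * mr k := (norm_sub_le _ _).trans (by linarith)
  have e2 : ‖x - t‖ ≤ ‖x‖ + 2 * mr k := (norm_sub_le _ _).trans (by linarith)
  have key : ∀ a b : Eu d, ‖b‖ ≤ ‖a‖ → ‖a‖ ≤ ‖x‖ + 2 * mr k → |f a - f b| ≤ C * (‖x‖ + 2 * mr k) * ‖a - b‖ := by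
    intro a b h1 h2
    refine (h.2 a b h1 (by linarith)).trans ?_
    rw [pow_one]; gcongr
  have e3 : y - x = (y - t) - (x - t) := by abel
  rw [e3]
  rcases le_total ‖y - t‖ ‖x - t‖ with h1 | h1
  · rw [abs_sub_comm, norm_sub_rev]; exact key _ _ h1 e2
  · exact key _ _ h1 e1

/-- weak divergence estimate for Lipschitz functions -/
lemma int_pd (hC : 0 ≤ C) (hc : Continuous f) (h : LO 3 1 C f) {Ψ : Eu d → ℝ} (hΨ : ContDiff ℝ 1 Ψ)
    {ρ : ℝ} (hρ0 : 0 ≤ ρ) (hρ : ρ ≤ 1) (hs : ∀ x ∉ closedBall (0 : Eu d) ρ, Ψ x = 0) (h0 : ∀ x, 0 ≤ Ψ x)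
    (i : Fin d) : |∫ x, f x * pd i Ψ x| ≤ C * ρ * ∫ x, Ψ x := by
  have hcs : HasCompactSupport Ψ := HasCompactSupport.intro (isCompact_closedBall 0 ρ) hs
  have h_int0 : Integrable Ψ := integrable_cs hΨ.continuous hcs
  have hb : ∀ k, |∫ x, mol k f x * pd i Ψ x| ≤ C * (ρ + 2 * mr k) * ∫ x, Ψ x := by
    intro k
    have e := integral_pd_mul ((mol_contDiff k hc).of_le one_le_inf) hΨ hcs i
    have e2 : |∫ x, mol k f x * pd i Ψ x| = |∫ x, pd i (mol k f) x * Ψ x| := by rw [e, abs_neg]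
    rw [e2, ← integral_const_mul]
    refine norm_integral_le_of_norm_le (f := fun x => pd i (mol k f) x * Ψ x) (h_int0.const_mul _)
      (Filter.Eventually.of_forall fun x => ?_)
    rw [norm_mul, Real.norm_eq_abs, Real.norm_eq_abs, abs_of_nonneg (h0 x)]
    by_cases hx : x ∈ closedBall (0 : Eu d) ρ
    · have hx' : ‖x‖ ≤ ρ := by simpa using hx
      have := h.mol_pd_le hC hc k (hx'.trans hρ) i
      have h0 := h0 x
      gcongr
      exact this.trans (by gcongr)
    · rw [hs x hx]; simp
  obtain ⟨K, hK⟩ := (isCompact_closedBall (0 : Eu d) (ρ + 1)).exists_bound_of_continuousOn hc.continuousOn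
  have hpc := continuous_pd hΨ i
  have L1 : Filter.Tendsto (fun k => ∫ x, mol k f x * pd i Ψ x) Filter.atTop (𝓝 (∫ x, f x * pd i Ψ x)) := by
    refine tendsto_integral_of_dominated_convergence (fun x => |K| * |pd i Ψ x|) (fun n => ?_) ?_ (fun n => ?_) ?_
    · have := (mol_contDiff n hc).continuous
      exact (by fun_prop : Continuous fun x => mol n f x * pd i Ψ x).aestronglyMeasurable
    · exact (integrable_cs hpc (hasCompactSupport_pd hcs i)).abs.const_mul _
    · refine Filter.Eventually.of_forall fun x => ?_
      rw [norm_mul, Real.norm_eq_abs, Real.norm_eq_abs]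
      by_cases hx : x ∈ closedBall (0 : Eu d) ρ
      · refine mul_le_mul_of_nonneg_right ?_ (abs_nonneg _)
        refine mol_abs_le n fun t ht => ?_
        have hx' : ‖x‖ ≤ ρ := by simpa using hx
        have hm1 : mr n ≤ 1 := by
          unfold mr; rw [div_le_one (by positivity)]
          have : (0 : ℝ) ≤ n := by positivity
          linarith
        refine (hK (x - t) ?_).trans (le_abs_self K)
        simp only [mem_closedBall, dist_zero_right]
        exact (norm_sub_le _ _).trans (by linarith)
      · have : pd i Ψ x = 0 := by
          refine pd_eq_zero_of_eventually i (c := 0) ?_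
          filter_upwards [isClosed_closedBall.isOpen_compl.mem_nhds hx] with y hy using hs y hy
        rw [this]; simp
    · exact Filter.Eventually.of_forall fun x => (mol_tendsto hc x).mul_const _
  have L2 : Filter.Tendsto (fun k => C * (ρ + 2 * mr k) * ∫ x, Ψ x) Filter.atTop (𝓝 (C * (ρ + 2 * 0) * ∫ x, Ψ x)) :=
    (((mr_tendsto.const_mul 2).const_add ρ).const_mul C).mul_const _
  rw [mul_zero, add_zero] at L2
  exact le_of_tendsto_of_tendsto' L1.abs L2 hb
end LO

/-! the vector field -/
section field
variable (A : Eu d → Matrix (Fin d) (Fin d) ℝ)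

def bb (x : Eu d) : Eu d := mv (A 0)⁻¹ x
def qq (x : Eu d) : ℝ := bform (A 0)⁻¹ x x
def gg (i : Fin d) (x : Eu d) : ℝ := ∑ j, (A x i j - A 0 i j) * bb A x j
def VV (i : Fin d) (x : Eu d) : ℝ := x i + gg A i x
def hh (x : Eu d) : ℝ := ∑ i, gg A i x * bb A x i
def pp (x : Eu d) : ℝ := ∑ i, VV A i x * bb A x i
def FF (i : Fin d) (x : Eu d) : ℝ := gg A i x - hh A x / pp A x * VV A i x

variable {A} {lam M : ℝ}

lemma VV_eq (hA : Coef lam M A) (hl : 0 < lam) (i : Fin d) (x : Eu d) : VV A i x = mv (A x) (bb A x) i := by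
  have h : mv (A 0) (bb A x) i = x i := by rw [bb, (hA.ell 0).mv_mv_inv hl]
  rw [VV, gg, ← h, mv_apply, mv_apply, ← Finset.sum_add_distrib]
  exact Finset.sum_congr rfl fun j _ => by ring

lemma pp_eq (hA : Coef lam M A) (hl : 0 < lam) (x : Eu d) : pp A x = bform (A x) (bb A x) (bb A x) := by
  rw [bform_eq_sum_mv, pp]
  exact Finset.sum_congr rfl fun i _ => by rw [VV_eq hA hl]

lemma pp_eq' (x : Eu d) : pp A x = qq A x + hh A x := by
  rw [pp, qq, hh, bform_eq_sum_mv, ← Finset.sum_add_distrib]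
  exact Finset.sum_congr rfl fun i _ => by rw [VV, bb]; ring

lemma pp_low (hA : Coef lam M A) (hl : 0 < lam) (x : Eu d) : lam * ‖x‖ ^ 2 ≤ pp A x := by
  rw [pp_eq hA hl]
  refine le_trans ?_ ((hA.ell x).low _)
  have := (hA.ell 0).le_norm_inv hl x
  unfold bb
  gcongr

lemma pp_high (hA : Coef lam M A) (hl : 0 < lam) (x : Eu d) : pp A x ≤ ‖x‖ ^ 2 / lam ^ 2 := by
  rw [pp_eq hA hl]
  refine ((hA.ell x).high _).trans ?_
  have := (hA.ell 0).norm_inv_le hl x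
  rw [← div_pow]; unfold bb
  gcongr

lemma bb_sub (x y : Eu d) : bb A x - bb A y = bb A (x - y) := by
  ext i
  simp only [bb, PiLp.sub_apply, mv_apply, mul_sub, Finset.sum_sub_distrib]

lemma bb_zero (i : Fin d) : bb A 0 i = 0 := by simp [bb, mv_apply]

lemma bb_le (hA : Coef lam M A) (hl : 0 < lam) (x : Eu d) (i : Fin d) : |bb A x i| ≤ ‖x‖ / lam :=
  (abs_coord_le _ _).trans ((hA.ell 0).norm_inv_le hl x)

lemma LO_bb (hA : Coef lam M A) (hl : 0 < lam) (R : ℝ) (i : Fin d) : LO R 0 (1 / lam) fun x => bb A x i := by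
  refine ⟨bb_zero i, fun x y _ _ => ?_⟩
  have := bb_le hA hl (x - y) i
  rw [← bb_sub] at this
  simpa [div_eq_inv_mul] using this

lemma LO_coord (R : ℝ) (i : Fin d) : LO R 0 1 fun x : Eu d => x i := by
  refine ⟨by simp, fun x y _ _ => ?_⟩
  simpa using abs_coord_le (x - y) i

lemma LO_A (hA : Coef lam M A) (R : ℝ) (i j : Fin d) : LO R 0 M fun x => A x i j - A 0 i j := by
  refine ⟨by simp, fun x y _ _ => ?_⟩
  simpa using hA.lip x y i j

/-- all the estimates for the field -/
theorem exists_field (d : ℕ) {lam M : ℝ} (hl : 0 < lam) (hM : 0 ≤ M) {R : ℝ} (hR : 0 ≤ R) : ∃ C, 0 < C ∧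
    ∀ A : Eu d → Matrix (Fin d) (Fin d) ℝ, Coef lam M A →
      (∀ i, LO R 1 C (gg A i)) ∧ LO R 2 C (hh A) ∧ (∀ i, LO R 1 C (FF A i)) := by
  set cg := (d : ℝ) * (2 * M * (1 / lam)) with hcg
  have cg0 : 0 ≤ cg := by positivity
  set ch := (d : ℝ) * (2 * cg * (1 / lam)) with hch
  have ch0 : 0 ≤ ch := by positivity
  set cV := 1 + cg * R with hcV
  have cV0 : 0 ≤ cV := by positivity
  set cp := (d : ℝ) * (2 * cV * (1 / lam)) with hcp
  have cp0 : 0 ≤ cp := by positivity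
  set cs := ch / lam + ch * cp / lam ^ 2 with hcs
  have cs0 : 0 ≤ cs := by positivity
  set cF := cg + 2 * cs * cV
  have cF0 : 0 ≤ cF := by positivity
  refine ⟨cg + ch + cF + 1, by positivity, fun A hA => ?_⟩
  have hb := LO_bb hA hl R
  have Hg : ∀ i, LO R 1 cg (gg A i) := fun i => by
    have := LO.sum (fun j => (LO_A hA R i j).mul (hb j))
    rw [Fintype.card_fin] at this; exact this
  have Hh : LO R 2 ch (hh A) := by
    have := LO.sum (fun j => (Hg j).mul (hb j))
    rw [Fintype.card_fin] at this; exact this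
  have HV : ∀ i, LO R 0 cV (VV A i) := fun i => (LO_coord R i).add ((Hg i).lower hR cg0)
  have Hp : LO R 1 cp (pp A) := by
    have := LO.sum (fun j => (HV j).mul (hb j))
    rw [Fintype.card_fin] at this; exact this
  have Hs : LO R 0 cs (fun x => hh A x / pp A x) := Hh.div hl ch0 cp0 Hp (pp_low hA hl)
  have HF : ∀ i, LO R 1 cF (FF A i) := fun i => (Hg i).sub (Hs.mul (HV i))
  exact ⟨fun i => (Hg i).mono (by linarith), Hh.mono (by linarith), fun i => (HF i).mono (by linarith)⟩

lemma cont_FF (hA : Coef lam M A) (hl : 0 < lam) (hM : 0 ≤ M) (i : Fin d) : Continuous (FF A i) :=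
  LO.cont (n := 1) fun R hR => by
    obtain ⟨C, -, h⟩ := exists_field d hl hM hR
    exact ⟨C, (h A hA).2.2 i⟩

lemma cont_bb (i : Fin d) : Continuous fun x => bb A x i := (contDiff_mv (A 0)⁻¹ i (n := 0)).continuous

lemma cont_qq : Continuous (qq A) := (contDiff_q (A 0)⁻¹ (n := 0)).continuous

lemma cont_gg (hA : Coef lam M A) (i : Fin d) : Continuous (gg A i) :=
  continuous_finsetSum _ fun j _ => ((hA.cont i j).sub continuous_const).mul (cont_bb j)

lemma cont_VV (hA : Coef lam M A) (i : Fin d) : Continuous (VV A i) :=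
  (contDiff_coord i (n := 0)).continuous.add (cont_gg hA i)

lemma cont_pp (hA : Coef lam M A) : Continuous (pp A) :=
  continuous_finsetSum _ fun j _ => (cont_VV hA j).mul (cont_bb j)

end field

/-- the ODE argument behind the monotonicity of the frequency -/
lemma freq_ode {H I H' I' J : ℝ → ℝ} {D C R Λ : ℝ} (hR0 : 0 < R) (hR : R ≤ 1) (hC : 0 ≤ C) (hD : 0 ≤ D)
    (hH : ∀ r, 0 ≤ H r) (hI : ∀ r, 0 ≤ I r) (hJ : ∀ r, 0 ≤ J r)
    (dH : ∀ r, 0 < r → r ≤ R → HasDerivAt H (H' r) r) (dI : ∀ r, 0 < r → r ≤ R → HasDerivAt I (I' r) r)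
    (h1 : ∀ r, 0 < r → r ≤ R → r * H' r ≤ (D + C * r) * H r + I r / 3)
    (h2 : ∀ r, 0 < r → r ≤ R → (D - C * r) * I r + 12 * J r ≤ r * I' r)
    (h3 : ∀ r, 0 < r → r ≤ R → I r ^ 2 ≤ 36 * (H r * J r))
    (hΛ : I R ≤ Λ * H R) (hpos : 0 < H R) {r t : ℝ} (hr : 0 < r) (hrt : r ≤ t) (htR : t ≤ R) :
    H t ≤ (t / r) ^ (D + C + Real.exp (2 * C) * Λ / 3) * H r := by
  have hrR := hrt.trans htR
  have ht0 : 0 < t := hr.trans_le hrt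
  have hΛ0 : 0 ≤ Λ := by
    by_contra hh
    push Not at hh
    nlinarith [hI R]
  set K := D + C + Real.exp (2 * C) * Λ / 3 with hK
  have key : ∀ δ : ℝ, 0 < δ → H t + δ ≤ (t / r) ^ K * (H r + δ) := by
    intro δ hδ
    have hp : ∀ s, 0 < H s + δ := fun s => add_pos_of_nonneg_of_pos (hH s) hδ
    -- monotonicity of the frequency
    have mono : MonotoneOn (fun s => I s / (H s + δ) * Real.exp (2 * C * s)) (Icc r R) := by
      have hd : ∀ s ∈ Icc r R, HasDerivAt (fun s => I s / (H s + δ) * Real.exp (2 * C * s))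
          ((I' s * (H s + δ) - I s * H' s) / (H s + δ) ^ 2 * Real.exp (2 * C * s)
            + I s / (H s + δ) * (Real.exp (2 * C * s) * (2 * C))) s := by
        intro s hs
        have a := (dI s (hr.trans_le hs.1) hs.2).div ((dH s (hr.trans_le hs.1) hs.2).add_const δ) (hp s).ne'
        have b : HasDerivAt (fun s : ℝ => Real.exp (2 * C * s)) (Real.exp (2 * C * s) * (2 * C)) s := by
          simpa using ((hasDerivAt_id s).const_mul (2 * C)).exp
        exact a.mul b
      refine monotoneOn_of_deriv_nonneg (convex_Icc r R)
        (fun s hs => (hd s hs).continuousAt.continuousWithinAt)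
        (fun s hs => (hd s (interior_subset hs)).differentiableAt.differentiableWithinAt) (fun s hs => ?_)
      have hs' := interior_subset hs
      have hs0 : 0 < s := hr.trans_le hs'.1
      rw [(hd s hs').deriv]
      have a1 := h1 s hs0 hs'.2
      have a2 := h2 s hs0 hs'.2
      have a3 := h3 s hs0 hs'.2
      have e : (I' s * (H s + δ) - I s * H' s) / (H s + δ) ^ 2 * Real.exp (2 * C * s)
            + I s / (H s + δ) * (Real.exp (2 * C * s) * (2 * C)) =
          (s * I' s * (H s + δ) - I s * (s * H' s) + 2 * C * s * I s * (H s + δ)) *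
            (Real.exp (2 * C * s) / (s * (H s + δ) ^ 2)) := by
        have := (hp s).ne'
        field_simp
      rw [e]
      refine mul_nonneg ?_ (by have := hp s; positivity)
      have b1 : ((D - C * s) * I s + 12 * J s) * (H s + δ) ≤ s * I' s * (H s + δ) :=
        mul_le_mul_of_nonneg_right a2 (hp s).le
      have b2 : I s * (s * H' s) ≤ I s * ((D + C * s) * H s + I s / 3) := mul_le_mul_of_nonneg_left a1 (hI s)
      have b3 : 0 ≤ (D * I s + 12 * J s + C * s * I s) * δ := by
        have := hI s; have := hJ s; positivity
      nlinarith
    have hN : ∀ s ∈ Icc r R, I s ≤ Real.exp (2 * C) * Λ * (H s + δ) := by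
      intro s hs
      have m := mono hs ⟨hrR, le_rfl⟩ hs.2
      simp only at m
      have e1 : 1 ≤ Real.exp (2 * C * s) := Real.one_le_exp (by have := hr.trans_le hs.1; positivity)
      have e2 : Real.exp (2 * C * R) ≤ Real.exp (2 * C) := Real.exp_le_exp.2 (by nlinarith)
      have e3 : I R / (H R + δ) ≤ Λ := by
        rw [div_le_iff₀ (hp R)]; nlinarith
      have e4 : I s / (H s + δ) ≤ Real.exp (2 * C) * Λ := by
        have q0 : 0 ≤ I s / (H s + δ) := div_nonneg (hI s) (hp s).le
        calc I s / (H s + δ) ≤ I s / (H s + δ) * Real.exp (2 * C * s) := le_mul_of_one_le_right q0 e1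
          _ ≤ _ := m
          _ ≤ Λ * Real.exp (2 * C) := by gcongr
          _ = _ := by ring
      rwa [div_le_iff₀ (hp s)] at e4
    have anti : AntitoneOn (fun s => Real.log (H s + δ) - K * Real.log s) (Icc r R) := by
      have hd : ∀ s ∈ Icc r R, HasDerivAt (fun s => Real.log (H s + δ) - K * Real.log s)
          (H' s / (H s + δ) - K * s⁻¹) s := by
        intro s hs
        exact (((dH s (hr.trans_le hs.1) hs.2).add_const δ).log (hp s).ne').sub
          ((Real.hasDerivAt_log (hr.trans_le hs.1).ne').const_mul K)
      refine antitoneOn_of_deriv_nonpos (convex_Icc r R)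
        (fun s hs => (hd s hs).continuousAt.continuousWithinAt)
        (fun s hs => (hd s (interior_subset hs)).differentiableAt.differentiableWithinAt) (fun s hs => ?_)
      have hs' := interior_subset hs
      have hs0 : 0 < s := hr.trans_le hs'.1
      rw [(hd s hs').deriv, sub_nonpos, div_le_iff₀ (hp s), ← sub_nonneg]
      have e : K * s⁻¹ * (H s + δ) - H' s = (K * (H s + δ) - s * H' s) * s⁻¹ := by field_simp
      rw [e]
      refine mul_nonneg ?_ (by positivity)
      have a1 := h1 s hs0 hs'.2
      have a4 := hN s hs'
      have s1 : s ≤ 1 := hs'.2.trans hR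
      have : C * s * H s ≤ C * H s := by
        have := hH s
        calc C * s * H s ≤ C * 1 * H s := by gcongr
          _ = _ := by ring
      have : 0 ≤ (D + C) * δ := by positivity
      rw [hK]; linarith
    have m := anti ⟨le_rfl, hrR⟩ ⟨hrt, htR⟩ hrt
    simp only at m
    have e : Real.log (H t + δ) ≤ Real.log ((t / r) ^ K * (H r + δ)) := by
      rw [Real.log_mul (by positivity) (hp r).ne', Real.log_rpow (by positivity),
        Real.log_div ht0.ne' hr.ne']
      linarith
    exact (Real.log_le_log_iff (hp t) (mul_pos (by positivity) (hp r))).1 e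
  have t1 : Filter.Tendsto (fun δ : ℝ => H t + δ) (𝓝[>] 0) (𝓝 (H t + 0)) :=
    (Continuous.tendsto (by fun_prop) 0).mono_left nhdsWithin_le_nhds
  have t2 : Filter.Tendsto (fun δ : ℝ => (t / r) ^ K * (H r + δ)) (𝓝[>] 0) (𝓝 ((t / r) ^ K * (H r + 0))) :=
    (Continuous.tendsto (by fun_prop) 0).mono_left nhdsWithin_le_nhds
  simpa using le_of_tendsto_of_tendsto t1 t2 (eventually_mem_nhdsWithin.mono fun δ hδ => key δ hδ)

lemma hasDerivAt_pospow (n : ℕ) (s : ℝ) :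
    HasDerivAt (fun s : ℝ => max s 0 ^ (n + 2)) ((n + 2 : ℕ) * max s 0 ^ (n + 1)) s := by
  rcases lt_trichotomy s 0 with h | h | h
  · have e : (fun s : ℝ => max s 0 ^ (n + 2)) =ᶠ[𝓝 s] fun _ => 0 := by
      filter_upwards [gt_mem_nhds h] with t ht
      rw [max_eq_right (le_of_lt ht)]; simp
    rw [max_eq_right h.le]
    simpa using (hasDerivAt_const s (0 : ℝ)).congr_of_eventuallyEq e
  · subst h
    have e : (fun s : ℝ => max s 0 ^ (n + 2)) =O[𝓝 0] fun s => ‖s - 0‖ ^ (n + 2) := by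
      refine Asymptotics.IsBigO.of_bound 1 (Filter.Eventually.of_forall fun t => ?_)
      rw [norm_pow, norm_pow, norm_norm, one_mul, sub_zero]
      gcongr
      rw [Real.norm_eq_abs, Real.norm_eq_abs, abs_of_nonneg (le_max_right _ _)]
      exact max_le (le_abs_self t) (abs_nonneg t)
    have := (e.hasFDerivAt (by omega)).hasDerivAt
    simpa using this
  · have e : (fun s : ℝ => max s 0 ^ (n + 2)) =ᶠ[𝓝 s] fun s => s ^ (n + 2) := by
      filter_upwards [lt_mem_nhds h] with t ht
      rw [max_eq_left (le_of_lt ht)]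
    rw [max_eq_left h.le]
    have := (hasDerivAt_pow (n + 2) s).congr_of_eventuallyEq e
    simpa using this

lemma contDiff_pospow (n : ℕ) : ContDiff ℝ 1 (fun s : ℝ => max s 0 ^ (n + 2)) := by
  rw [contDiff_one_iff_deriv]
  refine ⟨fun s => (hasDerivAt_pospow n s).differentiableAt, ?_⟩
  rw [show deriv (fun s : ℝ => max s 0 ^ (n + 2)) = fun s : ℝ => ((n + 2 : ℕ) : ℝ) * max s 0 ^ (n + 1) from
    funext fun s => (hasDerivAt_pospow n s).deriv]
  fun_prop

section
variable {lam M : ℝ} {Ω : Set (Eu d)} {A : Eu d → Matrix (Fin d) (Fin d) ℝ} {u : Eu d → ℝ}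

/-- the weight -/
def PP (A : Eu d → Matrix (Fin d) (Fin d) ℝ) (r : ℝ) (x : Eu d) : ℝ := max (r ^ 2 - qq A x) 0

lemma PP_nonneg (r : ℝ) (x : Eu d) : 0 ≤ PP A r x := le_max_right _ _

lemma cont_PP (r : ℝ) : Continuous (PP A r) := by
  have := cont_qq (A := A)
  unfold PP; fun_prop

lemma PP_zero (hA : Coef lam M A) (hl : 0 < lam) {r : ℝ} (hr : 0 ≤ r) {x : Eu d} (hx : x ∉ closedBall (0 : Eu d) r) :
    PP A r x = 0 := by
  have := (hA.ell 0).q_ge hl x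
  simp at hx
  refine max_eq_right ?_
  unfold qq; nlinarith

lemma PP_le (hA : Coef lam M A) (hl : 0 < lam) (r : ℝ) (x : Eu d) : PP A r x ≤ r ^ 2 := by
  have := (hA.ell 0).q_nonneg hl x
  exact max_le (by unfold qq; linarith) (sq_nonneg r)

lemma contDiff_PP (r : ℝ) (n : ℕ) : ContDiff ℝ 1 (fun x => PP A r x ^ (n + 2)) :=
  (contDiff_pospow n).comp (contDiff_const.sub (contDiff_q (A 0)⁻¹))

lemma pd_PP (hA : Coef lam M A) (r : ℝ) (n : ℕ) (i : Fin d) (x : Eu d) :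
    pd i (fun x => PP A r x ^ (n + 2)) x = - (2 * (n + 2 : ℕ) * PP A r x ^ (n + 1) * bb A x i) := by
  have hq : Differentiable ℝ (fun y : Eu d => bform (A 0)⁻¹ y y) :=
    (contDiff_q (A 0)⁻¹ (n := 1)).differentiable one_ne_zero
  have h1 := pd_comp (f := fun y => r ^ 2 - qq A y) (x := x) i (hasDerivAt_pospow n (r ^ 2 - qq A x))
    ((differentiableAt_const _).sub (hq x))
  have h2 : pd i (fun y => r ^ 2 - qq A y) x = - (2 * bb A x i) := by
    have e := pd_sub (f := fun _ : Eu d => r ^ 2) i (differentiableAt_const _) (hq x)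
    rw [pd_const, pd_q ((hA.ell 0).inv_symm) i x, zero_sub] at e
    exact e
  rw [h2] at h1
  refine h1.trans ?_
  unfold PP; ring

lemma pd_PP2 (hA : Coef lam M A) (r : ℝ) (i : Fin d) (x : Eu d) :
    pd i (fun x => PP A r x ^ 2) x = - (4 * PP A r x * bb A x i) := by
  have := pd_PP hA r 0 i x
  norm_num at this; exact this

lemma pd_PP3 (hA : Coef lam M A) (r : ℝ) (i : Fin d) (x : Eu d) :
    pd i (fun x => PP A r x ^ 3) x = - (6 * PP A r x ^ 2 * bb A x i) := by
  have := pd_PP hA r 1 i x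
  norm_num at this; exact this

lemma contDiff_PP2 (r : ℝ) : ContDiff ℝ 1 (fun x => PP A r x ^ 2) := by
  simpa using contDiff_PP (A := A) r 0

lemma contDiff_PP3 (r : ℝ) : ContDiff ℝ 1 (fun x => PP A r x ^ 3) := by
  simpa using contDiff_PP (A := A) r 1

lemma cs_PP (hA : Coef lam M A) (hl : 0 < lam) {r : ℝ} (hr : 0 ≤ r) {n : ℕ} (hn : n ≠ 0) :
    HasCompactSupport (fun x => PP A r x ^ n) :=
  HasCompactSupport.intro (isCompact_closedBall 0 r) fun x hx => by simp [PP_zero hA hl hr hx, hn]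

lemma ts_PP (hA : Coef lam M A) (hl : 0 < lam) {r : ℝ} (hr : 0 ≤ r) {n : ℕ} (hn : n ≠ 0) (g : Eu d → ℝ) :
    tsupport (fun x => PP A r x ^ n * g x) ⊆ closedBall 0 r := by
  refine closure_minimal (fun x hx => ?_) isClosed_closedBall
  by_contra hh
  exact hx (by simp [PP_zero hA hl hr hh, hn])

def fb (A : Eu d → Matrix (Fin d) (Fin d) ℝ) (u : Eu d → ℝ) (x : Eu d) : ℝ := ∑ i, fl A u i x * bb A x i

lemma Sol.cont_fb (h : Sol lam M Ω A u) : Continuous (fb A u) :=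
  continuous_finsetSum _ fun i _ => (h.cont_fl i).mul (cont_bb i)

lemma fb_eq (hA : Coef lam M A) (hl : 0 < lam) (x : Eu d) : fb A u x = ∑ i, VV A i x * pd i u x := by
  simp only [VV_eq hA hl, fb, fl, mv_apply, Finset.sum_mul]
  rw [Finset.sum_comm]
  refine Finset.sum_congr rfl fun i _ => Finset.sum_congr rfl fun j _ => ?_
  rw [(hA.ell x).symm j i]; ring

end

section
variable {lam M : ℝ} {Ω : Set (Eu d)} {A : Eu d → Matrix (Fin d) (Fin d) ℝ} {u : Eu d → ℝ}

lemma integrable_PP (hA : Coef lam M A) (hl : 0 < lam) {r : ℝ} (hr : 0 ≤ r) {f : Eu d → ℝ} (hf : Continuous f)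
    (h0 : ∀ x, PP A r x = 0 → f x = 0) : Integrable f :=
  integrable_cs hf (HasCompactSupport.intro (isCompact_closedBall 0 r) fun x hx => h0 x (PP_zero hA hl hr hx))

/-- identity (i) -/
lemma freq_i (h : Sol lam M Ω A u) (hl : 0 < lam) (hΩ : IsOpen Ω) {r : ℝ} (hr : 0 ≤ r) (hs : closedBall 0 r ⊆ Ω) :
    ∫ x, en A u x * PP A r x ^ 3 = 6 * ∫ x, u x * fb A u x * PP A r x ^ 2 := by
  have c1 : ContDiff ℝ 1 (fun x => PP A r x ^ 3) := contDiff_PP3 r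
  have w := h.weak2 hl hΩ (ψ := fun x => PP A r x ^ 3 * u x) (c1.mul h.c1) (h.cs.mul_left)
    ((ts_PP h.toCoef hl hr three_ne_zero u).trans hs)
  have e : ∀ x, ∑ i, fl A u i x * pd i (fun x => PP A r x ^ 3 * u x) x =
      en A u x * PP A r x ^ 3 - 6 * (u x * fb A u x * PP A r x ^ 2) := by
    intro x
    rw [en_eq, fb, Finset.sum_mul, Finset.mul_sum, Finset.sum_mul, Finset.mul_sum, ← Finset.sum_sub_distrib]
    refine Finset.sum_congr rfl fun i _ => ?_
    rw [pd_mul i (c1.differentiable one_ne_zero x) (h.c1.differentiable one_ne_zero x),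
      pd_PP3 h.toCoef r i x]
    ring
  simp only [e] at w
  have cP := cont_PP (A := A) r
  have cu := h.c1.continuous
  have cf := h.cont_fb
  have ce := h.cont_en
  have i1 : Integrable fun x => en A u x * PP A r x ^ 3 := 
    integrable_PP h.toCoef hl hr (by fun_prop) fun x hx => by simp [hx]
  have i2 : Integrable fun x => 6 * (u x * fb A u x * PP A r x ^ 2) :=
    integrable_PP h.toCoef hl hr (by fun_prop) fun x hx => by simp [hx]
  rw [integral_sub i1 i2, integral_const_mul] at w
  linarith
/-- conformal factor -/
def mu (A : Eu d → Matrix (Fin d) (Fin d) ℝ) (x : Eu d) : ℝ := open Classical in if x = 0 then 1 else pp A x / qq A x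

lemma qq_pos (hA : Coef lam M A) (hl : 0 < lam) {x : Eu d} (hx : x ≠ 0) : 0 < qq A x := by
  have := (hA.ell 0).q_ge hl x
  have : 0 < ‖x‖ := norm_pos_iff.2 hx
  exact lt_of_lt_of_le (by positivity) ((hA.ell 0).q_ge hl x)

lemma qq_zero : qq A 0 = 0 := by simp [qq, bform]

lemma gg_zero (i : Fin d) : gg A i 0 = 0 := by simp [gg]
lemma VV_zero (i : Fin d) : VV A i 0 = 0 := by simp [VV, gg_zero]
lemma pp_zero : pp A 0 = 0 := by simp [pp, VV_zero]
lemma FF_zero (i : Fin d) : FF A i 0 = 0 := by simp [FF, VV_zero, gg_zero]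

lemma mu_mul_qq (hA : Coef lam M A) (hl : 0 < lam) (x : Eu d) : mu A x * qq A x = pp A x := by
  unfold mu
  split_ifs with h
  · subst h; simp [qq_zero, pp_zero]
  · exact div_mul_cancel₀ _ (qq_pos hA hl h).ne'

lemma mu_low (hA : Coef lam M A) (hl : 0 < lam) (hl1 : lam ≤ 1) (x : Eu d) : lam ^ 2 ≤ mu A x := by
  unfold mu
  split_ifs with h
  · nlinarith
  · rw [le_div_iff₀ (qq_pos hA hl h)]
    have h1 := (hA.ell 0).q_le hl x
    have h2 := pp_low hA hl x
    rw [le_div_iff₀ hl] at h1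
    unfold qq; nlinarith

lemma mu_high (hA : Coef lam M A) (hl : 0 < lam) (hl1 : lam ≤ 1) (x : Eu d) : mu A x ≤ 1 / lam ^ 2 := by
  unfold mu
  split_ifs with h
  · rw [le_div_iff₀ (by positivity)]; nlinarith
  · rw [div_le_div_iff₀ (qq_pos hA hl h) (by positivity)]
    have h1 := (hA.ell 0).q_ge hl x
    have h2 := pp_high hA hl x
    rw [le_div_iff₀ (by positivity)] at h2
    unfold qq; linarith

lemma mu_pos (hA : Coef lam M A) (hl : 0 < lam) (hl1 : lam ≤ 1) (x : Eu d) : 0 < mu A x :=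
  lt_of_lt_of_le (by positivity) (mu_low hA hl hl1 x)

lemma meas_mu (hA : Coef lam M A) : Measurable (mu A) := by
  classical
  have := (cont_pp hA).measurable
  have := (cont_qq (A := A)).measurable
  unfold mu
  exact Measurable.ite (measurableSet_singleton 0) measurable_const (by fun_prop)

lemma mu_sub_one (hA : Coef lam M A) (hl : 0 < lam) {C : ℝ} (hC : 0 ≤ C) (hh' : LO 3 2 C (hh A)) {x : Eu d} (hx : ‖x‖ ≤ 3) :
    |mu A x - 1| ≤ C * ‖x‖ := by
  unfold mu
  split_ifs with h
  · subst h; simp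
  · have hq := qq_pos hA hl h
    have e : pp A x / qq A x - 1 = hh A x / qq A x := by
      rw [pp_eq']; field_simp; ring
    rw [e, abs_div, abs_of_pos hq, div_le_iff₀ hq]
    have h1 := (hA.ell 0).q_ge hl x
    calc _ ≤ _ := hh'.bd hx
      _ = C * ‖x‖ * ‖x‖ ^ 2 := by ring
      _ ≤ _ := by gcongr; exact h1

lemma field_eq (hA : Coef lam M A) (hl : 0 < lam) (hl1 : lam ≤ 1) (i : Fin d) (x : Eu d) :
    x i + FF A i x = (mu A x)⁻¹ * VV A i x := by
  by_cases h : x = 0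
  · subst h; simp [FF_zero, VV_zero]
  · have hq := qq_pos hA hl h
    have hp : 0 < pp A x := by
      rw [← mu_mul_qq hA hl]; exact mul_pos (mu_pos hA hl hl1 x) hq
    unfold mu; rw [if_neg h]
    unfold FF
    have : hh A x = pp A x - qq A x := by rw [pp_eq']; ring
    rw [this]
    have : VV A i x = x i + gg A i x := rfl
    field_simp
    rw [this]; ring

/-- derivative in `r` -/
lemma deriv_PP (hA : Coef lam M A) (hl : 0 < lam) {w : Eu d → ℝ} (hw : Integrable w) (n : ℕ) (r : ℝ) :
    HasDerivAt (fun r => ∫ x, w x * PP A r x ^ (n + 2))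
      (∫ x, w x * (((n + 2 : ℕ) : ℝ) * PP A r x ^ (n + 1) * (2 * r))) r := by
  have hmeas : ∀ (s : ℝ) (m : ℕ), AEStronglyMeasurable (fun x => PP A s x ^ m) (volume : Measure (Eu d)) := fun s m => by
    have := cont_PP (A := A) s
    exact (by fun_prop : Continuous fun x => PP A s x ^ m).aestronglyMeasurable
  have hb : ∀ s ∈ ball r 1, ∀ x, PP A s x ≤ (|r| + 1) ^ 2 := fun s hs x => by
    refine (PP_le hA hl s x).trans ?_
    have : |s - r| < 1 := hs
    rw [← sq_abs s]
    have : |s| ≤ |r| + 1 := by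
      have := abs_sub_abs_le_abs_sub s r
      linarith
    gcongr
  refine (hasDerivAt_integral_of_dominated_loc_of_deriv_le (μ := (volume : Measure (Eu d)))
    (F := fun s x => w x * PP A s x ^ (n + 2))
    (F' := fun s x => w x * (((n + 2 : ℕ) : ℝ) * PP A s x ^ (n + 1) * (2 * s)))
    (bound := fun x => |w x| * (((n + 2 : ℕ) : ℝ) * ((|r| + 1) ^ 2) ^ (n + 1) * (2 * (|r| + 1))))
    (s := ball r 1) (ball_mem_nhds r one_pos) ?_ ?_ ?_ ?_ ?_ ?_).2
  · exact Filter.Eventually.of_forall fun s => hw.aestronglyMeasurable.mul (hmeas s _)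
  · refine Integrable.mono' (hw.abs.mul_const (((|r| + 1) ^ 2) ^ (n + 2))) (hw.aestronglyMeasurable.mul (hmeas r _)) ?_
    refine Filter.Eventually.of_forall fun x => ?_
    rw [norm_mul, Real.norm_eq_abs, norm_pow, Real.norm_eq_abs, abs_of_nonneg (PP_nonneg r x)]
    have := hb r (mem_ball_self one_pos) x
    have := PP_nonneg (A := A) r x
    gcongr
  · exact hw.aestronglyMeasurable.mul (((hmeas r _).const_mul _).mul_const _)
  · refine Filter.Eventually.of_forall fun x s hs => ?_
    rw [norm_mul, Real.norm_eq_abs]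
    have h1 := hb s hs x
    have h2 := PP_nonneg (A := A) s x
    have h3 : |s| ≤ |r| + 1 := by
      have : |s - r| < 1 := hs
      have := abs_sub_abs_le_abs_sub s r
      linarith
    rw [norm_mul, norm_mul, norm_mul, norm_pow, Real.norm_eq_abs, Real.norm_eq_abs, Real.norm_eq_abs, Real.norm_eq_abs,
      abs_of_nonneg h2, abs_two, Nat.abs_cast]
    gcongr
  · exact hw.abs.mul_const _
  · refine Filter.Eventually.of_forall fun x s hs => ?_
    have a := hasDerivAt_pospow n (s ^ 2 - qq A x)
    have b : HasDerivAt (fun s : ℝ => s ^ 2 - qq A x) (2 * s) s := by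
      simpa using (hasDerivAt_pow 2 s).sub_const (qq A x)
    exact (a.comp s b).const_mul (w x)
end

section
variable {lam M : ℝ} {Ω : Set (Eu d)} {A : Eu d → Matrix (Fin d) (Fin d) ℝ} {u : Eu d → ℝ}

lemma Sol.int_mu (h : Sol lam M Ω A u) (hl : 0 < lam) (hl1 : lam ≤ 1) {f : Eu d → ℝ} (hf : Integrable f) :
    Integrable (fun x => f x * mu A x) := by
  refine Integrable.mono' (hf.abs.mul_const (1 / lam ^ 2))
    (hf.aestronglyMeasurable.mul (meas_mu h.toCoef).aestronglyMeasurable) (Filter.Eventually.of_forall fun x => ?_)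
  rw [norm_mul, Real.norm_eq_abs, Real.norm_eq_abs, abs_of_pos (mu_pos h.toCoef hl hl1 x)]
  gcongr
  exact mu_high h.toCoef hl hl1 x

lemma Sol.int_mu_inv (h : Sol lam M Ω A u) (hl : 0 < lam) (hl1 : lam ≤ 1) {f : Eu d → ℝ} (hf : Integrable f) :
    Integrable (fun x => f x * (mu A x)⁻¹) := by
  refine Integrable.mono' (hf.abs.mul_const (1 / lam ^ 2))
    (hf.aestronglyMeasurable.mul (meas_mu h.toCoef).inv.aestronglyMeasurable) (Filter.Eventually.of_forall fun x => ?_)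
  have hp := mu_pos h.toCoef hl hl1 x
  rw [norm_mul, Real.norm_eq_abs, Real.norm_eq_abs, abs_of_pos (inv_pos.2 hp)]
  gcongr
  rw [← one_div]
  exact one_div_le_one_div_of_le (by positivity) (mu_low h.toCoef hl hl1 x)

/-- estimate (ii) -/
lemma freq_ii (d : ℕ) {lam M : ℝ} (hl : 0 < lam) (hl1 : lam ≤ 1) (hM : 0 ≤ M) : ∃ C, 0 ≤ C ∧
    ∀ (Ω : Set (Eu d)) (A : Eu d → Matrix (Fin d) (Fin d) ℝ) (u : Eu d → ℝ), Sol lam M Ω A u → IsOpen Ω →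
    ∀ r : ℝ, 0 ≤ r → r ≤ 1 → closedBall 0 r ⊆ Ω →
      4 * (∫ x, u x ^ 2 * pp A x * PP A r x) ≤ (d + C * r) * (∫ x, u x ^ 2 * mu A x * PP A r x ^ 2)
        + (∫ x, en A u x * PP A r x ^ 3) / 3 := by
  obtain ⟨C, hC, hfield⟩ := exists_field d hl hM (R := 3) (by norm_num)
  refine ⟨(d * C + d * C) / lam ^ 2, by positivity, fun Ω A u h hΩ r hr hr1 hs => ?_⟩
  obtain ⟨hg, hh', -⟩ := hfield A h.toCoef
  have cP := cont_PP (A := A) r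
  have cu := h.c1.continuous
  have cf := h.cont_fb
  have cp := cont_pp h.toCoef
  have cg := fun i => cont_gg h.toCoef i
  set Ψ : Eu d → ℝ := fun x => u x ^ 2 * PP A r x ^ 2 with hΨ
  have cΨ : ContDiff ℝ 1 Ψ := (h.c1.pow 2).mul (contDiff_PP2 r)
  have sΨ : ∀ x ∉ closedBall (0 : Eu d) r, Ψ x = 0 := fun x hx => by simp [Ψ, PP_zero h.toCoef hl hr hx]
  have csΨ : HasCompactSupport Ψ := HasCompactSupport.intro (isCompact_closedBall 0 r) sΨ
  have pΨ : ∀ x, 0 ≤ Ψ x := fun x => by positivity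
  have iΨ : Integrable Ψ := integrable_cs cΨ.continuous csΨ
  have dΨ : ∀ i x, pd i Ψ x = 2 * u x * pd i u x * PP A r x ^ 2 - 4 * u x ^ 2 * PP A r x * bb A x i := by
    intro i x
    have hu := h.c1.differentiable one_ne_zero x
    have e1 : pd i (fun x => u x ^ 2) x = 2 * u x * pd i u x := by
      have := pd_mul i hu hu
      rw [show (fun x => u x ^ 2) = fun x => u x * u x from funext fun x => pow_two _, this]; ring
    have := pd_mul i ((h.c1.pow 2).differentiable one_ne_zero x) ((contDiff_PP2 (A := A) r).differentiable one_ne_zero x)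
    rw [e1, pd_PP2 h.toCoef] at this
    rw [hΨ, this]; ring
  have cpΨ := fun i => continuous_pd cΨ i
  have csp := fun i => hasCompactSupport_pd csΨ i
  -- the basic identity
  have id1 : ∫ x, ∑ i, VV A i x * pd i Ψ x = (∫ x, en A u x * PP A r x ^ 3) / 3 - 4 * ∫ x, u x ^ 2 * pp A x * PP A r x := by
    have e : ∀ x, ∑ i, VV A i x * pd i Ψ x = 2 * (u x * fb A u x * PP A r x ^ 2) - 4 * (u x ^ 2 * pp A x * PP A r x) := by
      intro x
      rw [fb_eq h.toCoef hl, pp]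
      simp only [dΨ, Finset.mul_sum, Finset.sum_mul, ← Finset.sum_sub_distrib]
      exact Finset.sum_congr rfl fun i _ => by ring
    simp only [e]
    have i1 : Integrable fun x => 2 * (u x * fb A u x * PP A r x ^ 2) :=
      integrable_PP h.toCoef hl hr (by fun_prop) fun x hx => by simp [hx]
    have i2 : Integrable fun x => 4 * (u x ^ 2 * pp A x * PP A r x) :=
      integrable_PP h.toCoef hl hr (by fun_prop) fun x hx => by simp [hx]
    rw [integral_sub i1 i2, integral_const_mul, integral_const_mul, freq_i h hl hΩ hr hs]
    ring
  have i3 : ∀ i, Integrable fun x : Eu d => x i * pd i Ψ x := fun i => by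
    have : Continuous fun x : Eu d => x i := (contDiff_coord i (n := 0)).continuous
    exact integrable_cs (this.mul (cpΨ i)) (HasCompactSupport.intro (csp i) fun x hx => by
      rw [image_eq_zero_of_notMem_tsupport hx, mul_zero])
  have i4 : ∀ i, Integrable fun x : Eu d => gg A i x * pd i Ψ x := fun i =>
    integrable_cs ((cg i).mul (cpΨ i)) (HasCompactSupport.intro (csp i) fun x hx => by
      rw [image_eq_zero_of_notMem_tsupport hx, mul_zero])
  have id2 : ∫ x, ∑ i, VV A i x * pd i Ψ x = - (d * ∫ x, Ψ x) + ∑ i, ∫ x, gg A i x * pd i Ψ x := by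
    have e : ∀ x, ∑ i, VV A i x * pd i Ψ x = ∑ i, (x i * pd i Ψ x + gg A i x * pd i Ψ x) := fun x =>
      Finset.sum_congr rfl fun i _ => by rw [VV]; ring
    simp only [e]
    have i5 : ∀ i ∈ Finset.univ, Integrable fun x : Eu d => x i * pd i Ψ x + gg A i x * pd i Ψ x :=
      fun i _ => (i3 i).add (i4 i)
    rw [integral_finsetSum _ i5]
    have e2 : ∀ i : Fin d, ∫ x, (x i * pd i Ψ x + gg A i x * pd i Ψ x) = - (∫ x, Ψ x) + ∫ x, gg A i x * pd i Ψ x := by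
      intro i
      rw [integral_add (i3 i) (i4 i)]
      have := integral_pd_mul (f := fun x : Eu d => x i) (contDiff_coord i) cΨ csΨ i
      simp only [pd_coord, if_true, one_mul] at this
      rw [this]; simp
    simp only [e2]
    rw [Finset.sum_add_distrib]; simp
  have b1 : |∑ i, ∫ x, gg A i x * pd i Ψ x| ≤ d * (C * r * ∫ x, Ψ x) := by
    refine (Finset.abs_sum_le_sum_abs _ _).trans ?_
    refine (Finset.sum_le_sum fun i _ => (hg i).int_pd hC.le (cg i) cΨ hr hr1 sΨ pΨ i).trans ?_
    simp
  -- comparing with H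
  have iH : Integrable fun x => Ψ x * mu A x := h.int_mu hl hl1 iΨ
  have eH : ∫ x, u x ^ 2 * mu A x * PP A r x ^ 2 = ∫ x, Ψ x * mu A x := by
    congr 1; ext x; simp only [Ψ]; ring
  rw [eH]
  have b2 : (∫ x, Ψ x) - (∫ x, Ψ x * mu A x) ≤ C * r * ∫ x, Ψ x := by
    rw [← integral_sub iΨ iH, ← integral_const_mul]
    refine integral_mono (iΨ.sub iH) (iΨ.const_mul _) fun x => ?_
    simp only
    by_cases hx : x ∈ closedBall (0 : Eu d) r
    · have hx' : ‖x‖ ≤ r := by simpa using hx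
      have := mu_sub_one h.toCoef hl hC.le hh' (x := x) (by linarith)
      have h1 : 1 - mu A x ≤ C * r := by
        have := neg_abs_le (mu A x - 1)
        have : C * ‖x‖ ≤ C * r := by gcongr
        linarith
      have := mul_le_mul_of_nonneg_left h1 (pΨ x)
      linarith
    · rw [sΨ x hx]; simp
  have b3 : ∫ x, Ψ x ≤ (∫ x, Ψ x * mu A x) / lam ^ 2 := by
    rw [le_div_iff₀ (by positivity), ← integral_mul_const]
    refine integral_mono (iΨ.mul_const _) iH fun x => ?_
    exact mul_le_mul_of_nonneg_left (mu_low h.toCoef hl hl1 x) (pΨ x)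
  have b4 := (abs_le.1 b1).1
  have b5 : (d * C + d * C) * r * (∫ x, Ψ x) ≤ (d * C + d * C) * r * ((∫ x, Ψ x * mu A x) / lam ^ 2) := by gcongr
  have b6 : (d : ℝ) * ((∫ x, Ψ x) - (∫ x, Ψ x * mu A x)) ≤ d * (C * r * ∫ x, Ψ x) := by gcongr
  have e7 : (d + (d * C + d * C) / lam ^ 2 * r) * (∫ x, Ψ x * mu A x)
      = d * (∫ x, Ψ x * mu A x) + (d * C + d * C) * r * ((∫ x, Ψ x * mu A x) / lam ^ 2) := by ring
  rw [e7]
  linarith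

lemma mr_le_one (n : ℕ) : mr n ≤ 1 := by
  unfold mr; rw [div_le_one (by positivity)]
  have : (0 : ℝ) ≤ n := by positivity
  linarith

lemma mol_int_tendsto {f w : Eu d → ℝ} (hf : Continuous f) (hw : Continuous w) {ρ : ℝ}
    (hs : ∀ x ∉ closedBall (0 : Eu d) ρ, w x = 0) :
    Filter.Tendsto (fun k => ∫ x, mol k f x * w x) Filter.atTop (𝓝 (∫ x, f x * w x)) := by
  have hcs : HasCompactSupport w := HasCompactSupport.intro (isCompact_closedBall 0 ρ) hs
  obtain ⟨K, hK⟩ := (isCompact_closedBall (0 : Eu d) (ρ + 1)).exists_bound_of_continuousOn hf.continuousOn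
  refine tendsto_integral_of_dominated_convergence (fun x => |K| * |w x|) (fun n => ?_) ?_ (fun n => ?_) ?_
  · have := (mol_contDiff n hf).continuous
    exact (by fun_prop : Continuous fun x => mol n f x * w x).aestronglyMeasurable
  · exact (integrable_cs hw hcs).abs.const_mul _
  · refine Filter.Eventually.of_forall fun x => ?_
    rw [norm_mul, Real.norm_eq_abs, Real.norm_eq_abs]
    by_cases hx : x ∈ closedBall (0 : Eu d) ρ
    · refine mul_le_mul_of_nonneg_right ?_ (abs_nonneg _)
      refine mol_abs_le n fun t ht => ?_
      have hx' : ‖x‖ ≤ ρ := by simpa using hx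
      refine (hK (x - t) ?_).trans (le_abs_self K)
      simp only [mem_closedBall, dist_zero_right]
      exact (norm_sub_le _ _).trans (by linarith [mr_le_one n])
    · rw [hs x hx]; simp
  · exact Filter.Eventually.of_forall fun x => (mol_tendsto hf x).mul_const _

lemma Sol.en_nonneg (h : Sol lam M Ω A u) (hl : 0 < lam) (x : Eu d) : 0 ≤ en A u x := by
  have := (h.ell x).nonneg hl (WithLp.toLp 2 fun i => pd i u x)
  simpa [bform, en] using this

lemma Sol.sum_sq_le (h : Sol lam M Ω A u) (hl : 0 < lam) (x : Eu d) : ∑ i, pd i u x ^ 2 ≤ en A u x / lam := by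
  have := (h.ell x).low (WithLp.toLp 2 fun i => pd i u x)
  rw [EuclideanSpace.norm_sq_eq] at this
  rw [le_div_iff₀ hl, mul_comm]
  simpa [bform, en] using this

lemma Sol.dabs_sq_le (h : Sol lam M Ω A u) (hl : 0 < lam) (x : Eu d) : dabs u x ^ 2 ≤ d / lam * en A u x := by
  have h1 : dabs u x ^ 2 ≤ d * ∑ i, pd i u x ^ 2 := by
    have := sq_sum_le_card_mul_sum_sq (s := Finset.univ) (f := fun i : Fin d => |pd i u x|)
    simpa [dabs] using this
  have h2 := h.sum_sq_le hl x
  calc _ ≤ _ := h1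
    _ ≤ d * (en A u x / lam) := by gcongr
    _ = _ := by ring

/-- estimate (iii) -/
lemma freq_iii (d : ℕ) {lam M : ℝ} (hl : 0 < lam) (hl1 : lam ≤ 1) (hM : 0 ≤ M) : ∃ C, 0 ≤ C ∧
    ∀ (Ω : Set (Eu d)) (A : Eu d → Matrix (Fin d) (Fin d) ℝ) (u : Eu d → ℝ), Sol lam M Ω A u → IsOpen Ω →
    ∀ r : ℝ, 0 ≤ r → r ≤ 1 → closedBall 0 r ⊆ Ω →
      (d - 2 - C * r) * (∫ x, en A u x * PP A r x ^ 3) + 12 * (∫ x, fb A u x ^ 2 * PP A r x ^ 2 * (mu A x)⁻¹) ≤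
        6 * ∫ x, en A u x * qq A x * PP A r x ^ 2 := by
  obtain ⟨C, hC, hfield⟩ := exists_field d hl hM (R := 3) (by norm_num)
  set K1 := C * (2 * d * (d / lam) + d) with hK1
  set K2 := M * (d * ((1 + 2 * C) * (d / lam))) with hK2
  have hK10 : 0 ≤ K1 := by positivity
  have hK20 : 0 ≤ K2 := by positivity
  refine ⟨K1 + K2, by positivity, fun Ω A u h hΩ r hr hr1 hs => ?_⟩
  obtain ⟨-, -, hF⟩ := hfield A h.toCoef
  have cP := cont_PP (A := A) r
  have cu := h.c1.continuous
  have cpu := fun i => continuous_pd h.c1 i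
  have cfl := fun i => h.cont_fl i
  have cf := h.cont_fb
  have ce := h.cont_en
  have cq := cont_qq (A := A)
  have cF := fun i => cont_FF h.toCoef hl hM i
  have cb := fun i => cont_bb (A := A) i
  have cco : ∀ i, Continuous fun x : Eu d => x i := fun i => (contDiff_coord i (n := 0)).continuous
  set I := ∫ x, en A u x * PP A r x ^ 3 with hI
  have iI : Integrable fun x => en A u x * PP A r x ^ 3 :=
    integrable_PP h.toCoef hl hr (by fun_prop) fun x hx => by simp [hx]
  set w : Fin d → Eu d → ℝ := fun k x => -(12 * (PP A r x ^ 2 * fb A u x * pd k u x)) + 6 * (PP A r x ^ 2 * bb A x k * en A u x)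
    with hw
  have cw : ∀ k, Continuous (w k) := fun k => by
    have := cpu k; have := cb k
    simp only [hw]; fun_prop
  have sw : ∀ k, ∀ x ∉ closedBall (0 : Eu d) r, w k x = 0 := fun k x hx => by simp [hw, PP_zero h.toCoef hl hr hx]
  have iw : ∀ (k : Fin d) (f : Eu d → ℝ), Continuous f → Integrable fun x => f x * w k x := fun k f hf =>
    integrable_PP h.toCoef hl hr (hf.mul (cw k)) fun x hx => by simp [hw, hx]
  -- inequality for each n
  have step : ∀ n : ℕ, -((K1 + K2) * (r + 2 * mr n) * I) ≤ (∑ k, ∫ x, (x k + mol n (FF A k) x) * w k x) + (2 - d) * I := by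
    intro n
    have hm := mr_pos n
    have hm1 := mr_le_one n
    set X : Fin d → Eu d → ℝ := fun k x => x k + mol n (FF A k) x with hX
    have cX : ∀ k, ContDiff ℝ 1 (X k) := fun k => (contDiff_coord k).add ((mol_contDiff n (cF k)).of_le one_le_inf)
    have cXc := fun k => (cX k).continuous
    have dX : ∀ k i x, pd i (X k) x = (if k = i then 1 else 0) + pd i (mol n (FF A k)) x := fun k i x => by
      rw [hX]; simp only
      rw [pd_add i ((contDiff_coord k (n := 1)).differentiable one_ne_zero x)
        (((mol_contDiff n (cF k)).of_le one_le_inf).differentiable one_ne_zero x), pd_coord]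
    set ζ : Fin d → Eu d → ℝ := fun k x => PP A r x ^ 3 * X k x with hζ
    have cζ : ∀ k, ContDiff ℝ 1 (ζ k) := fun k => (contDiff_PP3 r).mul (cX k)
    have sζ : ∀ k, tsupport (ζ k) ⊆ closedBall 0 r := fun k => ts_PP h.toCoef hl hr three_ne_zero (X k)
    have csζ : ∀ k, HasCompactSupport (ζ k) := fun k => (isCompact_closedBall 0 r).of_isClosed_subset (isClosed_tsupport _) (sζ k)
    have cpζ := fun k i => continuous_pd (cζ k) i
    have dζ : ∀ k i x, pd i (ζ k) x = -(6 * PP A r x ^ 2 * bb A x i) * X k x + PP A r x ^ 3 * pd i (X k) x := fun k i x => by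
      rw [hζ]; simp only
      rw [pd_mul i ((contDiff_PP3 r).differentiable one_ne_zero x) ((cX k).differentiable one_ne_zero x), pd_PP3 h.toCoef]
    have hz : ∀ k i x, x ∉ tsupport (ζ k) → pd i (ζ k) x = 0 := fun k i x hx =>
      image_eq_zero_of_notMem_tsupport fun hh => hx (tsupport_pd _ i hh)
    have ia : ∀ k, Integrable fun x => (∑ i, fl A u i x * pd i (ζ k) x) * pd k u x := fun k =>
      integrable_cs ((continuous_finsetSum _ fun i _ => (cfl i).mul (cpζ k i)).mul (cpu k))
        (HasCompactSupport.intro (csζ k) fun x hx => by simp [hz k _ x hx])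
    have ic : ∀ k, Integrable fun x => pd k (ζ k) x * en A u x := fun k =>
      integrable_cs ((cpζ k k).mul ce) (HasCompactSupport.intro (csζ k) fun x hx => by simp [hz k _ x hx])
    have iz : ∀ k, Integrable fun x => |ζ k x| * dabs u x ^ 2 := fun k =>
      integrable_cs ((cζ k).continuous.abs.mul (h.cont_dabs.pow 2)) (HasCompactSupport.intro (csζ k) fun x hx => by
        simp [image_eq_zero_of_notMem_tsupport hx])
    have R := fun k => (neg_le_abs _).trans (rellich h hl hΩ (cζ k) (csζ k) ((sζ k).trans hs) k)
    have R2 := Finset.sum_le_sum fun k (_ : k ∈ (Finset.univ : Finset (Fin d))) => R k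
    have eL : ∑ k, (2 * (∫ x, (∑ i, fl A u i x * pd i (ζ k) x) * pd k u x) - ∫ x, pd k (ζ k) x * en A u x) =
        ∫ x, ∑ k, (2 * ((∑ i, fl A u i x * pd i (ζ k) x) * pd k u x) - pd k (ζ k) x * en A u x) := by
      have i5 : ∀ k ∈ Finset.univ, Integrable fun x => 2 * ((∑ i, fl A u i x * pd i (ζ k) x) * pd k u x) - pd k (ζ k) x * en A u x :=
        fun k _ => ((ia k).const_mul 2).sub (ic k)
      rw [integral_finsetSum _ i5]
      refine Finset.sum_congr rfl fun k _ => ?_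
      have i6 : Integrable fun x => 2 * ((∑ i, fl A u i x * pd i (ζ k) x) * pd k u x) := (ia k).const_mul 2
      rw [integral_sub i6 (ic k), integral_const_mul]
    rw [Finset.sum_neg_distrib, eL] at R2
    -- pointwise bounds on the ball
    have hbd : ∀ k, ∀ x ∈ closedBall (0 : Eu d) r, |X k x| ≤ (1 + 2 * C) * (r + 2 * mr n) := by
      intro k x hx
      have hx' : ‖x‖ ≤ r := by simpa using hx
      have e1 : |mol n (FF A k) x| ≤ C * (r + mr n) ^ 2 := by
        refine mol_abs_le n fun t ht => ?_
        have e2 : ‖x - t‖ ≤ r + mr n := (norm_sub_le _ _).trans (by linarith)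
        refine ((hF k).bd (by linarith)).trans ?_
        gcongr
      have e3 : |X k x| ≤ |x k| + |mol n (FF A k) x| := abs_add_le _ _
      have e4 := (abs_coord_le x k).trans hx'
      have e5 : C * (r + mr n) ^ 2 ≤ C * (2 * (r + mr n)) := by
        gcongr; nlinarith
      nlinarith
    have hdF : ∀ k i, ∀ x ∈ closedBall (0 : Eu d) r, |pd i (mol n (FF A k)) x| ≤ C * (r + 2 * mr n) := by
      intro k i x hx
      have hx' : ‖x‖ ≤ r := by simpa using hx
      refine ((hF k).mol_pd_le hC.le (cF k) n (hx'.trans hr1) i).trans ?_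
      gcongr
    have low : ∀ x, ∑ k, (2 * ((∑ i, fl A u i x * pd i (ζ k) x) * pd k u x) - pd k (ζ k) x * en A u x) ≤
        (∑ k, X k x * w k x) + (2 - d) * (en A u x * PP A r x ^ 3) + K1 * (r + 2 * mr n) * (en A u x * PP A r x ^ 3) := by
      intro x
      set E : Fin d → ℝ := fun k => 2 * ((∑ i, fl A u i x * pd i (mol n (FF A k)) x) * pd k u x)
        - pd k (mol n (FF A k)) x * en A u x with hE
      have e1 : ∀ k, 2 * ((∑ i, fl A u i x * pd i (ζ k) x) * pd k u x) - pd k (ζ k) x * en A u x =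
          X k x * w k x + PP A r x ^ 3 * (2 * (fl A u k x * pd k u x) - en A u x) + PP A r x ^ 3 * E k := by
        intro k
        have e2 : ∑ i, fl A u i x * pd i (ζ k) x = -(6 * PP A r x ^ 2 * fb A u x * X k x) + PP A r x ^ 3 * fl A u k x
            + PP A r x ^ 3 * ∑ i, fl A u i x * pd i (mol n (FF A k)) x := by
          have e3 : fl A u k x = ∑ i, fl A u i x * (if k = i then 1 else 0) := by simp
          rw [e3, fb, Finset.mul_sum, Finset.mul_sum, Finset.mul_sum, Finset.sum_mul, ← Finset.sum_neg_distrib,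
            ← Finset.sum_add_distrib, ← Finset.sum_add_distrib]
          refine Finset.sum_congr rfl fun i _ => ?_
          rw [dζ, dX]; ring
        rw [e2, dζ, dX, if_pos rfl, hE, hw]; ring
      rw [Finset.sum_congr rfl fun k _ => e1 k, Finset.sum_add_distrib, Finset.sum_add_distrib, ← Finset.mul_sum,
        ← Finset.mul_sum, Finset.sum_sub_distrib, ← Finset.mul_sum, ← en_eq]
      simp only [Finset.sum_const, Finset.card_univ, Fintype.card_fin, nsmul_eq_mul]
      suffices hh : PP A r x ^ 3 * ∑ k, E k ≤ K1 * (r + 2 * mr n) * (en A u x * PP A r x ^ 3) by linarith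
      by_cases hx : x ∈ closedBall (0 : Eu d) r
      · have e5 : ∀ k, E k ≤ 2 * (d * (dabs u x * (C * (r + 2 * mr n))) * |pd k u x|) + C * (r + 2 * mr n) * en A u x := by
          intro k
          have f1 : |∑ i, fl A u i x * pd i (mol n (FF A k)) x| ≤ d * (dabs u x * (C * (r + 2 * mr n))) := by
            refine (Finset.abs_sum_le_sum_abs _ _).trans ?_
            refine (Finset.sum_le_sum (g := fun _ => dabs u x * (C * (r + 2 * mr n))) fun i _ => ?_).trans (by simp)
            rw [abs_mul]
            exact mul_le_mul (h.fl_le hl i x) (hdF k i x hx) (abs_nonneg _) (dabs_nonneg u x)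
          have f2 : |(∑ i, fl A u i x * pd i (mol n (FF A k)) x) * pd k u x| ≤ d * (dabs u x * (C * (r + 2 * mr n))) * |pd k u x| := by
            rw [abs_mul]; gcongr
          have f3 : -pd k (mol n (FF A k)) x * en A u x ≤ C * (r + 2 * mr n) * en A u x :=
            mul_le_mul_of_nonneg_right ((neg_le_abs _).trans (hdF k k x hx)) (h.en_nonneg hl x)
          have f4 := le_abs_self ((∑ i, fl A u i x * pd i (mol n (FF A k)) x) * pd k u x)
          simp only [hE]; linarith
        have e6 : ∑ k, E k ≤ K1 * (r + 2 * mr n) * en A u x := by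
          refine (Finset.sum_le_sum fun k _ => e5 k).trans ?_
          rw [Finset.sum_add_distrib, ← Finset.mul_sum, ← Finset.mul_sum]
          simp only [Finset.sum_const, Finset.card_univ, Fintype.card_fin, nsmul_eq_mul]
          rw [show ∑ k, |pd k u x| = dabs u x from rfl]
          have g1 := h.dabs_sq_le hl x
          calc _ = C * (r + 2 * mr n) * (2 * d * dabs u x ^ 2 + d * en A u x) := by ring
            _ ≤ C * (r + 2 * mr n) * (2 * d * (d / lam * en A u x) + d * en A u x) := by gcongr
            _ = _ := by rw [hK1]; ring
        have := mul_le_mul_of_nonneg_left e6 (pow_nonneg (PP_nonneg (A := A) r x) 3)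
        linarith
      · rw [PP_zero h.toCoef hl hr hx]; simp
    have up : ∀ x, ∑ k, M * (|ζ k x| * dabs u x ^ 2) ≤ K2 * (r + 2 * mr n) * (en A u x * PP A r x ^ 3) := by
      intro x
      by_cases hx : x ∈ closedBall (0 : Eu d) r
      · have hP := PP_nonneg (A := A) r x
        have he := h.en_nonneg hl x
        have f : ∀ k ∈ (Finset.univ : Finset (Fin d)), M * (|ζ k x| * dabs u x ^ 2) ≤
            M * ((PP A r x ^ 3 * ((1 + 2 * C) * (r + 2 * mr n))) * (d / lam * en A u x)) := fun k _ => by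
          have : |ζ k x| = PP A r x ^ 3 * |X k x| := by
            simp only [hζ]; rw [abs_mul, abs_of_nonneg (by positivity)]
          rw [this]
          have := hbd k x hx
          have := h.dabs_sq_le hl x
          gcongr
        refine (Finset.sum_le_sum f).trans ?_
        simp only [Finset.sum_const, Finset.card_univ, Fintype.card_fin, nsmul_eq_mul]
        rw [hK2]; apply le_of_eq; ring
      · simp [hζ, PP_zero h.toCoef hl hr hx]
    have iX : ∀ k ∈ Finset.univ, Integrable fun x => X k x * w k x := fun k _ => iw k (X k) (cXc k)
    have iS : Integrable fun x => ∑ k, X k x * w k x := integrable_finsetSum _ iX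
    have iI2 : Integrable fun x => (2 - (d : ℝ)) * (en A u x * PP A r x ^ 3) := iI.const_mul _
    have iI3 : Integrable fun x => K1 * (r + 2 * mr n) * (en A u x * PP A r x ^ 3) := iI.const_mul _
    have iA : Integrable fun x => (∑ k, X k x * w k x) + (2 - (d : ℝ)) * (en A u x * PP A r x ^ 3) := iS.add iI2
    have L := integral_mono (integrable_finsetSum Finset.univ fun k _ => ((ia k).const_mul 2).sub (ic k)) (iA.add iI3) low
    have e9 : ∫ x, ((∑ k, X k x * w k x) + (2 - d) * (en A u x * PP A r x ^ 3) + K1 * (r + 2 * mr n) * (en A u x * PP A r x ^ 3))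
        = (∑ k, ∫ x, X k x * w k x) + (2 - d) * I + K1 * (r + 2 * mr n) * I := by
      rw [integral_add iA iI3, integral_add iS iI2, integral_const_mul, integral_const_mul, integral_finsetSum _ iX]
    have U : ∑ k, M * ∫ x, |ζ k x| * dabs u x ^ 2 ≤ K2 * (r + 2 * mr n) * I := by
      have i7 : ∀ k ∈ Finset.univ, Integrable fun x => M * (|ζ k x| * dabs u x ^ 2) := fun k _ => (iz k).const_mul M
      have e10 : ∑ k, M * ∫ x, |ζ k x| * dabs u x ^ 2 = ∫ x, ∑ k, M * (|ζ k x| * dabs u x ^ 2) := by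
        rw [integral_finsetSum _ i7]; simp only [integral_const_mul]
      rw [e10, hI, ← integral_const_mul]
      exact integral_mono (integrable_finsetSum _ i7) (iI.const_mul _) up
    have L1 : ∫ x, ∑ k, (2 * ((∑ i, fl A u i x * pd i (ζ k) x) * pd k u x) - pd k (ζ k) x * en A u x) ≤ 
        (∑ k, ∫ x, X k x * w k x) + (2 - d) * I + K1 * (r + 2 * mr n) * I := L.trans e9.le
    have L2 := R2.trans U
    have L3 : (∑ k, ∫ x, (x k + mol n (FF A k) x) * w k x) = ∑ k, ∫ x, X k x * w k x := rfl
    rw [L3]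
    linarith
  have lim : Filter.Tendsto (fun n => (∑ k, ∫ x, (x k + mol n (FF A k) x) * w k x) + (2 - d) * I) Filter.atTop
      (𝓝 ((∑ k, ∫ x, (x k + FF A k x) * w k x) + (2 - d) * I)) := by
    refine Filter.Tendsto.add_const _ (tendsto_finsetSum _ fun k _ => ?_)
    have i1 := iw k (fun x => x k) (cco k)
    have e1 : ∀ n, ∫ x, (x k + mol n (FF A k) x) * w k x = (∫ x, x k * w k x) + ∫ x, mol n (FF A k) x * w k x := fun n => by
      have i2 := iw k (mol n (FF A k)) (mol_contDiff n (cF k)).continuous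
      rw [← integral_add i1 i2]; congr 1; ext x; ring
    have e2 : ∫ x, (x k + FF A k x) * w k x = (∫ x, x k * w k x) + ∫ x, FF A k x * w k x := by
      have i2 := iw k (FF A k) (cF k)
      rw [← integral_add i1 i2]; congr 1; ext x; ring
    simp only [e1, e2]
    exact (mol_int_tendsto (cF k) (cw k) (sw k)).const_add _
  have lim2 : Filter.Tendsto (fun n => (K1 + K2) * (r + 2 * mr n) * I) Filter.atTop (𝓝 ((K1 + K2) * (r + 2 * 0) * I)) :=
    (((mr_tendsto.const_mul 2).const_add r).const_mul _).mul_const _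
  have fin := le_of_tendsto_of_tendsto' lim2.neg lim step
  have i3 : ∀ k ∈ Finset.univ, Integrable fun x : Eu d => (x k + FF A k x) * w k x := fun k _ =>
    iw k (fun x => x k + FF A k x) ((cco k).add (cF k))
  have iJ : Integrable fun x => fb A u x ^ 2 * PP A r x ^ 2 * (mu A x)⁻¹ :=
    h.int_mu_inv hl hl1 (integrable_PP h.toCoef hl hr (by fun_prop) fun x hx => by simp [hx])
  have iT : Integrable fun x => en A u x * qq A x * PP A r x ^ 2 :=
    integrable_PP h.toCoef hl hr (by fun_prop) fun x hx => by simp [hx]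
  have e11 : ∑ k, ∫ x, (x k + FF A k x) * w k x = 6 * (∫ x, en A u x * qq A x * PP A r x ^ 2)
      - 12 * ∫ x, fb A u x ^ 2 * PP A r x ^ 2 * (mu A x)⁻¹ := by
    rw [← integral_finsetSum _ i3, ← integral_const_mul, ← integral_const_mul, ← integral_sub (iT.const_mul 6) (iJ.const_mul 12)]
    congr 1; ext x
    have hmu := mu_pos h.toCoef hl hl1 x
    have g1 : ∑ k, (x k + FF A k x) * w k x = (mu A x)⁻¹ * (-(12 * (PP A r x ^ 2 * fb A u x * ∑ k, VV A k x * pd k u x))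
        + 6 * (PP A r x ^ 2 * en A u x * ∑ k, VV A k x * bb A x k)) := by
      simp only [field_eq h.toCoef hl hl1, hw, Finset.mul_sum, ← Finset.sum_neg_distrib, ← Finset.sum_add_distrib]
      exact Finset.sum_congr rfl fun k _ => by ring
    rw [g1, ← fb_eq h.toCoef hl, show ∑ k, VV A k x * bb A x k = pp A x from rfl, ← mu_mul_qq h.toCoef hl]
    field_simp
    ring
  rw [e11] at fin
  linarith

end

section
variable {lam M : ℝ} {Ω : Set (Eu d)} {A : Eu d → Matrix (Fin d) (Fin d) ℝ} {u : Eu d → ℝ}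

def HH (A : Eu d → Matrix (Fin d) (Fin d) ℝ) (u : Eu d → ℝ) (r : ℝ) : ℝ := ∫ x, u x ^ 2 * mu A x * PP A r x ^ 2
def II (A : Eu d → Matrix (Fin d) (Fin d) ℝ) (u : Eu d → ℝ) (r : ℝ) : ℝ := ∫ x, en A u x * PP A r x ^ 3

lemma Sol.int_w (h : Sol lam M Ω A u) (hl : 0 < lam) (hl1 : lam ≤ 1) : Integrable fun x => u x ^ 2 * mu A x := by
  have cu := h.c1.continuous
  exact h.int_mu hl hl1 (integrable_cs (f := fun x => u x ^ 2) (by fun_prop) (HasCompactSupport.intro h.cs fun x hx => by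
    simp [image_eq_zero_of_notMem_tsupport hx]))

lemma freq_cs (h : Sol lam M Ω A u) (hl : 0 < lam) (hl1 : lam ≤ 1) (hΩ : IsOpen Ω) {r : ℝ} (hr : 0 ≤ r) (hs : closedBall 0 r ⊆ Ω) :
    II A u r ^ 2 ≤ 36 * (HH A u r * ∫ x, fb A u x ^ 2 * PP A r x ^ 2 * (mu A x)⁻¹) := by
  have cP := cont_PP (A := A) r
  have cu := h.c1.continuous
  have cf := h.cont_fb
  have iH : Integrable fun x => u x ^ 2 * PP A r x ^ 2 * mu A x :=
    h.int_mu hl hl1 (integrable_PP h.toCoef hl hr (by fun_prop) fun x hx => by simp [hx])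
  have iJ : Integrable fun x => fb A u x ^ 2 * PP A r x ^ 2 * (mu A x)⁻¹ :=
    h.int_mu_inv hl hl1 (integrable_PP h.toCoef hl hr (by fun_prop) fun x hx => by simp [hx])
  have iK : Integrable fun x => u x * fb A u x * PP A r x ^ 2 :=
    integrable_PP h.toCoef hl hr (by fun_prop) fun x hx => by simp [hx]
  have eH : HH A u r = ∫ x, u x ^ 2 * PP A r x ^ 2 * mu A x := by
    unfold HH; congr 1; ext x; ring
  rw [show II A u r = _ from freq_i h hl hΩ hr hs, eH]
  set K := ∫ x, u x * fb A u x * PP A r x ^ 2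
  have pos : ∀ t : ℝ, 0 ≤ (∫ x, u x ^ 2 * PP A r x ^ 2 * mu A x) * (t * t) + (2 * K) * t +
      ∫ x, fb A u x ^ 2 * PP A r x ^ 2 * (mu A x)⁻¹ := by
    intro t
    have e : (∫ x, u x ^ 2 * PP A r x ^ 2 * mu A x) * (t * t) + (2 * K) * t + (∫ x, fb A u x ^ 2 * PP A r x ^ 2 * (mu A x)⁻¹) =
        ∫ x, ((u x ^ 2 * PP A r x ^ 2 * mu A x) * (t * t) + (u x * fb A u x * PP A r x ^ 2) * (2 * t)
          + fb A u x ^ 2 * PP A r x ^ 2 * (mu A x)⁻¹) := by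
      have i1 : Integrable fun x => (u x ^ 2 * PP A r x ^ 2 * mu A x) * (t * t) := iH.mul_const _
      have i2 : Integrable fun x => (u x * fb A u x * PP A r x ^ 2) * (2 * t) := iK.mul_const _
      have i3 : Integrable fun x => (u x ^ 2 * PP A r x ^ 2 * mu A x) * (t * t) + (u x * fb A u x * PP A r x ^ 2) * (2 * t) := i1.add i2
      rw [integral_add i3 iJ, integral_add i1 i2, integral_mul_const, integral_mul_const]
      ring
    rw [e]
    refine integral_nonneg fun x => ?_
    have hm := mu_pos h.toCoef hl hl1 x
    have : (u x ^ 2 * PP A r x ^ 2 * mu A x) * (t * t) + (u x * fb A u x * PP A r x ^ 2) * (2 * t)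
          + fb A u x ^ 2 * PP A r x ^ 2 * (mu A x)⁻¹ = (mu A x)⁻¹ * (PP A r x * (u x * mu A x * t + fb A u x)) ^ 2 := by
      field_simp; ring
    simp only [Pi.zero_apply]
    rw [this]; positivity
  have := discrim_le_zero pos
  unfold discrim at this
  nlinarith

theorem freq (d : ℕ) {lam M : ℝ} (hl : 0 < lam) (hl1 : lam ≤ 1) (hM : 0 ≤ M) : ∃ C, 0 ≤ C ∧
    ∀ (Ω : Set (Eu d)) (A : Eu d → Matrix (Fin d) (Fin d) ℝ) (u : Eu d → ℝ), Sol lam M Ω A u → IsOpen Ω →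
    ∀ R : ℝ, 0 < R → R ≤ 1 → closedBall 0 R ⊆ Ω → ∀ Λ : ℝ, II A u R ≤ Λ * HH A u R → 0 < HH A u R →
    ∀ r t : ℝ, 0 < r → r ≤ t → t ≤ R → HH A u t ≤ (t / r) ^ (d + 4 + C + Real.exp (2 * C) * Λ / 3) * HH A u r := by
  obtain ⟨C1, hC1, H1⟩ := freq_ii d hl hl1 hM
  obtain ⟨C2, hC2, H2⟩ := freq_iii d hl hl1 hM
  refine ⟨C1 + C2, by positivity, fun Ω A u h hΩ R hR0 hR1 hs Λ hΛ hpos r t hr hrt htR => ?_⟩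
  have hPn := fun s => PP_nonneg (A := A) s
  have hmp := mu_pos h.toCoef hl hl1
  have nH : ∀ s, 0 ≤ HH A u s := fun s => integral_nonneg fun x => by have := hmp x; have := hPn s x; simp only [Pi.zero_apply]; positivity
  have nI : ∀ s, 0 ≤ II A u s := fun s => integral_nonneg fun x => by
    have := h.en_nonneg hl x; have := hPn s x; simp only [Pi.zero_apply]; positivity
  have cP := fun s => cont_PP (A := A) s
  have cu := h.c1.continuous
  have ce := h.cont_en
  have cq := cont_qq (A := A)
  have cp := cont_pp h.toCoef
  refine freq_ode (H := HH A u) (I := II A u) (H' := fun r => ∫ x, u x ^ 2 * mu A x * (((0 + 2 : ℕ) : ℝ) * PP A r x ^ (0 + 1) * (2 * r)))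
    (I' := fun r => ∫ x, en A u x * (((1 + 2 : ℕ) : ℝ) * PP A r x ^ (1 + 1) * (2 * r)))
    (J := fun r => ∫ x, fb A u x ^ 2 * PP A r x ^ 2 * (mu A x)⁻¹) hR0 hR1 (by positivity) (by positivity) nH nI
    ?_ ?_ ?_ ?_ ?_ ?_ hΛ hpos hr hrt htR
  · intro s
    refine integral_nonneg fun x => ?_
    have := hmp x
    simp only [Pi.zero_apply]; positivity
  · intro s _ _
    exact deriv_PP h.toCoef hl (h.int_w hl hl1) 0 s
  · intro s _ _
    exact deriv_PP h.toCoef hl (integrable_cs ce h.cs_en) 1 s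
  · intro s hs0 hsR
    have k := H1 Ω A u h hΩ s hs0.le (hsR.trans hR1) ((closedBall_subset_closedBall hsR).trans hs)
    have i1 : Integrable fun x => 4 * (u x ^ 2 * mu A x * PP A s x ^ 2) := by
      have := (h.int_mu hl hl1 (integrable_PP h.toCoef hl hs0.le (f := fun x => u x ^ 2 * PP A s x ^ 2) (by
        have := cP s; fun_prop) fun x hx => by simp [hx])).const_mul 4
      refine this.congr (Filter.Eventually.of_forall fun x => ?_)
      simp only; ring
    have i2 : Integrable fun x => 4 * (u x ^ 2 * pp A x * PP A s x) :=
      integrable_PP h.toCoef hl hs0.le (by have := cP s; fun_prop) fun x hx => by simp [hx]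
    have e : s * (∫ x, u x ^ 2 * mu A x * (((0 + 2 : ℕ) : ℝ) * PP A s x ^ (0 + 1) * (2 * s))) =
        4 * HH A u s + 4 * ∫ x, u x ^ 2 * pp A x * PP A s x := by
      unfold HH
      rw [← integral_const_mul, ← integral_const_mul, ← integral_const_mul, ← integral_add i1 i2]
      congr 1; ext x
      have hP : s ^ 2 * PP A s x = (PP A s x + qq A x) * PP A s x := by
        unfold PP
        rcases max_cases (s ^ 2 - qq A x) 0 with h | h <;> rw [h.1] <;> ring
      rw [← mu_mul_qq h.toCoef hl]
      push_cast
      linear_combination (4 * u x ^ 2 * mu A x) * hP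
    rw [e]
    have := nH s
    have : 0 ≤ C2 * s * HH A u s := by positivity
    have k' : 4 * (∫ x, u x ^ 2 * pp A x * PP A s x) ≤ (d + C1 * s) * HH A u s + II A u s / 3 := k
    linarith
  · intro s hs0 hsR
    have k := H2 Ω A u h hΩ s hs0.le (hsR.trans hR1) ((closedBall_subset_closedBall hsR).trans hs)
    have i1 : Integrable fun x => 6 * (en A u x * PP A s x ^ 3) :=
      integrable_PP h.toCoef hl hs0.le (by have := cP s; fun_prop) fun x hx => by simp [hx]
    have i2 : Integrable fun x => 6 * (en A u x * qq A x * PP A s x ^ 2) :=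
      integrable_PP h.toCoef hl hs0.le (by have := cP s; fun_prop) fun x hx => by simp [hx]
    have e : s * (∫ x, en A u x * (((1 + 2 : ℕ) : ℝ) * PP A s x ^ (1 + 1) * (2 * s))) =
        6 * II A u s + 6 * ∫ x, en A u x * qq A x * PP A s x ^ 2 := by
      unfold II
      rw [← integral_const_mul, ← integral_const_mul, ← integral_const_mul, ← integral_add i1 i2]
      congr 1; ext x
      have hP : s ^ 2 * PP A s x = (PP A s x + qq A x) * PP A s x := by
        unfold PP
        rcases max_cases (s ^ 2 - qq A x) 0 with h | h <;> rw [h.1] <;> ring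
      push_cast
      linear_combination (6 * en A u x * PP A s x) * hP
    rw [e]
    have := nI s
    have : 0 ≤ C1 * s * II A u s := by positivity
    have k' : (d - 2 - C2 * s) * II A u s + 12 * (∫ x, fb A u x ^ 2 * PP A s x ^ 2 * (mu A x)⁻¹) ≤
        6 * ∫ x, en A u x * qq A x * PP A s x ^ 2 := k
    linarith
  · intro s hs0 hsR
    exact freq_cs h hl hl1 hΩ hs0.le ((closedBall_subset_closedBall hsR).trans hs)

end

section
variable {lam M : ℝ} {Ω : Set (Eu d)} {A : Eu d → Matrix (Fin d) (Fin d) ℝ} {u : Eu d → ℝ}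

/-- local `L²` mass -/
def ms (u : Eu d → ℝ) (y : Eu d) (s : ℝ) : ℝ := ∫ x in ball y s, u x ^ 2

lemma ms_nonneg (u : Eu d → ℝ) (y : Eu d) (s : ℝ) : 0 ≤ ms u y s :=
  integral_nonneg fun x => sq_nonneg _

lemma int_ball {f : Eu d → ℝ} (hf : Continuous f) (y : Eu d) (s : ℝ) : IntegrableOn f (ball y s) :=
  (hf.continuousOn.integrableOn_compact (isCompact_closedBall y s)).mono_set ball_subset_closedBall

lemma ms_mono (hu : Continuous u) {y y' : Eu d} {s s' : ℝ} (h : ball y s ⊆ ball y' s') : ms u y s ≤ ms u y' s' := by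
  refine setIntegral_mono_set (int_ball (by fun_prop) _ _) (Filter.Eventually.of_forall fun x => sq_nonneg _) ?_
  exact h.eventuallyLE

lemma ms_zero (hu : Continuous u) {y : Eu d} {s : ℝ} (h : ms u y s = 0) : ∀ x ∈ ball y s, u x = 0 := by
  by_contra hcon
  push Not at hcon
  obtain ⟨x, hx, hne⟩ := hcon
  have h1 : 0 < ∫ x in ball y s, u x ^ 2 := by
    rw [setIntegral_pos_iff_support_of_nonneg_ae (Filter.Eventually.of_forall fun x => sq_nonneg _) (int_ball (by fun_prop) _ _)]
    refine IsOpen.measure_pos _ (IsOpen.inter ?_ isOpen_ball) ⟨x, by simpa using hne, hx⟩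
    exact isOpen_ne_fun (by fun_prop) continuous_const
  exact h1.ne' h

lemma ms_pos (hu : Continuous u) {y x : Eu d} {s : ℝ} (hx : x ∈ ball y s) (h : u x ≠ 0) : 0 < ms u y s :=
  lt_of_le_of_ne (ms_nonneg _ _ _) fun e => h (ms_zero hu e.symm x hx)

/-- change of variables for masses -/
lemma ms_affine (u : Eu d → ℝ) (y z : Eu d) {r : ℝ} (hr : 0 < r) (c s : ℝ) :
    ms (fun x => c * u (y + r • x)) z s = c ^ 2 * ((r ^ d)⁻¹ * ms u (y + r • z) (r * s)) := by
  unfold ms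
  rw [← integral_indicator measurableSet_ball, ← integral_indicator measurableSet_ball, ← integral_affine _ y hr,
    ← integral_const_mul]
  refine integral_congr_ae (Filter.Eventually.of_forall fun x => ?_)
  have : x ∈ ball z s ↔ y + r • x ∈ ball (y + r • z) (r * s) := by
    rw [mem_ball, mem_ball, dist_eq_norm, dist_eq_norm, add_sub_add_left_eq_sub, ← smul_sub, norm_smul,
      Real.norm_eq_abs, abs_of_pos hr]
    constructor
    · intro h; gcongr
    · intro h; exact lt_of_mul_lt_mul_left h hr.le
  by_cases hx : x ∈ ball z s
  · simp only [indicator_of_mem hx, indicator_of_mem (this.1 hx)]; ring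
  · simp only [indicator_of_notMem hx, indicator_of_notMem (fun h => hx (this.2 h))]; ring

lemma HH_le (h : Sol lam M Ω A u) (hl : 0 < lam) (hl1 : lam ≤ 1) {r : ℝ} (hr : 0 < r) :
    HH A u r ≤ r ^ 4 / lam ^ 2 * ms u 0 r := by
  have cu := h.c1.continuous
  unfold HH ms
  rw [← integral_indicator measurableSet_ball, ← integral_const_mul]
  refine integral_mono_of_nonneg (Filter.Eventually.of_forall fun x => ?_) ?_ (Filter.Eventually.of_forall fun x => ?_)
  · have := mu_pos h.toCoef hl hl1 x
    simp only [Pi.zero_apply]; positivity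
  · exact ((int_ball (by fun_prop) _ _).integrable_indicator measurableSet_ball).const_mul _
  · have h1 := mu_pos h.toCoef hl hl1 x
    have h2 := mu_high h.toCoef hl hl1 x
    have h3 := PP_nonneg (A := A) r x
    have h5 := (h.ell 0).q_ge hl x
    have h6 := (h.ell 0).q_le hl x
    dsimp only
    by_cases hx : x ∈ ball 0 r
    · rw [indicator_of_mem hx]
      have h4 : PP A r x ≤ r ^ 2 := by
        unfold PP qq
        refine max_le ?_ (by positivity)
        nlinarith [sq_nonneg ‖x‖]
      calc u x ^ 2 * mu A x * PP A r x ^ 2 ≤ u x ^ 2 * (1 / lam ^ 2) * (r ^ 2) ^ 2 := by gcongr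
        _ = _ := by ring
    · rw [indicator_of_notMem hx]
      have : PP A r x = 0 := by
        unfold PP qq
        rw [mem_ball_zero_iff, not_lt] at hx
        refine max_eq_right ?_
        nlinarith
      simp [this]

lemma HH_ge (h : Sol lam M Ω A u) (hl : 0 < lam) (hl1 : lam ≤ 1) {r : ℝ} (hr : 0 < r) :
    lam ^ 2 * (9 / 16) * r ^ 4 * ms u 0 (Real.sqrt lam * r / 2) ≤ HH A u r := by
  have cu := h.c1.continuous
  unfold HH ms
  rw [← integral_indicator measurableSet_ball, ← integral_const_mul]
  refine integral_mono_of_nonneg (Filter.Eventually.of_forall fun x => ?_) ?_ (Filter.Eventually.of_forall fun x => ?_)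
  · simp only [Pi.zero_apply]
    refine mul_nonneg (by positivity) (indicator_nonneg (fun x _ => sq_nonneg _) _)
  · have hi := h.int_mu hl hl1 (integrable_PP (f := fun x => u x ^ 2 * PP A r x ^ 2) h.toCoef hl hr.le
      (by have := cont_PP (A := A) r; fun_prop) (fun x hx => by simp [hx]))
    refine hi.congr (Filter.Eventually.of_forall fun x => ?_)
    dsimp only; ring
  · have h1 := mu_pos h.toCoef hl hl1 x
    have h2 := mu_low h.toCoef hl hl1 x
    have h3 := PP_nonneg (A := A) r x
    have h5 := (h.ell 0).q_ge hl x
    have h6 := (h.ell 0).q_le hl x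
    dsimp only
    by_cases hx : x ∈ ball 0 (Real.sqrt lam * r / 2)
    · rw [indicator_of_mem hx]
      rw [mem_ball_zero_iff] at hx
      have h4 : 3 / 4 * r ^ 2 ≤ PP A r x := by
        unfold PP qq
        refine le_max_of_le_left ?_
        have : ‖x‖ ^ 2 ≤ (Real.sqrt lam * r / 2) ^ 2 := by gcongr
        rw [div_pow, mul_pow, Real.sq_sqrt hl.le] at this
        have : ‖x‖ ^ 2 / lam ≤ r ^ 2 / 4 := by
          rw [div_le_iff₀ hl]; linarith
        linarith
      calc lam ^ 2 * (9 / 16) * r ^ 4 * u x ^ 2 = u x ^ 2 * lam ^ 2 * (3 / 4 * r ^ 2) ^ 2 := by ring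
        _ ≤ u x ^ 2 * mu A x * PP A r x ^ 2 := by gcongr
    · rw [indicator_of_notMem hx]; simp only [mul_zero]; positivity

lemma II_le (h : Sol lam M Ω A u) (hl : 0 < lam) {r K : ℝ} (hr : 0 < r) (hr1 : r ≤ 1)
    (hK : ∀ x ∈ closedBall (0 : Eu d) r, ∀ i, |pd i u x| ≤ K) :
    II A u r ≤ d * K ^ 2 * volume.real (ball (0 : Eu d) 1) := by
  unfold II
  have : d * K ^ 2 * volume.real (ball (0 : Eu d) 1) = ∫ x, (ball (0 : Eu d) 1).indicator (fun _ => d * K ^ 2) x := by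
    rw [integral_indicator measurableSet_ball, setIntegral_const, smul_eq_mul, mul_comm]
  rw [this]
  refine integral_mono_of_nonneg (Filter.Eventually.of_forall fun x => ?_) ?_ (Filter.Eventually.of_forall fun x => ?_)
  · have := h.en_nonneg hl x
    have h3 := PP_nonneg (A := A) r x
    simp only [Pi.zero_apply]; positivity
  · exact (integrableOn_const (by finiteness)).integrable_indicator measurableSet_ball
  · have h5 := (h.ell 0).q_ge hl x
    have h3 := PP_nonneg (A := A) r x
    have h0 := h.en_nonneg hl x
    dsimp only
    by_cases hx : x ∈ ball 0 r
    · rw [indicator_of_mem (ball_subset_ball hr1 hx)]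
      have h4 : PP A r x ≤ 1 := by
        unfold PP qq
        refine max_le ?_ (by positivity)
        nlinarith [sq_nonneg ‖x‖]
      have h7 : en A u x ≤ d * K ^ 2 := by
        have h8 : en A u x ≤ ∑ i, pd i u x ^ 2 := by
          have := (h.ell x).high (WithLp.toLp 2 fun i => pd i u x)
          rw [EuclideanSpace.norm_sq_eq] at this
          simpa [bform, en] using this
        refine h8.trans ?_
        calc ∑ i, pd i u x ^ 2 ≤ ∑ i : Fin d, K ^ 2 := by
              refine Finset.sum_le_sum fun i _ => ?_
              rw [← sq_abs]
              have := hK x (ball_subset_closedBall hx) i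
              gcongr
          _ = _ := by simp
      calc en A u x * PP A r x ^ 3 ≤ en A u x * 1 := by gcongr; exact pow_le_one₀ h3 h4
        _ ≤ _ := by linarith
    · have : PP A r x = 0 := by
        unfold PP qq
        rw [mem_ball_zero_iff, not_lt] at hx
        refine max_eq_right ?_
        nlinarith
      rw [this]
      refine le_trans (by simp) (indicator_nonneg (fun _ _ => by positivity) _)
end

theorem pt_doubling (d : ℕ) (hd : 0 < d) {lam M : ℝ} (hl : 0 < lam) (hl1 : lam ≤ 1) (hM : 0 ≤ M) (N : ℝ) :
    ∃ N1 : ℝ, 1 ≤ N1 ∧ ∀ (A : Eu d → Matrix (Fin d) (Fin d) ℝ) (u : Eu d → ℝ) (Ω : Set (Eu d)),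
      Sol lam M Ω A u → IsOpen Ω → ball (0 : Eu d) 2 ⊆ Ω → 0 < ms u 0 2 →
      ∀ y, ‖y‖ ≤ 5 / 4 → ms u 0 2 ≤ N * ms u y (Real.sqrt lam / 8) →
      ms u 0 2 ≤ N1 * ms u y (Real.sqrt lam / 16) ∧
      ∀ s, 0 < s → s ≤ Real.sqrt lam / 16 → ms u y (2 * s) ≤ N1 * ms u y s := by
  obtain ⟨C, hC, hfr⟩ := freq d hl hl1 hM
  obtain ⟨Cg, hCg, hgr⟩ := grad_bound d hd hl hM
  have hsq : 0 < Real.sqrt lam := Real.sqrt_pos.2 hl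
  have hsq1 : Real.sqrt lam ≤ 1 := Real.sqrt_le_one.2 hl1
  set V := volume.real (ball (0 : Eu d) 1) with hV
  have hV0 : 0 ≤ V := measureReal_nonneg
  set c0 : ℝ := lam ^ 2 * (9 / 16) * (1 / 4) ^ 4 with hc0
  have hc0p : 0 < c0 := by positivity
  set Λ : ℝ := d * Cg ^ 2 * V * N / c0 with hΛ
  set E : ℝ := d + 4 + C + Real.exp (2 * C) * Λ / 3 with hE
  set K : ℝ := 16 / 9 / lam ^ 4 * (4 / Real.sqrt lam) ^ E with hK
  have hK0 : 0 < K := by positivity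
  refine ⟨1 + K + |N| * K, by have := abs_nonneg N; nlinarith [mul_nonneg this hK0.le], fun A u Ω h hΩ hsub hpos y hy hN => ?_⟩
  have cu := h.c1.continuous
  have hNp : 0 < N := by
    by_contra hh
    push Not at hh
    have := mul_nonneg (neg_nonneg.2 hh) (ms_nonneg u y (Real.sqrt lam / 8))
    linarith
  have hv := h.affine y one_pos 1
  rw [mul_one] at hv
  set v : Eu d → ℝ := fun x => 1 * u (y + (1:ℝ) • x) with hvd
  have hmv : ∀ s, ms v 0 s = ms u y s := fun s => by
    rw [hvd, ms_affine u y 0 one_pos 1 s]; simp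
  have hΩ' : IsOpen {x : Eu d | y + (1:ℝ) • x ∈ Ω} := hΩ.preimage (by fun_prop)
  have hgu := (hgr Ω A u h hsub).2
  set m := ms u 0 2 with hm
  have hpd : ∀ x ∈ closedBall (0 : Eu d) (1/4), ∀ i, |pd i v x| ≤ Cg * Real.sqrt m := by
    intro x hx i
    have e : pd i v x = pd i u (y + x) := by
      rw [show v = fun x => u (y + (1:ℝ) • x) from by funext x; simp [hvd]]
      rw [pd_affine i 1 ((h.c1.differentiable one_ne_zero) _)]; simp
    rw [e]
    refine hgu _ ?_ i
    rw [mem_closedBall_zero_iff] at hx ⊢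
    linarith [norm_add_le y x]
  have hHpos : c0 / N * m ≤ HH (fun x => A (y + (1:ℝ) • x)) v (1 / 4) := by
    refine le_trans ?_ (HH_ge hv hl hl1 (by norm_num))
    rw [show Real.sqrt lam * (1/4) / 2 = Real.sqrt lam / 8 by ring, hmv, div_mul_eq_mul_div, div_le_iff₀ hNp]
    have : m ≤ ms u y (Real.sqrt lam / 8) * N := by linarith
    calc c0 * m ≤ c0 * (ms u y (Real.sqrt lam / 8) * N) := by gcongr
      _ = _ := by rw [hc0]; ring
  have hII : II (fun x => A (y + (1:ℝ) • x)) v (1 / 4) ≤ Λ * HH (fun x => A (y + (1:ℝ) • x)) v (1 / 4) := by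
    refine (II_le hv hl (by norm_num) (by norm_num) hpd).trans ?_
    rw [mul_pow, Real.sq_sqrt hpos.le]
    calc d * (Cg ^ 2 * m) * V = Λ * (c0 / N * m) := by rw [hΛ]; field_simp
      _ ≤ _ := by gcongr
  have hdb : ∀ s, 0 < s → s ≤ Real.sqrt lam / 16 → ms u y (2 * s) ≤ K * ms u y s := by
    intro s hs hs1
    set t := 4 * s / Real.sqrt lam with ht
    have hts : s ≤ t := by
      rw [ht, le_div_iff₀ hsq]; nlinarith
    have htR : t ≤ 1 / 4 := by
      rw [ht, div_le_iff₀ hsq]; linarith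
    have ht0 : 0 < t := by positivity
    have h1 := hfr _ _ _ hv hΩ' (1/4) (by norm_num) (by norm_num) (fun x hx => hsub (by
      rw [mem_closedBall_zero_iff] at hx
      rw [mem_ball_zero_iff, one_smul]
      linarith [norm_add_le y x])) Λ hII (lt_of_lt_of_le (by positivity) hHpos) s t hs hts htR
    have h2 := HH_ge hv hl hl1 ht0
    have h3 := HH_le hv hl hl1 hs
    rw [hmv] at h2 h3
    have e1 : Real.sqrt lam * t / 2 = 2 * s := by rw [ht]; field_simp; norm_num
    have e2 : t / s = 4 / Real.sqrt lam := by rw [ht]; field_simp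
    rw [e1] at h2
    rw [e2] at h1
    have hp : 0 < (4 / Real.sqrt lam) ^ E := by positivity
    have h4 : lam ^ 2 * (9 / 16) * t ^ 4 * ms u y (2 * s) ≤ (4 / Real.sqrt lam) ^ E * (t ^ 4 / lam ^ 2 * ms u y s) := by
      refine h2.trans (h1.trans ?_)
      have := ms_nonneg u y s
      refine mul_le_mul_of_nonneg_left (h3.trans ?_) hp.le
      gcongr
    have h5 : 0 < lam ^ 2 * (9 / 16) * t ^ 4 := by positivity
    refine le_of_mul_le_mul_left (h4.trans_eq ?_) h5
    rw [hK]; field_simp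
  constructor
  · have h1 := hdb (Real.sqrt lam / 16) (by positivity) le_rfl
    rw [show 2 * (Real.sqrt lam / 16) = Real.sqrt lam / 8 by ring] at h1
    have h2 := ms_nonneg u y (Real.sqrt lam / 16)
    calc m ≤ N * (K * ms u y (Real.sqrt lam / 16)) := hN.trans (by gcongr)
      _ ≤ _ := by rw [abs_of_pos hNp]; nlinarith [mul_nonneg hK0.le h2]
  · intro s hs hs1
    refine (hdb s hs hs1).trans ?_
    have := ms_nonneg u y s
    gcongr
    nlinarith [mul_nonneg (abs_nonneg N) hK0.le]

theorem doubling (d : ℕ) (hd : 0 < d) {lam M : ℝ} (hl : 0 < lam) (hl1 : lam ≤ 1) (hM : 0 ≤ M) (N : ℝ) :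
    ∃ N1 : ℝ, 1 ≤ N1 ∧ ∀ (A : Eu d → Matrix (Fin d) (Fin d) ℝ) (u : Eu d → ℝ) (Ω : Set (Eu d)),
      Sol lam M Ω A u → IsOpen Ω → ball (0 : Eu d) 2 ⊆ Ω → 0 < ms u 0 2 →
      ms u 0 2 ≤ N * ms u 0 (Real.sqrt lam / 8) →
      ∀ y, ‖y‖ ≤ 5 / 4 → ms u 0 2 ≤ N1 * ms u y (Real.sqrt lam / 8) ∧
      ∀ s, 0 < s → s ≤ Real.sqrt lam / 16 → ms u y (2 * s) ≤ N1 * ms u y s := by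
  have hsq : 0 < Real.sqrt lam := Real.sqrt_pos.2 hl
  have key : ∀ n : ℕ, ∃ N1 : ℝ, ∀ (A : Eu d → Matrix (Fin d) (Fin d) ℝ) (u : Eu d → ℝ) (Ω : Set (Eu d)),
      Sol lam M Ω A u → IsOpen Ω → ball (0 : Eu d) 2 ⊆ Ω → 0 < ms u 0 2 →
      ms u 0 2 ≤ N * ms u 0 (Real.sqrt lam / 8) →
      ∀ y, ‖y‖ ≤ 5 / 4 → ‖y‖ ≤ n * (Real.sqrt lam / 16) → ms u 0 2 ≤ N1 * ms u y (Real.sqrt lam / 8) := by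
    intro n
    induction n with
    | zero =>
      refine ⟨N, fun A u Ω h _ _ _ hN y _ hy => ?_⟩
      have : y = 0 := by simpa using hy
      rw [this]; exact hN
    | succ n ih =>
      obtain ⟨N1, ih⟩ := ih
      obtain ⟨N2, hN2, hp⟩ := pt_doubling d hd hl hl1 hM N1
      refine ⟨N2, fun A u Ω h hΩ hsub hpos hN y hy hyn => ?_⟩
      have hn : (0:ℝ) < n + 1 := by positivity
      set y' : Eu d := ((n : ℝ) / (n + 1)) • y with hy'
      have e1 : ‖y'‖ = (n : ℝ) / (n + 1) * ‖y‖ := by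
        rw [hy', norm_smul, Real.norm_eq_abs, abs_of_nonneg (by positivity)]
      push_cast at hyn
      have e2 : ‖y'‖ ≤ n * (Real.sqrt lam / 16) := by
        rw [e1, div_mul_eq_mul_div, div_le_iff₀ hn]
        nlinarith [mul_le_mul_of_nonneg_left hyn (Nat.cast_nonneg (α := ℝ) n)]
      have e3 : ‖y'‖ ≤ 5 / 4 := by
        rw [e1, div_mul_eq_mul_div, div_le_iff₀ hn]
        nlinarith [mul_le_mul_of_nonneg_left hy (Nat.cast_nonneg (α := ℝ) n), norm_nonneg y]
      have e4 : ‖y - y'‖ ≤ Real.sqrt lam / 16 := by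
        have : y - y' = (1 / ((n:ℝ) + 1)) • y := by
          rw [hy']; nth_rewrite 1 [← one_smul ℝ y]; rw [← sub_smul]; congr 1; field_simp; ring
        rw [this, norm_smul, Real.norm_eq_abs, abs_of_nonneg (by positivity), div_mul_eq_mul_div, div_le_iff₀ hn]
        linarith
      refine ((hp A u Ω h hΩ hsub hpos y' e3 (ih A u Ω h hΩ hsub hpos hN y' e3 e2)).1).trans ?_
      refine mul_le_mul_of_nonneg_left (ms_mono h.c1.continuous (ball_subset_ball' ?_)) (by linarith)
      rw [dist_comm, dist_eq_norm]; linarith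
  obtain ⟨n, hn⟩ := exists_nat_ge (5 / 4 / (Real.sqrt lam / 16))
  rw [div_le_iff₀ (by positivity)] at hn
  obtain ⟨N1, h1⟩ := key n
  obtain ⟨N2, hN2, hp⟩ := pt_doubling d hd hl hl1 hM N1
  refine ⟨max N1 N2, hN2.trans (le_max_right _ _), fun A u Ω h hΩ hsub hpos hN y hy => ?_⟩
  have h2 := h1 A u Ω h hΩ hsub hpos hN y hy (hy.trans hn)
  constructor
  · refine h2.trans ?_
    have := ms_nonneg u y (Real.sqrt lam / 8)
    gcongr
    exact le_max_left _ _
  · intro s hs hs1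
    refine ((hp A u Ω h hΩ hsub hpos y hy h2).2 s hs hs1).trans ?_
    have := ms_nonneg u y s
    gcongr
    exact le_max_right _ _

/-- unique continuation -/
theorem ucp (d : ℕ) (hd : 0 < d) {lam M : ℝ} (hl : 0 < lam) (hl1 : lam ≤ 1) (hM : 0 ≤ M)
    {A : Eu d → Matrix (Fin d) (Fin d) ℝ} {u : Eu d → ℝ} {Ω : Set (Eu d)}
    (h : Sol lam M Ω A u) (hΩ : IsOpen Ω) (hc : IsPreconnected Ω) (hne : ∃ x ∈ Ω, u x ≠ 0) {y : Eu d} (hy : y ∈ Ω)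
    {s : ℝ} (hs : 0 < s) : 0 < ms u y s := by
  have cu := h.c1.continuous
  have hsq : 0 < Real.sqrt lam := Real.sqrt_pos.2 hl
  have hsq1 : Real.sqrt lam ≤ 1 := Real.sqrt_le_one.2 hl1
  refine lt_of_le_of_ne (ms_nonneg _ _ _) fun e => ?_
  have hz := ms_zero cu e.symm
  set S : Set (Eu d) := {z | ∀ᶠ x in 𝓝 z, u x = 0} with hS
  have hSo : IsOpen S := isOpen_setOfPred_eventually_nhds
  obtain ⟨x0, hx0, hx0'⟩ := hne
  refine hx0' ((hc.subset_of_closure_inter_subset hSo ⟨y, hy, ?_⟩ ?_ hx0 : x0 ∈ S).self_of_nhds)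
  · exact Filter.mem_of_superset (ball_mem_nhds y hs) hz
  · rintro z ⟨hzc, hzΩ⟩
    obtain ⟨ρ, hρ, hρs⟩ := Metric.isOpen_iff.1 hΩ z hzΩ
    obtain ⟨ρ', hρ', hρ1, hρ2⟩ : ∃ ρ' : ℝ, 0 < ρ' ∧ ρ' ≤ 1 ∧ 3 * ρ' ≤ ρ :=
      ⟨min 1 (ρ / 3), by positivity, min_le_left _ _, by linarith [min_le_right 1 (ρ / 3)]⟩
    obtain ⟨w, hwS, hw⟩ := Metric.mem_closure_iff.1 hzc (ρ' * (Real.sqrt lam / 8)) (by positivity)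
    have hv0 := h.affine w hρ' 1
    have hv : Sol lam M {x : Eu d | w + ρ' • x ∈ Ω} (fun x => A (w + ρ' • x)) (fun x => 1 * u (w + ρ' • x)) :=
      { hv0 with lip := fun x y i j => (hv0.lip x y i j).trans (by gcongr; nlinarith) }
    set v : Eu d → ℝ := fun x => 1 * u (w + ρ' • x) with hvd
    have cv := hv.c1.continuous
    have hsub : ball (0 : Eu d) 2 ⊆ {x : Eu d | w + ρ' • x ∈ Ω} := by
      intro x hx
      apply hρs
      rw [mem_ball_zero_iff] at hx
      rw [mem_ball, dist_eq_norm, show w + ρ' • x - z = ρ' • x - (z - w) by abel]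
      rw [dist_eq_norm] at hw
      calc _ ≤ ‖ρ' • x‖ + ‖z - w‖ := norm_sub_le _ _
        _ < ρ' * 2 + ρ' * (Real.sqrt lam / 8) := by
          rw [norm_smul, Real.norm_eq_abs, abs_of_pos hρ']; gcongr
        _ ≤ ρ := by nlinarith
    have hm0 : ms v 0 (Real.sqrt lam / 8) = 0 := by
      by_contra hm
      have hmp : 0 < ms v 0 (Real.sqrt lam / 8) := lt_of_le_of_ne (ms_nonneg _ _ _) (Ne.symm hm)
      obtain ⟨N1, hN1, hp⟩ := pt_doubling d hd hl hl1 hM (ms v 0 2 / ms v 0 (Real.sqrt lam / 8))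
      have h2 := (hp _ v _ hv (hΩ.preimage (by fun_prop)) hsub (lt_of_lt_of_le hmp (ms_mono cv (ball_subset_ball (by linarith))))
        0 (by simp; norm_num) (by rw [div_mul_cancel₀ _ hmp.ne'])).2
      have h3 : ∀ n : ℕ, 0 < ms v 0 (Real.sqrt lam / 8 / 2 ^ n) := by
        intro n
        induction n with
        | zero => simpa using hmp
        | succ n ih =>
          have h4 := h2 (Real.sqrt lam / 8 / 2 ^ (n + 1)) (by positivity) (by
            rw [pow_succ]
            have : (1:ℝ) ≤ 2 ^ n := one_le_pow₀ (by norm_num)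
            rw [div_le_iff₀ (by positivity)]; nlinarith)
          rw [show 2 * (Real.sqrt lam / 8 / 2 ^ (n + 1)) = Real.sqrt lam / 8 / 2 ^ n by rw [pow_succ]; field_simp] at h4
          by_contra hh
          push Not at hh
          nlinarith
      obtain ⟨δ, hδ, hδs⟩ := Metric.eventually_nhds_iff_ball.1 hwS
      obtain ⟨n, hn⟩ := exists_pow_lt_of_lt_one hδ (by norm_num : (1/2 : ℝ) < 1)
      refine (h3 n).ne' ?_
      unfold ms
      rw [setIntegral_congr_fun (g := fun _ => 0) measurableSet_ball]; · simp
      intro x hx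
      rw [mem_ball_zero_iff] at hx
      have : u (w + ρ' • x) = 0 := by
        refine hδs _ ?_
        rw [mem_ball, dist_eq_norm, add_sub_cancel_left, norm_smul, Real.norm_eq_abs, abs_of_pos hρ']
        have h5 : Real.sqrt lam / 8 / 2 ^ n ≤ (1/2) ^ n := by
          rw [one_div, inv_pow, div_eq_mul_inv]
          have : (0:ℝ) < (2 ^ n)⁻¹ := by positivity
          nlinarith
        nlinarith [norm_nonneg x]
      simp [hvd, this]
    have hz2 := ms_zero cv hm0
    have hmem : z ∈ ball w (ρ' * (Real.sqrt lam / 8)) := hw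
    refine Filter.mem_of_superset (isOpen_ball.mem_nhds hmem) fun x hx => ?_
    have h6 := hz2 (ρ'⁻¹ • (x - w)) (by
      rw [mem_ball, dist_eq_norm] at hx
      rw [mem_ball_zero_iff, norm_smul, norm_inv, Real.norm_eq_abs, abs_of_pos hρ', inv_mul_lt_iff₀ hρ']
      exact hx)
    simpa [hvd, smul_smul, mul_inv_cancel₀ hρ'.ne'] using h6

/-- iterated partial derivatives -/
def pdl (l : List (Fin d)) (f : Eu d → ℝ) : Eu d → ℝ := l.foldr pd f

lemma contDiff_pdl {f : Eu d → ℝ} (hf : ContDiff ℝ ∞ f) (l : List (Fin d)) : ContDiff ℝ ∞ (pdl l f) := by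
  induction l with
  | nil => exact hf
  | cons i l ih => exact contDiff_pd_top ih i

lemma pdl_append (l : List (Fin d)) (i : Fin d) (f : Eu d → ℝ) : pdl (l ++ [i]) f = pdl l (pd i f) := by
  simp [pdl, List.foldr_append]

lemma flat_bound (k : ℕ) : ∀ {f : Eu d → ℝ}, ContDiff ℝ ∞ f → ∀ y : Eu d, (∀ l, pdl l f y = 0) →
    ∃ C : ℝ, 0 ≤ C ∧ ∀ x ∈ closedBall y 1, |f x| ≤ C * ‖x - y‖ ^ k := by
  induction k with
  | zero =>
    intro f hf y _
    obtain ⟨C, hC⟩ := (isCompact_closedBall y 1).exists_bound_of_continuousOn hf.continuous.continuousOn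
    refine ⟨max C 0, le_max_right _ _, fun x hx => ?_⟩
    have := hC x hx
    rw [Real.norm_eq_abs] at this
    simpa using Or.inl this
  | succ k ih =>
    intro f hf y hy
    have h1 : ∀ i, ∃ C : ℝ, 0 ≤ C ∧ ∀ x ∈ closedBall y 1, |pd i f x| ≤ C * ‖x - y‖ ^ k := fun i =>
      ih (contDiff_pd_top hf i) y fun l => by rw [← pdl_append]; exact hy _
    choose C hC0 hC using h1
    refine ⟨d * ∑ i, C i, by have := Finset.sum_nonneg fun i (_ : i ∈ Finset.univ) => hC0 i; positivity, fun x hx => ?_⟩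
    have h0 : f y = 0 := hy []
    rw [mem_closedBall, dist_eq_norm] at hx
    have h2 := abs_sub_le_of_pd (hf.of_le one_le_inf) (convex_closedBall y ‖x - y‖) (G := (∑ i, C i) * ‖x - y‖ ^ k)
      (fun z hz i => ?_) (mem_closedBall_self (norm_nonneg _)) (by rw [mem_closedBall, dist_eq_norm] : x ∈ closedBall y ‖x - y‖)
    · rw [h0, zero_sub, abs_neg, norm_sub_rev y x] at h2
      refine h2.trans (le_of_eq ?_)
      ring
    · have hz' : ‖z - y‖ ≤ ‖x - y‖ := by rwa [mem_closedBall, dist_eq_norm] at hz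
      refine (hC i z (by rw [mem_closedBall, dist_eq_norm]; linarith)).trans ?_
      have : C i ≤ ∑ i, C i := Finset.single_le_sum (fun i _ => hC0 i) (Finset.mem_univ i)
      have := hC0 i
      exact mul_le_mul (by assumption) (by gcongr) (by positivity) (by linarith)

lemma muH_le_of_antilip {X Y : Type*} [MetricSpace X] [MeasurableSpace X] [BorelSpace X] [MetricSpace Y] [MeasurableSpace Y]
    [BorelSpace Y] (s : Set X) (p : X → Y) (K : ℝ≥0) (h : ∀ x ∈ s, ∀ y ∈ s, dist x y ≤ K * dist (p x) (p y)) {t : ℝ} (ht : 0 ≤ t) :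
    μH[t] s ≤ (K : ℝ≥0∞) ^ t * μH[t] (p '' s) := by
  rcases s.eq_empty_or_nonempty with rfl | ⟨x0, hx0⟩
  · simp
  have : Nonempty X := ⟨x0⟩
  have hinj : InjOn p s := fun x hx y hy e => by
    have := h x hx y hy
    rw [e, dist_self, mul_zero] at this
    exact dist_le_zero.1 this
  have hl := hinj.leftInvOn_invFunOn
  set g := Function.invFunOn p s
  have hg : LipschitzOnWith K g (p '' s) := by
    refine LipschitzOnWith.of_dist_le_mul ?_
    rintro _ ⟨x, hx, rfl⟩ _ ⟨y, hy, rfl⟩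
    rw [hl hx, hl hy]
    exact h x hx y hy
  have := hg.hausdorffMeasure_image_le ht
  rwa [hl.image_image] at this

/-- second order equation is inherited by derivatives -/
lemma eq_pd {a : Matrix (Fin d) (Fin d) ℝ} {f : Eu d → ℝ} (hf : ContDiff ℝ ∞ f) {U : Set (Eu d)} (hU : IsOpen U)
    (h : ∀ x ∈ U, ∑ i, ∑ j, a i j * pd i (pd j f) x = 0) (k : Fin d) :
    ∀ x ∈ U, ∑ i, ∑ j, a i j * pd i (pd j (pd k f)) x = 0 := by
  intro x hx
  have c1 : ∀ i, ContDiff ℝ ∞ (pd i f) := contDiff_pd_top hf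
  have c2 : ∀ i j, ContDiff ℝ ∞ (pd i (pd j f)) := fun i j => contDiff_pd_top (c1 j) i
  have df : ∀ i j, DifferentiableAt ℝ (pd i (pd j f)) x := fun i j => (c2 i j).differentiable (by simp) x
  have h1 : pd k (fun x => ∑ i, ∑ j, a i j * pd i (pd j f) x) x = 0 :=
    pd_eq_zero_of_eventually (c := 0) k (Filter.mem_of_superset (hU.mem_nhds hx) fun z hz => h z hz)
  rw [pd_sum Finset.univ (f := fun i x => ∑ j, a i j * pd i (pd j f) x) k
    fun i _ => DifferentiableAt.fun_sum fun j _ => (df i j).const_mul _] at h1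
  rw [← h1]
  refine Finset.sum_congr rfl fun i _ => ?_
  rw [pd_sum Finset.univ (f := fun j x => a i j * pd i (pd j f) x) k fun j _ => (df i j).const_mul _]
  refine Finset.sum_congr rfl fun j _ => ?_
  rw [pd_const_mul _ _ (df i j), pd_comm ((c1 j).of_le two_le_inf) k i x]
  congr 2
  funext z
  exact pd_comm (hf.of_le two_le_inf) j k z

lemma eq_pdl {a : Matrix (Fin d) (Fin d) ℝ} {f : Eu d → ℝ} (hf : ContDiff ℝ ∞ f) {U : Set (Eu d)} (hU : IsOpen U)
    (h : ∀ x ∈ U, ∑ i, ∑ j, a i j * pd i (pd j f) x = 0) (l : List (Fin d)) :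
    ∀ x ∈ U, ∑ i, ∑ j, a i j * pd i (pd j (pdl l f)) x = 0 := by
  induction l with
  | nil => exact h
  | cons k l ih => exact eq_pd (contDiff_pdl hf l) hU ih k

lemma exists_minor {lam : ℝ} (hl : 0 < lam) {a H : Matrix (Fin d) (Fin d) ℝ} (ha : Ell lam a) (hH : ∀ i j, H i j = H j i)
    (htr : ∑ i, ∑ j, a i j * H i j = 0) {i j : Fin d} (hij : H i j ≠ 0) :
    ∃ p q b c, H b p * H c q - H c p * H b q ≠ 0 := by
  by_contra hcon
  push Not at hcon
  have hii : H i i ≠ 0 := by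
    intro h0
    have := hcon i j i j
    rw [h0, hH j i] at this
    apply hij
    have : H i j * H i j = 0 := by linarith
    simpa using this
  have h1 : bform a (WithLp.toLp 2 fun k => H i k) (WithLp.toLp 2 fun k => H i k) = 0 := by
    have : bform a (WithLp.toLp 2 fun k => H i k) (WithLp.toLp 2 fun k => H i k) = H i i * ∑ p, ∑ q, a p q * H p q := by
      simp only [bform, Finset.mul_sum]
      refine Finset.sum_congr rfl fun p _ => Finset.sum_congr rfl fun q _ => ?_
      have := hcon i q i p
      rw [hH p i] at this
      have e : H i q * H i p = H i i * H p q := by linarith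
      calc a p q * H i q * H i p = a p q * (H i q * H i p) := by ring
        _ = _ := by rw [e]; ring
    rw [this, htr, mul_zero]
  have h2 := ha.low (WithLp.toLp 2 fun k => H i k)
  rw [h1] at h2
  have h3 : (0:ℝ) < ‖(WithLp.toLp 2 fun k => H i k : Eu d)‖ := by
    rw [norm_pos_iff]
    intro h0
    apply hii
    have := congrArg (fun v : Eu d => v i) h0
    simpa using this
  nlinarith [mul_pos hl (pow_pos h3 2)]

lemma null_codim2 {g h : Eu d → ℝ} (hg : ContDiff ℝ ∞ g) (hh : ContDiff ℝ ∞ h) (b c : Fin d) :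
    μH[(d : ℝ) - 1] {x : Eu d | g x = 0 ∧ h x = 0 ∧ pd b g x * pd c h x - pd c g x * pd b h x ≠ 0} = 0 := by
  refine measure_null_of_locally_null _ fun x hx => ?_
  obtain ⟨hgx, hhx, hm⟩ := hx
  have hbc : b ≠ c := by rintro rfl; apply hm; ring
  set ι := {k : Fin d // k ≠ b ∧ k ≠ c}
  set P : Eu d →L[ℝ] (ι → ℝ) := ContinuousLinearMap.pi fun k => EuclideanSpace.proj (k : Fin d) with hP
  set Ψ : Eu d → (ℝ × ℝ) × (ι → ℝ) := fun z => ((g z, h z), P z) with hΨ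
  set T : Eu d →L[ℝ] (ℝ × ℝ) × (ι → ℝ) := ((fderiv ℝ g x).prod (fderiv ℝ h x)).prod P with hT
  have hstrict : HasStrictFDerivAt Ψ T x :=
    (((hg.contDiffAt).hasStrictFDerivAt (by simp)).prodMk ((hh.contDiffAt).hasStrictFDerivAt (by simp))).prodMk
      P.hasStrictFDerivAt
  have hker : LinearMap.ker (T : Eu d →ₗ[ℝ] (ℝ × ℝ) × (ι → ℝ)) = ⊥ := by
    rw [LinearMap.ker_eq_bot']
    intro e he
    have h1 : fderiv ℝ g x e = 0 := congrArg (fun t => t.1.1) he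
    have h2 : fderiv ℝ h x e = 0 := congrArg (fun t => t.1.2) he
    have h3 : ∀ k, k ≠ b → k ≠ c → e k = 0 := fun k hk1 hk2 => congrFun (congrArg (fun t => t.2) he) ⟨k, hk1, hk2⟩
    have hsum : ∀ F : Fin d → ℝ, ∑ i, e i * F i = e b * F b + e c * F c := by
      intro F
      rw [← Finset.sum_subset (Finset.subset_univ {b, c}), Finset.sum_pair hbc]
      intro k _ hk
      simp only [Finset.mem_insert, Finset.mem_singleton, not_or] at hk
      rw [h3 k hk.1 hk.2, zero_mul]
    rw [fderiv_apply_eq, hsum] at h1 h2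
    have eb : e b = 0 := by
      have : e b * (pd b g x * pd c h x - pd c g x * pd b h x) = 0 := by
        linear_combination pd c h x * h1 - pd c g x * h2
      exact (mul_eq_zero.1 this).resolve_right hm
    have ec : e c = 0 := by
      have : e c * (pd b g x * pd c h x - pd c g x * pd b h x) = 0 := by
        linear_combination - pd b h x * h1 + pd b g x * h2
      exact (mul_eq_zero.1 this).resolve_right hm
    ext k
    by_cases k1 : k = b
    · rw [k1, eb]; rfl
    by_cases k2 : k = c
    · rw [k2, ec]; rfl
    exact h3 k k1 k2
  obtain ⟨K, hK, hanti⟩ := LinearMap.exists_antilipschitzWith (T : Eu d →ₗ[ℝ] (ℝ × ℝ) × (ι → ℝ)) hker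
  have hK' : 0 < K⁻¹ / 2 := by positivity
  obtain ⟨s, hs, happ⟩ := hstrict.approximates_deriv_on_nhds (c := K⁻¹ / 2) (Or.inr hK')
  set E := {x : Eu d | g x = 0 ∧ h x = 0 ∧ pd b g x * pd c h x - pd c g x * pd b h x ≠ 0}
  refine ⟨E ∩ s, Filter.inter_mem self_mem_nhdsWithin (mem_nhdsWithin_of_mem_nhds hs), ?_⟩
  have hd : (Fintype.card ι : ℝ) < (d : ℝ) - 1 := by
    have h1 : Fintype.card ι ≤ d - 2 := by
      have h4 : Fintype.card ι = (Finset.univ.filter fun k : Fin d => k ≠ b ∧ k ≠ c).card := Fintype.card_subtype _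
      have h5 : (Finset.univ.filter fun k : Fin d => k ≠ b ∧ k ≠ c) = Finset.univ \ {b, c} := by
        ext k; simp
      rw [h4, h5, Finset.card_sdiff_of_subset (Finset.subset_univ _), Finset.card_pair hbc]; simp
    have h2 : 2 ≤ d := by
      have := Finset.card_le_univ ({b, c} : Finset (Fin d))
      rwa [Finset.card_pair hbc, Fintype.card_fin] at this
    have h3 : (Fintype.card ι : ℝ) ≤ ((d - 2 : ℕ) : ℝ) := by exact_mod_cast h1
    rw [Nat.cast_sub h2] at h3
    push_cast at h3; linarith
  have h0 : μH[(d : ℝ) - 1] (P '' (E ∩ s)) = 0 := by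
    have hd0 : (0:ℝ) ≤ (d : ℝ) - 1 := le_trans (Nat.cast_nonneg _) hd.le
    have h1 : dimH (P '' (E ∩ s)) < (((d : ℝ) - 1).toNNReal : ℝ≥0) := by
      refine lt_of_le_of_lt (dimH_mono (subset_univ _)) ?_
      rw [Real.dimH_univ_pi]
      have : ((Fintype.card ι : ℝ≥0)) < ((d : ℝ) - 1).toNNReal := by
        rw [← NNReal.coe_lt_coe, Real.coe_toNNReal _ hd0]; simpa using hd
      exact_mod_cast this
    have := hausdorffMeasure_of_dimH_lt h1
    rwa [Real.coe_toNNReal _ hd0] at this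
  have hle := muH_le_of_antilip (E ∩ s) P (2 * K) (fun z hz z' hz' => ?_) (le_trans (Nat.cast_nonneg _) hd.le)
  · rw [h0, mul_zero] at hle
    exact le_antisymm hle bot_le
  · have h2 := happ z hz.2 z' hz'.2
    have h3 := hanti.le_mul_dist z z'
    have h4 : ‖Ψ z - Ψ z'‖ = dist (P z) (P z') := by
      rw [← dist_eq_norm, Prod.dist_eq]
      simp only [hΨ]
      rw [hz.1.1, hz.1.2.1, hz'.1.1, hz'.1.2.1]
      simp
    have hKr : (0:ℝ) < K := hK
    push_cast at h2 ⊢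
    rw [dist_eq_norm, dist_eq_norm] at h3
    change ‖z - z'‖ ≤ K * ‖T z - T z'‖ at h3
    rw [← map_sub] at h3
    have h5 : ‖T (z - z')‖ ≤ ‖Ψ z - Ψ z'‖ + (K : ℝ)⁻¹ / 2 * ‖z - z'‖ := by
      calc ‖T (z - z')‖ = ‖(Ψ z - Ψ z') - (Ψ z - Ψ z' - T (z - z'))‖ := by congr 1; abel
        _ ≤ _ := (norm_sub_le _ _).trans (by gcongr)
    rw [dist_eq_norm, ← h4]
    have h6 : K * ((K : ℝ)⁻¹ / 2 * ‖z - z'‖) = ‖z - z'‖ / 2 := by field_simp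
    have h7 := mul_le_mul_of_nonneg_left h5 hKr.le
    rw [mul_add, h6] at h7
    linarith

/-- the critical zero set has measure zero -/
theorem crit_null {lam : ℝ} (hl : 0 < lam) {a : Matrix (Fin d) (Fin d) ℝ} (ha : Ell lam a) {W : Eu d → ℝ}
    (hW : ContDiff ℝ ∞ W) {U : Set (Eu d)} (hU : IsOpen U) (h : ∀ x ∈ U, ∑ i, ∑ j, a i j * pd i (pd j W) x = 0)
    {S : Set (Eu d)} (hSU : S ⊆ U) (hS : ∀ y ∈ S, ∃ l, pdl l W y ≠ 0) :
    μH[(d : ℝ) - 1] {y ∈ S | W y = 0 ∧ ∀ i, pd i W y = 0} = 0 := by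
  have hsub : {y ∈ S | W y = 0 ∧ ∀ i, pd i W y = 0} ⊆ ⋃ t : List (Fin d) × Fin d × Fin d × Fin d × Fin d,
      {x : Eu d | pd t.2.1 (pdl t.1 W) x = 0 ∧ pd t.2.2.1 (pdl t.1 W) x = 0 ∧
        pd t.2.2.2.1 (pd t.2.1 (pdl t.1 W)) x * pd t.2.2.2.2 (pd t.2.2.1 (pdl t.1 W)) x -
        pd t.2.2.2.2 (pd t.2.1 (pdl t.1 W)) x * pd t.2.2.2.1 (pd t.2.2.1 (pdl t.1 W)) x ≠ 0} := by
    rintro y ⟨hy, h0, h1⟩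
    have hex : ∃ n : ℕ, ∃ l : List (Fin d), l.length = n ∧ pdl l W y ≠ 0 := by
      obtain ⟨l, hl⟩ := hS y hy
      exact ⟨_, l, rfl, hl⟩
    classical
    obtain ⟨l, hln, hly⟩ := Nat.find_spec hex
    have hmin : ∀ l' : List (Fin d), l'.length < l.length → pdl l' W y = 0 := by
      intro l' hl'
      by_contra hne
      rw [hln] at hl'
      exact Nat.find_min hex hl' ⟨l', rfl, hne⟩
    match l, hly, hmin with
    | [], hly, _ => exact absurd h0 hly
    | [i], hly, _ => exact absurd (h1 i) hly
    | i :: j :: l', hly, hmin =>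
      have c := contDiff_pdl hW l'
      obtain ⟨p, q, b, c', hm⟩ := exists_minor hl (H := Matrix.of fun i j => pd i (pd j (pdl l' W)) y) ha
        (fun i j => pd_comm (c.of_le two_le_inf) i j y) (eq_pdl hW hU h l' y (hSU hy)) (i := i) (j := j) hly
      refine mem_iUnion.2 ⟨⟨l', p, q, b, c'⟩, hmin (p :: l') (by simp), hmin (q :: l') (by simp), hm⟩
  refine measure_mono_null hsub (measure_iUnion_null fun t => ?_)
  have c := contDiff_pdl hW t.1
  exact null_codim2 (contDiff_pd_top c _) (contDiff_pd_top c _) _ _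

/-- doubling prevents infinite order vanishing -/
lemma not_flat {W : Eu d → ℝ} (hW : ContDiff ℝ ∞ W) {y : Eu d} {s N : ℝ} (hs : 0 < s) (hs1 : s ≤ 1) (h0 : 0 < ms W y s)
    (hN : ∀ t, 0 < t → 2 * t ≤ s → ms W y (2 * t) ≤ N * ms W y t) : ∃ l, pdl l W y ≠ 0 := by
  by_contra hcon
  push Not at hcon
  have hNp : 0 < N := by
    have h1 := hN (s / 2) (by positivity) (by linarith)
    rw [mul_div_cancel₀ _ (two_ne_zero)] at h1
    by_contra hh
    push Not at hh
    nlinarith [ms_nonneg W y (s / 2), mul_nonneg (neg_nonneg.2 hh) (ms_nonneg W y (s / 2))]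
  have h1 : ∀ n : ℕ, ms W y s ≤ N ^ n * ms W y (s / 2 ^ n) := by
    intro n
    induction n with
    | zero => simp
    | succ n ih =>
      have h2 := hN (s / 2 ^ (n + 1)) (by positivity) (by
        rw [pow_succ]
        have : (1:ℝ) ≤ 2 ^ n := one_le_pow₀ (by norm_num)
        rw [show 2 * (s / (2 ^ n * 2)) = s / 2 ^ n by field_simp]
        exact div_le_self hs.le this)
      rw [show 2 * (s / 2 ^ (n + 1)) = s / 2 ^ n by rw [pow_succ]; field_simp] at h2
      calc _ ≤ N ^ n * (N * ms W y (s / 2 ^ (n + 1))) := ih.trans (by gcongr)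
        _ = _ := by ring
  obtain ⟨k, hk⟩ := pow_unbounded_of_one_lt N (by norm_num : (1:ℝ) < 4)
  obtain ⟨C, hC, hfl⟩ := flat_bound k hW y hcon
  set V := volume.real (ball y 1)
  have hV : 0 ≤ V := measureReal_nonneg
  have h3 : ∀ n : ℕ, ms W y (s / 2 ^ n) ≤ C ^ 2 * V * ((1 / 4) ^ k) ^ n := by
    intro n
    have h2n : (1:ℝ) ≤ 2 ^ n := one_le_pow₀ (by norm_num)
    have hle : s / 2 ^ n ≤ 1 := (div_le_self hs.le h2n).trans hs1
    have hle2 : s / 2 ^ n ≤ (1 / 2) ^ n := by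
      rw [one_div, inv_pow, ← one_div]; gcongr
    calc ms W y (s / 2 ^ n) ≤ ∫ x in ball y (s / 2 ^ n), C ^ 2 * ((1 / 4) ^ k) ^ n := by
          refine setIntegral_mono_on (int_ball (by have := hW.continuous; fun_prop) _ _)
            (int_ball continuous_const _ _) measurableSet_ball fun x hx => ?_
          rw [mem_ball, dist_eq_norm] at hx
          have h4 := hfl x (by rw [mem_closedBall, dist_eq_norm]; linarith)
          have h5 : |W x| ≤ C * ((1 / 2) ^ n) ^ k := h4.trans (by gcongr; linarith)
          calc W x ^ 2 = |W x| ^ 2 := (sq_abs _).symm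
            _ ≤ (C * ((1 / 2) ^ n) ^ k) ^ 2 := by gcongr
            _ = _ := by
              rw [mul_pow, show (1 / 4 : ℝ) = (1 / 2) ^ 2 by norm_num, ← pow_mul, ← pow_mul, ← pow_mul, ← pow_mul]
              congr 2; ring
      _ = volume.real (ball y (s / 2 ^ n)) * (C ^ 2 * ((1 / 4) ^ k) ^ n) := by simp
      _ ≤ V * (C ^ 2 * ((1 / 4) ^ k) ^ n) := by
        gcongr
        exact measureReal_mono (ball_subset_ball hle) measure_ball_lt_top.ne
      _ = _ := by ring
  have h4 : ∀ n : ℕ, ms W y s ≤ C ^ 2 * V * (N * (1 / 4) ^ k) ^ n := fun n => by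
    refine (h1 n).trans ?_
    calc _ ≤ N ^ n * (C ^ 2 * V * ((1 / 4) ^ k) ^ n) := by gcongr; exact h3 n
      _ = _ := by rw [mul_pow]; ring
  have h5 : N * (1 / 4) ^ k < 1 := by
    rw [one_div, inv_pow, ← div_eq_mul_inv, div_lt_one (by positivity)]; exact hk
  have h6 := (tendsto_pow_atTop_nhds_zero_of_lt_one (by positivity) h5).const_mul (C ^ 2 * V)
  rw [mul_zero] at h6
  exact absurd (ge_of_tendsto' h6 h4) (not_le.2 h0)

/-- kernel transform -/
def KT (f : Eu d → ℝ) (r : ℝ) (g : Eu d → ℝ) (x : Eu d) : ℝ := ∫ y, f (x + r • y) * g y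

lemma KT_conv (f : Eu d → ℝ) {r : ℝ} (hr : 0 < r) (g : Eu d → ℝ) (x : Eu d) :
    KT f r g x = (r ^ d)⁻¹ * (convolution f (fun w => g (0 + (-r⁻¹) • w)) (ContinuousLinearMap.lsmul ℝ ℝ) volume) x := by
  unfold KT convolution
  rw [← integral_affine _ x hr]
  refine integral_congr_ae (Filter.Eventually.of_forall fun y => ?_)
  simp only [ContinuousLinearMap.lsmul_apply, smul_eq_mul]
  congr 2
  rw [zero_add, sub_add_cancel_left, smul_neg, neg_smul, neg_neg, smul_smul, inv_mul_cancel₀ hr.ne', one_smul]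

lemma KT_contDiff {f : Eu d → ℝ} (hf : Continuous f) {r : ℝ} (hr : 0 < r) {g : Eu d → ℝ} (hg : ContDiff ℝ ∞ g)
    (hc : HasCompactSupport g) :
    ContDiff ℝ ∞ (KT f r g) ∧ ∀ i x, pd i (KT f r g) x = -r⁻¹ * KT f r (pd i g) x := by
  have hr' : (-r⁻¹) ≠ 0 := neg_ne_zero.2 (inv_ne_zero hr.ne')
  have e : KT f r g = fun x => (r ^ d)⁻¹ * (convolution f (fun w => g (0 + (-r⁻¹) • w)) (ContinuousLinearMap.lsmul ℝ ℝ) volume) x :=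
    funext fun x => KT_conv f hr g x
  have hg' : ContDiff ℝ ∞ fun w : Eu d => g (0 + (-r⁻¹) • w) := hg.comp (by fun_prop)
  have hc' : HasCompactSupport fun w : Eu d => g (0 + (-r⁻¹) • w) := hc.comp_homeomorph (affHomeo 0 hr')
  have hconv := hc'.contDiff_convolution_right (ContinuousLinearMap.lsmul ℝ ℝ) (hf.locallyIntegrable (μ := volume)) hg'
  constructor
  · rw [e]; exact contDiff_const.mul hconv
  · intro i x
    have h1 := hc'.hasFDerivAt_convolution_right (ContinuousLinearMap.lsmul ℝ ℝ) (hf.locallyIntegrable (μ := volume))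
      (hg'.of_le one_le_inf) x
    have h2 := (h1.const_mul ((r ^ d)⁻¹))
    rw [e, HasFDerivAt.pd_eq h2, KT_conv f hr]
    rw [ContinuousLinearMap.smul_apply, smul_eq_mul]
    rw [convolution_precompR_apply _ (hf.locallyIntegrable (μ := volume)) (hc'.fderiv ℝ) (hg'.continuous_fderiv (by simp))]
    rw [mul_left_comm]
    congr 1
    unfold convolution
    rw [← integral_const_mul]
    refine integral_congr_ae (Filter.Eventually.of_forall fun y => ?_)
    simp only [ContinuousLinearMap.lsmul_apply, smul_eq_mul]
    have h3 := pd_affine (f := g) (x := x - y) (y := 0) i (-r⁻¹) (hg.differentiable (by simp) _)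
    rw [pd] at h3
    rw [h3]; ring

section conv
variable {lam : ℝ} {B : ℕ → Matrix (Fin d) (Fin d) ℝ} {a : Matrix (Fin d) (Fin d) ℝ}

lemma ell_limit (hB : ∀ n, Ell lam (B n)) (h : ∀ i j, Filter.Tendsto (fun n => B n i j) Filter.atTop (𝓝 (a i j))) : Ell lam a := by
  have hb : ∀ ξ : Eu d, Filter.Tendsto (fun n => bform (B n) ξ ξ) Filter.atTop (𝓝 (bform a ξ ξ)) := fun ξ =>
    tendsto_finsetSum _ fun i _ => tendsto_finsetSum _ fun j _ => ((h i j).mul_const _).mul_const _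
  refine ⟨fun i j => ?_, fun ξ => ?_, fun ξ => ?_⟩
  · refine tendsto_nhds_unique (h i j) ((h j i).congr fun n => (hB n).symm j i)
  · exact ge_of_tendsto' (hb ξ) fun n => (hB n).low ξ
  · exact le_of_tendsto' (hb ξ) fun n => (hB n).high ξ

lemma inv_limit (hl : 0 < lam) (hB : ∀ n, Ell lam (B n))
    (h : ∀ i j, Filter.Tendsto (fun n => B n i j) Filter.atTop (𝓝 (a i j))) (i j : Fin d) :
    Filter.Tendsto (fun n => (B n)⁻¹ i j) Filter.atTop (𝓝 (a⁻¹ i j)) := by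
  have ha := ell_limit hB h
  have ht : Filter.Tendsto B Filter.atTop (𝓝 a) := tendsto_pi_nhds.2 fun i => tendsto_pi_nhds.2 fun j => h i j
  have h1 : Filter.Tendsto (fun n => (B n).det) Filter.atTop (𝓝 a.det) :=
    ((continuous_id.matrix_det).tendsto a).comp ht
  have h2 : Filter.Tendsto (fun n => (B n).adjugate) Filter.atTop (𝓝 a.adjugate) :=
    ((continuous_id.matrix_adjugate).tendsto a).comp ht
  have h3 : Filter.Tendsto (fun n => (B n)⁻¹) Filter.atTop (𝓝 a⁻¹) := by
    simp only [Matrix.inv_def, Ring.inverse_eq_inv']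
    exact (h1.inv₀ (ha.isUnit_det hl).ne_zero).smul h2
  exact tendsto_pi_nhds.1 (tendsto_pi_nhds.1 h3 i) j

lemma eta_limit (hl : 0 < lam) (hB : ∀ n, Ell lam (B n))
    (h : ∀ i j, Filter.Tendsto (fun n => B n i j) Filter.atTop (𝓝 (a i j))) (y : Eu d) :
    Filter.Tendsto (fun n => eta (B n)⁻¹ y) Filter.atTop (𝓝 (eta a⁻¹ y)) ∧
    ∀ i, Filter.Tendsto (fun n => pd i (eta (B n)⁻¹) y) Filter.atTop (𝓝 (pd i (eta a⁻¹) y)) := by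
  have ha := ell_limit hB h
  have hi := inv_limit hl hB h
  have hb : Filter.Tendsto (fun n => bform (B n)⁻¹ y y) Filter.atTop (𝓝 (bform a⁻¹ y y)) :=
    tendsto_finsetSum _ fun i _ => tendsto_finsetSum _ fun j _ => ((hi i j).mul_const _).mul_const _
  refine ⟨(contDiff_th.continuous.tendsto _).comp hb, fun i => ?_⟩
  rw [pd_eta ha.inv_symm i y]
  refine Filter.Tendsto.congr (fun n => (pd_eta ((hB n).inv_symm) i y).symm) ?_
  refine (((contDiff_th.continuous_deriv (by simp)).tendsto _).comp hb).mul (Filter.Tendsto.const_mul _ ?_)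
  simp only [mv_apply]
  exact tendsto_finsetSum _ fun j _ => (hi i j).mul_const _

lemma int_limit {f g : ℕ → Eu d → ℝ} {f0 g0 : Eu d → ℝ} {C K : ℝ} (hC : 0 ≤ C)
    (cf : ∀ n, Continuous (f n)) (cg : ∀ n, Continuous (g n)) (hf : ∀ n, ∀ y ∈ closedBall (0 : Eu d) 1, |f n y| ≤ C)
    (hg : ∀ n y, |g n y| ≤ K) (hg0 : ∀ n, ∀ y ∉ closedBall (0 : Eu d) 1, g n y = 0)
    (tf : ∀ y ∈ closedBall (0 : Eu d) 1, Filter.Tendsto (fun n => f n y) Filter.atTop (𝓝 (f0 y)))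
    (tg : ∀ y, Filter.Tendsto (fun n => g n y) Filter.atTop (𝓝 (g0 y))) :
    Filter.Tendsto (fun n => ∫ y, f n y * g n y) Filter.atTop (𝓝 (∫ y, f0 y * g0 y)) := by
  refine tendsto_integral_of_dominated_convergence ((closedBall (0 : Eu d) 1).indicator fun _ => C * K)
    (fun n => ((cf n).mul (cg n)).aestronglyMeasurable)
    ((integrableOn_const (isCompact_closedBall _ _).measure_lt_top.ne).integrable_indicator measurableSet_closedBall)
    (fun n => Filter.Eventually.of_forall fun y => ?_) (Filter.Eventually.of_forall fun y => ?_)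
  · by_cases hy : y ∈ closedBall (0 : Eu d) 1
    · rw [indicator_of_mem hy, norm_mul]
      exact mul_le_mul (hf n y hy) (hg n y) (norm_nonneg _) hC
    · rw [indicator_of_notMem hy, hg0 n y hy]; simp
  · by_cases hy : y ∈ closedBall (0 : Eu d) 1
    · exact (tf y hy).mul (tg y)
    · have : g0 y = 0 := tendsto_nhds_unique (tg y) ((tendsto_const_nhds (x := (0:ℝ))).congr fun n => (hg0 n y hy).symm)
      rw [this]
      simp only [fun n => hg0 n y hy, mul_zero]
      exact tendsto_const_nhds
end conv

lemma extract_seq {f : ℕ → Eu d → ℝ} {a : ℕ → Matrix (Fin d) (Fin d) ℝ} {C L : ℝ} (hL : 0 ≤ L)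
    (hf : ∀ n x, |f n x| ≤ C) (hlip : ∀ n x y, |f n x - f n y| ≤ L * ‖x - y‖) (ha : ∀ n i j, |a n i j| ≤ C) :
    ∃ φ : ℕ → ℕ, StrictMono φ ∧ ∃ (f0 : Eu d → ℝ) (a0 : Matrix (Fin d) (Fin d) ℝ),
      (∀ x, Filter.Tendsto (fun n => f (φ n) x) Filter.atTop (𝓝 (f0 x))) ∧
      ∀ i j, Filter.Tendsto (fun n => a (φ n) i j) Filter.atTop (𝓝 (a0 i j)) := by
  set q := TopologicalSpace.denseSeq (Eu d)
  have hq : DenseRange q := TopologicalSpace.denseRange_denseSeq _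
  set F : ℕ → (ℕ → ℝ) × (Fin d × Fin d → ℝ) := fun n => (fun k => f n (q k), fun p => a n p.1 p.2) with hF
  have hK : IsCompact ((Set.pi univ fun _ : ℕ => Icc (-C) C) ×ˢ (Set.pi univ fun _ : Fin d × Fin d => Icc (-C) C)) :=
    (isCompact_univ_pi fun _ => isCompact_Icc).prod (isCompact_univ_pi fun _ => isCompact_Icc)
  obtain ⟨p, -, φ, hφ, hp⟩ := hK.tendsto_subseq (x := F) fun n =>
    ⟨fun k _ => abs_le.1 (hf n _), fun k _ => abs_le.1 (ha n _ _)⟩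
  have h1 : ∀ k, Filter.Tendsto (fun n => f (φ n) (q k)) Filter.atTop (𝓝 (p.1 k)) := fun k =>
    tendsto_pi_nhds.1 ((continuous_fst.tendsto _).comp hp) k
  have h2 : ∀ k, Filter.Tendsto (fun n => a (φ n) k.1 k.2) Filter.atTop (𝓝 (p.2 k)) := fun k =>
    tendsto_pi_nhds.1 ((continuous_snd.tendsto _).comp hp) k
  have h3 : ∀ x, CauchySeq fun n => f (φ n) x := by
    intro x
    rw [Metric.cauchySeq_iff']
    intro ε hε
    obtain ⟨k, hk⟩ := hq.exists_dist_lt x (ε := ε / (4 * (L + 1))) (by positivity)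
    obtain ⟨N, hN⟩ := Metric.cauchySeq_iff'.1 (h1 k).cauchySeq (ε / 4) (by positivity)
    refine ⟨N, fun n hn => ?_⟩
    have h4 := hN n hn
    have h5 := hlip (φ n) x (q k)
    have h6 := hlip (φ N) x (q k)
    rw [dist_eq_norm, lt_div_iff₀ (by positivity)] at hk
    rw [Real.dist_eq] at h4 ⊢
    have h7 : L * ‖x - q k‖ ≤ ε / 4 := by nlinarith [norm_nonneg (x - q k)]
    rw [abs_le] at h5 h6
    rw [abs_lt] at h4 ⊢
    constructor <;> linarith [h5.1, h5.2, h6.1, h6.2, h4.1, h4.2]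
  choose f0 hf0 using fun x => cauchySeq_tendsto_of_complete (h3 x)
  exact ⟨φ, hφ, f0, Matrix.of fun i j => p.2 (i, j), hf0, fun i j => h2 (i, j)⟩

lemma unif_of_seq {K : Set (Eu d)} (hK : IsCompact K) {f : ℕ → Eu d → ℝ} {g : Eu d → ℝ} (hg : Continuous g)
    (h : ∀ φ : ℕ → ℕ, StrictMono φ → ∀ x : ℕ → Eu d, ∀ x0, (∀ n, x n ∈ K) → Filter.Tendsto x Filter.atTop (𝓝 x0) →
      Filter.Tendsto (fun n => f (φ n) (x n)) Filter.atTop (𝓝 (g x0))) {ε : ℝ} (hε : 0 < ε) :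
    ∀ᶠ n in Filter.atTop, ∀ x ∈ K, |f n x - g x| < ε := by
  by_contra hcon
  rw [Filter.not_eventually] at hcon
  obtain ⟨φ, hφ, hbad⟩ := Filter.extraction_of_frequently_atTop hcon
  push Not at hbad
  choose x hxK hx using hbad
  obtain ⟨x0, _, ψ, hψ, hlim⟩ := hK.tendsto_subseq hxK
  have h1 := h (φ ∘ ψ) (hφ.comp hψ) (x ∘ ψ) x0 (fun n => hxK _) hlim
  have h2 : Filter.Tendsto (fun n => |f ((φ ∘ ψ) n) ((x ∘ ψ) n) - g ((x ∘ ψ) n)|) Filter.atTop (𝓝 0) := by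
    have := (h1.sub ((hg.tendsto x0).comp hlim)).abs
    simpa using this
  have h3 := ge_of_tendsto' h2 (b := ε) fun n => hx (ψ n)
  linarith

lemma Sol.mono {lam M M' : ℝ} {Ω : Set (Eu d)} {A : Eu d → Matrix (Fin d) (Fin d) ℝ} {u : Eu d → ℝ}
    (h : Sol lam M Ω A u) (hM : M ≤ M') : Sol lam M' Ω A u :=
  { ell := h.ell
    lip := fun x y i j => (h.lip x y i j).trans (by gcongr)
    c1 := h.c1
    cs := h.cs
    weak := h.weak }

lemma exists_cut (d : ℕ) {C : ℝ} (hC : 0 ≤ C) : ∃ L : ℝ, C ≤ L ∧ ∀ u : Eu d → ℝ, ContDiff ℝ 1 u →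
    (∀ x ∈ closedBall (0 : Eu d) (5 / 4), |u x| ≤ C ∧ ∀ i, |pd i u x| ≤ C) →
    ∃ f : Eu d → ℝ, Continuous f ∧ (∀ x ∈ closedBall (0 : Eu d) (19 / 16), f x = u x) ∧ (∀ x, |f x| ≤ C) ∧
      ∀ x y, |f x - f y| ≤ L * ‖x - y‖ := by
  let χ : ContDiffBump (0 : Eu d) := ⟨19 / 16, 5 / 4, by norm_num, by norm_num⟩
  have hχ : ContDiff ℝ 1 (χ : Eu d → ℝ) := χ.contDiff
  have hb : ∀ i, ∃ K, ∀ x, |pd i χ x| ≤ K := fun i => by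
    obtain ⟨K, hK⟩ := (continuous_pd hχ i).bounded_above_of_compact_support (hasCompactSupport_pd χ.hasCompactSupport i)
    exact ⟨K, hK⟩
  choose K hK using hb
  set S := ∑ i, |K i| with hS
  have hS0 : 0 ≤ S := Finset.sum_nonneg fun i _ => abs_nonneg _
  have hKS : ∀ i x, |pd i χ x| ≤ S := fun i x => (hK i x).trans ((le_abs_self _).trans
    (Finset.single_le_sum (f := fun i => |K i|) (fun i _ => abs_nonneg _) (Finset.mem_univ i)))
  refine ⟨C + d * (S * C + C), by nlinarith [mul_nonneg (Nat.cast_nonneg (α := ℝ) d) (add_nonneg (mul_nonneg hS0 hC) hC)], fun u hu hub => ?_⟩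
  have h1 : ContDiff ℝ 1 fun x => χ x * u x := hχ.mul hu
  refine ⟨fun x => χ x * u x, h1.continuous, fun x hx => ?_, fun x => ?_, fun x y => ?_⟩
  · simp only; rw [χ.one_of_mem_closedBall hx, one_mul]
  · simp only; rw [abs_mul, abs_of_nonneg χ.nonneg]
    by_cases hx : x ∈ closedBall (0 : Eu d) (5 / 4)
    · calc χ x * |u x| ≤ 1 * C := mul_le_mul χ.le_one (hub x hx).1 (abs_nonneg _) zero_le_one
        _ = C := one_mul C
    · rw [χ.zero_of_le_dist (by simp at hx; simpa using hx.le), zero_mul]; exact hC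
  · refine (abs_sub_le_of_pd h1 convex_univ (G := S * C + C) (fun z _ i => ?_) (mem_univ x) (mem_univ y)).trans ?_
    · rw [pd_mul i (hχ.differentiable (by norm_num) z) (hu.differentiable (by norm_num) z)]
      by_cases hz : z ∈ closedBall (0 : Eu d) (5 / 4)
      · refine (abs_add_le _ _).trans ?_
        rw [abs_mul, abs_mul, abs_of_nonneg (χ.nonneg : 0 ≤ χ z)]
        have := hub z hz
        calc |pd i χ z| * |u z| + χ z * |pd i u z| ≤ S * C + 1 * C :=
              add_le_add (mul_le_mul (hKS i z) this.1 (abs_nonneg _) hS0) (mul_le_mul χ.le_one (this.2 i) (abs_nonneg _) zero_le_one)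
          _ = _ := by ring
      · have e1 : χ z = 0 := χ.zero_of_le_dist (by simp at hz; simpa using hz.le)
        have e2 : pd i χ z = 0 := by
          by_contra hne
          have := tsupport_pd χ i (subset_tsupport _ hne)
          rw [χ.tsupport_eq] at this
          exact hz this
        rw [e1, e2]; simp; positivity
    · gcongr; linarith

lemma lim_div {c t I e : ℕ → ℝ} {c0 I0 : ℝ} (hc0 : c0 ≠ 0) (hc : Filter.Tendsto c Filter.atTop (𝓝 c0))
    (hI : Filter.Tendsto I Filter.atTop (𝓝 I0)) (he : Filter.Tendsto e Filter.atTop (𝓝 0))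
    (h : ∀ n, |c n * t n - I n| ≤ e n) : Filter.Tendsto t Filter.atTop (𝓝 (c0⁻¹ * I0)) := by
  have h1 : Filter.Tendsto (fun n => c n * t n - I n) Filter.atTop (𝓝 0) := squeeze_zero_norm h he
  have h2 : Filter.Tendsto (fun n => (c n)⁻¹ * ((c n * t n - I n) + I n)) Filter.atTop (𝓝 (c0⁻¹ * (0 + I0))) :=
    (hc.inv₀ hc0).mul (h1.add hI)
  rw [zero_add] at h2
  refine h2.congr' ?_
  filter_upwards [hc.eventually_ne hc0] with n hn
  rw [sub_add_cancel, inv_mul_cancel_left₀ hn]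

theorem compact_lim (hd : 0 < d) {lam : ℝ} (hl : 0 < lam) {Ω : ℕ → Set (Eu d)} {A : ℕ → Eu d → Matrix (Fin d) (Fin d) ℝ}
    {u : ℕ → Eu d → ℝ} (h : ∀ n : ℕ, Sol lam (1 / ((n : ℝ) + 1)) (Ω n) (A n) (u n)) (hΩ : ∀ n, ball (0 : Eu d) 2 ⊆ Ω n)
    (hm : ∀ n, ms (u n) 0 2 = 1) :
    ∃ φ : ℕ → ℕ, StrictMono φ ∧ ∃ (a : Matrix (Fin d) (Fin d) ℝ) (W : Eu d → ℝ), Ell lam a ∧ ContDiff ℝ ∞ W ∧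
      (∀ ε > 0, ∀ᶠ n in Filter.atTop, ∀ x ∈ closedBall (0 : Eu d) (9 / 8), |u (φ n) x - W x| < ε) ∧
      (∀ i, ∀ ε > 0, ∀ᶠ n in Filter.atTop, ∀ x ∈ closedBall (0 : Eu d) (9 / 8), |pd i (u (φ n)) x - pd i W x| < ε) ∧
      ∀ x ∈ ball (0 : Eu d) (9 / 8), ∑ i, ∑ j, a i j * pd i (pd j W) x = 0 := by
  obtain ⟨C, hC, hgb⟩ := grad_bound d hd hl (zero_le_one (α := ℝ))
  obtain ⟨Cs, hCs, hstar⟩ := star d hl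
  obtain ⟨K, hK, hker⟩ := exists_kernel_bounds hl
  obtain ⟨c', hc', heta⟩ := exists_eta_int d hl
  have hle1 : ∀ n : ℕ, 1 / ((n : ℝ) + 1) ≤ 1 := fun n => by
    rw [div_le_one (by positivity)]; linarith [Nat.cast_nonneg (α := ℝ) n]
  have hgb' : ∀ n, (∀ x ∈ closedBall (0 : Eu d) (5 / 4), |u n x| ≤ C) ∧ ∀ x ∈ closedBall (0 : Eu d) (3 / 2), ∀ i, |pd i (u n) x| ≤ C := by
    intro n
    have := hgb _ _ _ ((h n).mono (hle1 n)) (hΩ n)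
    have e : ∫ y in ball (0 : Eu d) 2, u n y ^ 2 = 1 := hm n
    rw [e, Real.sqrt_one, mul_one] at this
    exact this
  obtain ⟨L, hL, hcut⟩ := exists_cut d hC.le
  have hL0 : 0 ≤ L := hC.le.trans hL
  choose f fc fu fb fl using fun n => hcut (u n) (h n).c1 fun x hx =>
    ⟨(hgb' n).1 x hx, (hgb' n).2 x (closedBall_subset_closedBall (by norm_num) hx)⟩
  obtain ⟨φ, hφ, f0, a, hf0, ha⟩ := extract_seq (f := f) (a := fun n => A n 0) (C := max C 1) hL0
    (fun n x => (fb n x).trans (le_max_left _ _)) fl (fun n i j => (((h n).ell 0).abs_le hl i j).trans (le_max_right _ _))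
  have hea : Ell lam a := ell_limit (fun n => (h (φ n)).ell 0) ha
  have lip0 : ∀ x y, |f0 x - f0 y| ≤ L * ‖x - y‖ := fun x y =>
    le_of_tendsto' ((hf0 x).sub (hf0 y)).abs fun n => fl _ x y
  have cf0 : Continuous f0 := by
    refine (LipschitzWith.of_dist_le_mul (K := L.toNNReal) fun x y => ?_).continuous
    rw [Real.dist_eq, dist_eq_norm, Real.coe_toNNReal _ hL0]
    exact lip0 x y
  set c0 := ∫ y, eta a⁻¹ y with hc0
  have hc0p : c0 ≠ 0 := (hc'.trans_le (heta a hea)).ne'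
  set r : ℝ := 1 / 16 with hr
  have hr0 : 0 < r := by norm_num [hr]
  obtain ⟨hWs, hWd⟩ := KT_contDiff cf0 hr0 (contDiff_eta a⁻¹) (hea.cs_eta hl)
  set W : Eu d → ℝ := fun x => c0⁻¹ * KT f0 r (eta a⁻¹) x with hW
  have hWc : ContDiff ℝ ∞ W := contDiff_const.mul hWs
  have hWp : ∀ i x, pd i W x = c0⁻¹ * (-r⁻¹ * KT f0 r (pd i (eta a⁻¹)) x) := fun i x => by
    rw [hW, pd_const_mul i _ (hWs.differentiable (by simp) x), hWd]
  -- the key sequential statement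
  have key : ∀ ψ : ℕ → ℕ, StrictMono ψ → ∀ x : ℕ → Eu d, ∀ x0, (∀ n, x n ∈ closedBall (0 : Eu d) (9 / 8)) →
      Filter.Tendsto x Filter.atTop (𝓝 x0) →
      (∀ i j, Filter.Tendsto (fun n => A (φ (ψ n)) (x n) i j) Filter.atTop (𝓝 (a i j))) ∧
      Filter.Tendsto (fun n => u (φ (ψ n)) (x n)) Filter.atTop (𝓝 (W x0)) ∧
      ∀ i, Filter.Tendsto (fun n => pd i (u (φ (ψ n))) (x n)) Filter.atTop (𝓝 (pd i W x0)) := by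
    intro ψ hψ x x0 hx hlim
    have hinv : Filter.Tendsto (fun n : ℕ => 1 / (((φ (ψ n) : ℕ) : ℝ) + 1)) Filter.atTop (𝓝 0) :=
      (tendsto_one_div_add_atTop_nhds_zero_nat (𝕜 := ℝ)).comp ((hφ.comp hψ).tendsto_atTop)
    have hB : ∀ i j, Filter.Tendsto (fun n => A (φ (ψ n)) (x n) i j) Filter.atTop (𝓝 (a i j)) := by
      intro i j
      have h1 : Filter.Tendsto (fun n => A (φ (ψ n)) (x n) i j - A (φ (ψ n)) 0 i j) Filter.atTop (𝓝 0) := by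
        refine squeeze_zero_norm (a := fun n => 1 / (((φ (ψ n) : ℕ) : ℝ) + 1) * (9 / 8))
          (fun n => ((h (φ (ψ n))).lip (x n) 0 i j).trans ?_) (by simpa using hinv.mul_const (9 / 8))
        gcongr
        have := hx n
        rw [mem_closedBall_zero_iff] at this
        rwa [sub_zero]
      have h2 := h1.add ((ha i j).comp hψ.tendsto_atTop)
      simpa using h2
    have hEB : ∀ n, Ell lam (A (φ (ψ n)) (x n)) := fun n => (h _).ell _
    have hetal := fun y => eta_limit hl hEB hB y
    have hz : ∀ n, ∀ y ∉ closedBall (0 : Eu d) 1, eta (A (φ (ψ n)) (x n))⁻¹ y = 0 := fun n y hy =>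
      image_eq_zero_of_notMem_tsupport fun hh => hy ((hEB n).tsupport_eta hl hh)
    have hz' : ∀ i n, ∀ y ∉ closedBall (0 : Eu d) 1, pd i (eta (A (φ (ψ n)) (x n))⁻¹) y = 0 := fun i n y hy =>
      image_eq_zero_of_notMem_tsupport fun hh => hy ((hEB n).tsupport_eta hl (tsupport_pd _ _ hh))
    have hcl : Filter.Tendsto (fun n => ∫ y, eta (A (φ (ψ n)) (x n))⁻¹ y) Filter.atTop (𝓝 c0) := by
      have := int_limit (f := fun _ _ => 1) (f0 := fun _ => 1) (g := fun n y => eta (A (φ (ψ n)) (x n))⁻¹ y) (g0 := eta a⁻¹)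
        (C := 1) (K := K) zero_le_one (fun _ => continuous_const) (fun n => (contDiff_eta _).continuous) (fun _ _ _ => by simp)
        (fun n y => (hker _ (hEB n) y ⟨0, hd⟩ ⟨0, hd⟩).1) hz (fun _ _ => tendsto_const_nhds) (fun y => (hetal y).1)
      simpa only [one_mul] using this
    have hfl : ∀ y, Filter.Tendsto (fun n => f (φ (ψ n)) (x n + r • y)) Filter.atTop (𝓝 (f0 (x0 + r • y))) := by
      intro y
      have h1 : Filter.Tendsto (fun n => f (φ (ψ n)) (x n + r • y) - f (φ (ψ n)) (x0 + r • y)) Filter.atTop (𝓝 0) := by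
        refine squeeze_zero_norm (a := fun n => L * ‖x n - x0‖) (fun n => (fl _ _ _).trans (by simp)) ?_
        have := ((hlim.sub_const x0).norm).const_mul L
        simpa using this
      have h2 := h1.add ((hf0 (x0 + r • y)).comp hψ.tendsto_atTop)
      simpa using h2
    have hxy : ∀ n, ∀ y ∈ closedBall (0 : Eu d) 1, x n + r • y ∈ closedBall (0 : Eu d) (19 / 16) := by
      intro n y hy
      have h1 := hx n
      rw [mem_closedBall_zero_iff] at hy h1 ⊢
      refine (norm_add_le _ _).trans ?_
      rw [norm_smul, Real.norm_of_nonneg hr0.le, hr]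
      linarith
    have hIg : ∀ n (g : Eu d → ℝ), (∀ y ∉ closedBall (0 : Eu d) 1, g y = 0) →
        ∫ y, u (φ (ψ n)) (x n + r • y) * g y = ∫ y, f (φ (ψ n)) (x n + r • y) * g y := by
      intro n g hg
      refine integral_congr_ae (Filter.Eventually.of_forall fun y => ?_)
      by_cases hy : y ∈ closedBall (0 : Eu d) 1
      · simp only [fu (φ (ψ n)) _ (hxy n y hy)]
      · simp only [hg y hy, mul_zero]
    have hst := fun n => hstar _ _ _ _ (by positivity) (h (φ (ψ n))) (x n) r hr0
      (fun z hz => hΩ _ (by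
        have h1 := hx n
        rw [mem_closedBall_zero_iff] at h1
        rw [mem_closedBall, dist_eq_norm] at hz
        rw [mem_ball_zero_iff]
        have := norm_add_le (z - x n) (x n)
        rw [sub_add_cancel] at this
        rw [hr] at hz
        linarith)) C hC.le (fun z hz k => (hgb' _).2 z (by
        have h1 := hx n
        rw [mem_closedBall_zero_iff] at h1
        rw [mem_closedBall, dist_eq_norm] at hz
        rw [mem_closedBall_zero_iff]
        have := norm_add_le (z - x n) (x n)
        rw [sub_add_cancel] at this
        rw [hr] at hz
        linarith) k)
    have herr : Filter.Tendsto (fun n : ℕ => Cs * (1 / (((φ (ψ n) : ℕ) : ℝ) + 1) * r) * (r * C)) Filter.atTop (𝓝 0) := by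
      have := ((hinv.mul_const r).const_mul Cs).mul_const (r * C)
      simpa using this
    refine ⟨hB, ?_, fun i => ?_⟩
    · have hI := int_limit (f := fun n y => f (φ (ψ n)) (x n + r • y)) (f0 := fun y => f0 (x0 + r • y))
        (g := fun n y => eta (A (φ (ψ n)) (x n))⁻¹ y) (g0 := eta a⁻¹) (C := C) (K := K) hC.le
        (fun n => (fc _).comp (by fun_prop)) (fun n => (contDiff_eta _).continuous) (fun n y _ => fb _ _)
        (fun n y => (hker _ (hEB n) y ⟨0, hd⟩ ⟨0, hd⟩).1) hz (fun y _ => hfl y) (fun y => (hetal y).1)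
      refine lim_div hc0p hcl hI herr fun n => ?_
      have := (hst n).2
      rwa [hIg n _ (hz n)] at this
    · have hI := int_limit (f := fun n y => f (φ (ψ n)) (x n + r • y)) (f0 := fun y => f0 (x0 + r • y))
        (g := fun n y => pd i (eta (A (φ (ψ n)) (x n))⁻¹) y) (g0 := pd i (eta a⁻¹)) (C := C) (K := K) hC.le
        (fun n => (fc _).comp (by fun_prop)) (fun n => (contDiff_pd_top (contDiff_eta _) i).continuous) (fun n y _ => fb _ _)
        (fun n y => (hker _ (hEB n) y i i).2.1) (hz' i) (fun y _ => hfl y) (fun y => (hetal y).2 i)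
      have h1 := lim_div hc0p hcl hI.neg herr (t := fun n => r * pd i (u (φ (ψ n))) (x n)) fun n => by
        have := (hst n).1 i
        rw [hIg n _ (hz' i n)] at this
        rwa [sub_neg_eq_add]
      have h2 := h1.const_mul r⁻¹
      have e : pd i W x0 = r⁻¹ * (c0⁻¹ * -∫ y, f0 (x0 + r • y) * pd i (eta a⁻¹) y) := by
        rw [hWp, KT]; ring
      rw [e]
      refine h2.congr fun n => ?_
      rw [inv_mul_cancel_left₀ hr0.ne']
  refine ⟨φ, hφ, a, W, hea, hWc, fun ε hε => ?_, fun i ε hε => ?_, ?_⟩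
  · exact unif_of_seq (isCompact_closedBall _ _) (f := fun n => u (φ n)) hWc.continuous
      (fun ψ hψ x x0 hx hlim => (key ψ hψ x x0 hx hlim).2.1) hε
  · exact unif_of_seq (isCompact_closedBall _ _) (f := fun n => pd i (u (φ n))) (contDiff_pd_top hWc i).continuous
      (fun ψ hψ x x0 hx hlim => (key ψ hψ x x0 hx hlim).2.2 i) hε
  · have hcont : Continuous fun x => ∑ i, ∑ j, a i j * pd i (pd j W) x :=
      continuous_finsetSum _ fun i _ => continuous_finsetSum _ fun j _ =>
        continuous_const.mul (contDiff_pd_top (contDiff_pd_top hWc j) i).continuous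
    have hae := isOpen_ball.ae_eq_zero_of_integral_contDiff_smul_eq_zero (U := ball (0 : Eu d) (9 / 8))
      (f := fun x => ∑ i, ∑ j, a i j * pd i (pd j W) x) (μ := volume) (hcont.locallyIntegrable.locallyIntegrableOn _) ?_
    · have h1 := Measure.eqOn_open_of_ae_eq (μ := volume) (f := fun x => ∑ i, ∑ j, a i j * pd i (pd j W) x) (g := fun _ => (0 : ℝ))
        (U := ball (0 : Eu d) (9 / 8)) ((ae_restrict_iff' measurableSet_ball).2 hae) isOpen_ball hcont.continuousOn continuousOn_const
      exact h1
    · intro g hg hgc hgs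
      have hpt : ∀ x ∈ ball (0 : Eu d) (9 / 8), (∀ i j, Filter.Tendsto (fun n => A (φ n) x i j) Filter.atTop (𝓝 (a i j))) ∧
          ∀ i, Filter.Tendsto (fun n => pd i (u (φ n)) x) Filter.atTop (𝓝 (pd i W x)) := fun x hx => by
        have := key id strictMono_id (fun _ => x) x (fun _ => ball_subset_closedBall hx) tendsto_const_nhds
        exact ⟨this.1, this.2.2⟩
      have hz : ∀ i, ∀ x ∉ ball (0 : Eu d) (9 / 8), pd i g x = 0 := fun i x hx =>
        image_eq_zero_of_notMem_tsupport fun hh => hx (hgs (tsupport_pd _ _ hh))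
      have hcg : ∀ i, Continuous (pd i g) := fun i => (contDiff_pd_top hg i).continuous
      have hig : ∀ i, Integrable (pd i g) := fun i => (hcg i).integrable_of_hasCompactSupport (hasCompactSupport_pd hgc i)
      have hlim : Filter.Tendsto (fun n => ∫ x, ∑ i, ∑ j, A (φ n) x i j * pd j (u (φ n)) x * pd i g x) Filter.atTop
          (𝓝 (∫ x, ∑ i, ∑ j, a i j * pd j W x * pd i g x)) := by
        refine tendsto_integral_of_dominated_convergence (fun x => ∑ i : Fin d, ∑ _j : Fin d, C * |pd i g x|) (fun n => ?_) ?_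
          (fun n => Filter.Eventually.of_forall fun x => ?_) (Filter.Eventually.of_forall fun x => ?_)
        · exact (continuous_finsetSum _ fun i _ => continuous_finsetSum _ fun j _ =>
            (((h (φ n)).toCoef.cont i j).mul (continuous_pd (h (φ n)).c1 j)).mul (hcg i)).aestronglyMeasurable
        · exact integrable_finsetSum _ fun i _ => integrable_finsetSum _ fun j _ => (hig i).abs.const_mul C
        · refine (norm_sum_le _ _).trans (Finset.sum_le_sum fun i _ => (norm_sum_le _ _).trans (Finset.sum_le_sum fun j _ => ?_))
          rw [norm_mul, norm_mul]
          by_cases hx : x ∈ ball (0 : Eu d) (9 / 8)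
          · have h1 := ((h (φ n)).ell x).abs_le hl i j
            have h2 := (hgb' (φ n)).2 x (ball_subset_closedBall (ball_subset_ball (by norm_num) hx)) j
            calc ‖A (φ n) x i j‖ * ‖pd j (u (φ n)) x‖ * ‖pd i g x‖ ≤ (1 * C) * |pd i g x| :=
                  mul_le_mul_of_nonneg_right (mul_le_mul h1 h2 (abs_nonneg _) zero_le_one) (abs_nonneg _)
              _ = _ := by ring
          · rw [hz i x hx]; simp
        · refine tendsto_finsetSum _ fun i _ => tendsto_finsetSum _ fun j _ => ?_
          by_cases hx : x ∈ ball (0 : Eu d) (9 / 8)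
          · exact (((hpt x hx).1 i j).mul ((hpt x hx).2 j)).mul_const _
          · rw [hz i x hx]; simp
      have h0 : ∫ x, ∑ i, ∑ j, a i j * pd j W x * pd i g x = 0 := by
        refine tendsto_nhds_unique hlim ?_
        have : ∀ n, ∫ x, ∑ i, ∑ j, A (φ n) x i j * pd j (u (φ n)) x * pd i g x = 0 := fun n =>
          (h (φ n)).weak g hg hgc (hgs.trans ((ball_subset_ball (by norm_num)).trans (hΩ _)))
        simp only [this]
        exact tendsto_const_nhds
      have hcW : ∀ j, ContDiff ℝ 1 (pd j W) := fun j => (contDiff_pd_top hWc j).of_le one_le_inf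
      have hcW2 : ∀ i j, Continuous (pd i (pd j W)) := fun i j => continuous_pd (hcW j) i
      have e1 : ∫ x, ∑ i, ∑ j, a i j * pd j W x * pd i g x = ∑ i, ∑ j, a i j * ∫ x, pd j W x * pd i g x := by
        have hi : ∀ i j, Integrable (fun x => a i j * pd j W x * pd i g x) := fun i j => integrable_cs
          ((continuous_const.mul (hcW j).continuous).mul (hcg i)) ((hasCompactSupport_pd hgc i).mul_left)
        rw [integral_finsetSum _ fun i _ => integrable_finsetSum _ fun j _ => hi i j]
        refine Finset.sum_congr rfl fun i _ => ?_
        rw [integral_finsetSum _ fun j _ => hi i j]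
        refine Finset.sum_congr rfl fun j _ => ?_
        rw [← integral_const_mul]
        simp only [mul_assoc]
      have e2 : ∫ x, g x • ∑ i, ∑ j, a i j * pd i (pd j W) x = ∑ i, ∑ j, a i j * ∫ x, pd i (pd j W) x * g x := by
        have : ∀ x, g x • ∑ i, ∑ j, a i j * pd i (pd j W) x = ∑ i, ∑ j, a i j * (pd i (pd j W) x * g x) := fun x => by
          rw [smul_eq_mul, Finset.mul_sum]
          refine Finset.sum_congr rfl fun i _ => ?_
          rw [Finset.mul_sum]
          exact Finset.sum_congr rfl fun j _ => by ring
        simp only [this]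
        have hi : ∀ i j, Integrable (fun x => a i j * (pd i (pd j W) x * g x)) := fun i j => (integrable_cs
          ((hcW2 i j).mul hg.continuous) (hgc.mul_left)).const_mul _
        rw [integral_finsetSum _ fun i _ => integrable_finsetSum _ fun j _ => hi i j]
        refine Finset.sum_congr rfl fun i _ => ?_
        rw [integral_finsetSum _ fun j _ => hi i j]
        refine Finset.sum_congr rfl fun j _ => ?_
        rw [integral_const_mul]
      rw [e2]
      rw [e1] at h0
      calc _ = -∑ i, ∑ j, a i j * ∫ x, pd j W x * pd i g x := by
            simp only [← Finset.sum_neg_distrib]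
            refine Finset.sum_congr rfl fun i _ => Finset.sum_congr rfl fun j _ => ?_
            rw [integral_pd_mul (hcW j) (hg.of_le one_le_inf) hgc i]; ring
        _ = 0 := by rw [h0, neg_zero]

lemma ms_limit {u : ℕ → Eu d → ℝ} {W : Eu d → ℝ} (hu : ∀ n, Continuous (u n)) (hW : Continuous W) {S : Set (Eu d)}
    (h : ∀ ε > 0, ∀ᶠ n in Filter.atTop, ∀ x ∈ S, |u n x - W x| < ε) {y : Eu d} {s : ℝ} (hs : ball y s ⊆ S) :
    Filter.Tendsto (fun n => ms (u n) y s) Filter.atTop (𝓝 (ms W y s)) := by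
  unfold ms
  refine tendsto_integral_filter_of_dominated_convergence (fun x => (|W x| + 1) ^ 2)
    (Filter.Eventually.of_forall fun n => ((hu n).pow 2).aestronglyMeasurable) ?_ (int_ball (by fun_prop) y s) ?_
  · filter_upwards [h 1 one_pos] with n hn
    rw [ae_restrict_iff' measurableSet_ball]
    refine Filter.Eventually.of_forall fun x hx => ?_
    have h1 := hn x (hs hx)
    rw [norm_pow, Real.norm_eq_abs]
    have h2 : |u n x| ≤ |W x| + 1 := by
      have := abs_sub_abs_le_abs_sub (u n x) (W x); linarith
    gcongr
  · rw [ae_restrict_iff' measurableSet_ball]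
    refine Filter.Eventually.of_forall fun x hx => Filter.Tendsto.pow ?_ 2
    rw [Metric.tendsto_nhds]
    intro ε hε
    filter_upwards [h ε hε] with n hn
    exact hn x (hs hx)

/-- Covering a compact null set. -/
lemma cover_null {X : Type*} [MetricSpace X] [MeasurableSpace X] [BorelSpace X] [Nonempty X] {K : Set X} (hK : IsCompact K) {t : ℝ} (ht : 0 < t)
    (h0 : μH[t] K = 0) {η : ℝ} (hη : 0 < η) :
    ∃ (ι : Finset ℕ) (x : ℕ → X) (r : ℕ → ℝ), (∀ i ∈ ι, 0 < r i ∧ r i ≤ η) ∧ ∑ i ∈ ι, (r i) ^ t ≤ η ∧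
      K ⊆ ⋃ i ∈ ι, ball (x i) (r i) := by
  have h1 := h0
  rw [Measure.hausdorffMeasure_apply] at h1
  simp only [ENNReal.iSup_eq_zero] at h1
  have h2 := h1 (ENNReal.ofReal (η / 2)) (by positivity)
  have h3 : (⨅ (s : ℕ → Set X) (_ : K ⊆ ⋃ n, s n) (_ : ∀ n, ediam (s n) ≤ ENNReal.ofReal (η / 2)),
      ∑' n, ⨆ _ : (s n).Nonempty, ediam (s n) ^ t) < ENNReal.ofReal (η / 2) := by
    rw [h2]; positivity
  simp only [iInf_lt_iff] at h3
  obtain ⟨s, hs, hsd, hsum⟩ := h3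
  have hfin : ∀ n, ediam (s n) ≠ ⊤ := fun n => ((hsd n).trans_lt ENNReal.ofReal_lt_top).ne
  set D : ℕ → ℝ := fun n => (ediam (s n)).toReal with hD
  have hD0 : ∀ n, 0 ≤ D n := fun n => ENNReal.toReal_nonneg
  have hDe : ∀ n, D n ≤ η / 2 := fun n => ENNReal.toReal_le_of_le_ofReal (by positivity) (hsd n)
  obtain ⟨e, he0, c, hes, hec⟩ := (⟨fun n => (η / 2) / 2 / 2 ^ n, fun n => by positivity, η / 2, hasSum_geometric_two' (η / 2), le_rfl⟩ :
    ∃ e : ℕ → ℝ, (∀ n, 0 < e n) ∧ ∃ c, HasSum e c ∧ c ≤ η / 2)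
  have hex : ∀ n, ∃ ρ, D n < ρ ∧ ρ ≤ η ∧ ρ ^ t ≤ D n ^ t + e n := by
    intro n
    have hc : ContinuousAt (fun ρ : ℝ => ρ ^ t) (D n) := Real.continuousAt_rpow_const _ _ (Or.inr ht.le)
    have h4 : ∀ᶠ ρ in 𝓝 (D n), ρ ^ t < D n ^ t + e n := hc.eventually_lt continuousAt_const (by simpa using he0 n)
    have h5 : ∀ᶠ ρ in 𝓝 (D n), ρ < η := eventually_lt_nhds (by linarith [hDe n])
    obtain ⟨ρ, h6, h7⟩ := (((h4.and h5).filter_mono nhdsWithin_le_nhds).and self_mem_nhdsWithin : ∀ᶠ ρ in 𝓝[>] (D n), _).exists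
    exact ⟨ρ, h7, h6.2.le, h6.1.le⟩
  choose r hr1 hr2 hr3 using hex
  classical
  set x : ℕ → X := fun n => if h : (s n).Nonempty then h.some else Classical.arbitrary X with hx
  have hsub : ∀ n, s n ⊆ ball (x n) (r n) := by
    intro n z hz
    have hne : (s n).Nonempty := ⟨z, hz⟩
    have hxn : x n ∈ s n := by simp only [hx, dif_pos hne]; exact hne.some_mem
    have h4 := edist_le_ediam_of_mem hz hxn
    rw [mem_ball]
    refine lt_of_le_of_lt ?_ (hr1 n)
    rw [dist_edist]
    exact ENNReal.toReal_mono (hfin n) h4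
  set good : Set ℕ := {n | (s n).Nonempty}
  have hcov : K ⊆ ⋃ n ∈ good, ball (x n) (r n) := by
    intro z hz
    obtain ⟨n, hn⟩ := mem_iUnion.1 (hs hz)
    exact mem_biUnion (x := n) (⟨z, hn⟩ : (s n).Nonempty) (hsub n hn)
  obtain ⟨b, hb, hbf, hbc⟩ := hK.elim_finite_subcover_image (b := good) (c := fun n => ball (x n) (r n)) (fun _ _ => isOpen_ball) hcov
  refine ⟨hbf.toFinset, x, r, fun i _ => ⟨(hD0 i).trans_lt (hr1 i), hr2 i⟩, ?_, by simpa using hbc⟩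
  have h5 : ∑ i ∈ hbf.toFinset, D i ^ t ≤ η / 2 := by
    have h6 : ∑ i ∈ hbf.toFinset, ENNReal.ofReal (D i ^ t) ≤ ENNReal.ofReal (η / 2) := by
      refine (Finset.sum_le_sum fun i hi => ?_).trans ((ENNReal.sum_le_tsum hbf.toFinset).trans hsum.le)
      have : (s i).Nonempty := hb (by simpa using hi)
      rw [iSup_pos this, ← ENNReal.ofReal_rpow_of_nonneg (hD0 i) ht.le, hD, ENNReal.ofReal_toReal (hfin i)]
    rw [← ENNReal.ofReal_sum_of_nonneg fun i _ => Real.rpow_nonneg (hD0 i) _] at h6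
    exact (ENNReal.ofReal_le_ofReal_iff (by positivity)).1 h6
  calc ∑ i ∈ hbf.toFinset, r i ^ t ≤ ∑ i ∈ hbf.toFinset, (D i ^ t + e i) := Finset.sum_le_sum fun i _ => hr3 i
    _ = _ + ∑ i ∈ hbf.toFinset, e i := Finset.sum_add_distrib
    _ ≤ η / 2 + η / 2 := add_le_add h5 ((sum_le_hasSum _ (fun i _ => (he0 i).le) hes).trans hec)
    _ = η := by ring

lemma graph_piece (hd : 2 ≤ d) {v : Eu d → ℝ} (hv : ContDiff ℝ 1 v) {g : Eu d → Fin d → ℝ} (i : Fin d) {c Γ : ℝ} (hc : 0 < c)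
    (hΓ : 0 ≤ Γ) {B G : Set (Eu d)} (hB : Convex ℝ B) (hGB : G ⊆ B) (hG1 : G ⊆ closedBall 0 1) (hz : ∀ z ∈ G, v z = 0)
    (hci : ∀ z ∈ G, c ≤ |g z i|) (hgΓ : ∀ z ∈ G, ∀ j, |g z j| ≤ Γ)
    (hclose : ∀ z ∈ G, ∀ w ∈ B, ∀ j, |pd j v w - g z j| ≤ c / (2 * d)) :
    μH[(d : ℝ) - 1] G ≤ ((((2 + 2 * Γ / c) * d).toNNReal : ℝ≥0∞) ^ ((d : ℝ) - 1)) *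
      volume (closedBall (0 : {j : Fin d // j ≠ i} → ℝ) 1) := by
  have hd0 : (0 : ℝ) < d := by positivity
  have hd1 : (0 : ℝ) ≤ (d : ℝ) - 1 := by have : (2 : ℝ) ≤ d := by exact_mod_cast hd
                                         linarith
  set p : Eu d → ({j : Fin d // j ≠ i} → ℝ) := fun x j => x j with hp
  have h1 := muH_le_of_antilip G p (((2 + 2 * Γ / c) * d).toNNReal) (fun x hx z hzG => ?_) hd1
  · refine h1.trans ?_
    refine mul_le_mul_right ?_ _
    have hcard : ((Fintype.card {j : Fin d // j ≠ i} : ℕ) : ℝ) = (d : ℝ) - 1 := by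
      rw [Fintype.card_subtype_compl, Fintype.card_fin, Fintype.card_subtype_eq, Nat.cast_sub (by omega)]; simp
    rw [← hcard, hausdorffMeasure_pi_real]
    refine measure_mono ?_
    rintro _ ⟨x, hx, rfl⟩
    rw [mem_closedBall_zero_iff, pi_norm_le_iff_of_nonneg zero_le_one]
    intro j
    have := hG1 hx
    rw [mem_closedBall_zero_iff] at this
    exact (abs_coord_le x j).trans this
  · rw [Real.coe_toNNReal _ (by positivity)]
    set Δ := dist (p x) (p z) with hΔ
    have hΔj : ∀ j, j ≠ i → |x j - z j| ≤ Δ := fun j hj => by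
      have := dist_le_pi_dist (p x) (p z) ⟨j, hj⟩
      rwa [Real.dist_eq] at this
    -- linear part
    have hlin : ContDiff ℝ 1 fun w : Eu d => ∑ j, g z j * w j :=
      ContDiff.sum fun j _ => contDiff_const.mul (contDiff_coord j)
    have hpl : ∀ k w, pd k (fun w : Eu d => ∑ j, g z j * w j) w = g z k := by
      intro k w
      rw [pd_sum Finset.univ (f := fun j w => g z j * w j) k fun j _ => ((contDiff_const.mul (contDiff_coord j)).differentiable (n := 1) (by simp)) w]
      rw [Finset.sum_eq_single k]
      · rw [pd_const_mul k _ ((contDiff_coord (n := 1) k).differentiable (by simp) w), pd_coord]; simp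
      · intro j _ hj
        rw [pd_const_mul k _ ((contDiff_coord (n := 1) j).differentiable (by simp) w), pd_coord]; simp [hj]
      · simp
    have h2 := abs_sub_le_of_pd (hv.sub hlin) hB (G := c / (2 * d)) (fun w hw k => by
      have e := pd_sub k (hv.differentiable (by norm_num) w) (hlin.differentiable (by norm_num) w)
      rw [e, hpl]
      exact hclose z hzG w hw k) (hGB hx) (hGB hzG)
    have e1 : v x - ∑ j, g z j * x j - (v z - ∑ j, g z j * z j) = -∑ j, g z j * (x j - z j) := by
      simp only [hz x hx, hz z hzG, mul_sub, Finset.sum_sub_distrib]; ring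
    rw [e1, abs_neg, show (d : ℝ) * (c / (2 * d)) = c / 2 by field_simp] at h2
    set T := ∑ j ∈ Finset.univ.erase i, |x j - z j| with hT
    have hTn : T ≤ d * Δ := by
      calc T ≤ ∑ j ∈ Finset.univ.erase i, Δ := Finset.sum_le_sum fun j hj => hΔj j (Finset.ne_of_mem_erase hj)
        _ ≤ d * Δ := by
          rw [Finset.sum_const, nsmul_eq_mul]
          have : (((Finset.univ.erase i).card : ℕ) : ℝ) ≤ d := by
            exact_mod_cast (Finset.card_le_univ (Finset.univ.erase i)).trans (by simp)
          exact mul_le_mul_of_nonneg_right this dist_nonneg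
    have hT0 : 0 ≤ T := Finset.sum_nonneg fun j _ => abs_nonneg _
    have hnorm : ‖x - z‖ ≤ |x i - z i| + T := by
      rw [hT, Finset.add_sum_erase _ (fun j => |x j - z j|) (Finset.mem_univ i)]
      calc ‖x - z‖ = ‖∑ j, (x - z) j • ev j‖ := by rw [← sum_ev]
        _ ≤ ∑ j, ‖(x - z) j • ev j‖ := norm_sum_le _ _
        _ = ∑ j, |x j - z j| := Finset.sum_congr rfl fun j _ => by rw [norm_smul, norm_ev, mul_one]; rfl
    have h3 : |g z i * (x i - z i)| ≤ |∑ j, g z j * (x j - z j)| + Γ * T := by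
      rw [← Finset.add_sum_erase _ (fun j => g z j * (x j - z j)) (Finset.mem_univ i)]
      have h4 : |∑ j ∈ Finset.univ.erase i, g z j * (x j - z j)| ≤ Γ * T := by
        refine (Finset.abs_sum_le_sum_abs _ _).trans ?_
        rw [hT, Finset.mul_sum]
        refine Finset.sum_le_sum fun j _ => ?_
        rw [abs_mul]
        exact mul_le_mul_of_nonneg_right (hgΓ z hzG j) (abs_nonneg _)
      have h5 := abs_sub_abs_le_abs_sub (g z i * (x i - z i)) (-∑ j ∈ Finset.univ.erase i, g z j * (x j - z j))
      rw [sub_neg_eq_add, abs_neg] at h5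
      linarith
    rw [abs_mul] at h3
    have h6 : c * |x i - z i| ≤ |g z i| * |x i - z i| := mul_le_mul_of_nonneg_right (hci z hzG) (abs_nonneg _)
    have h7 : c / 2 * ‖x - z‖ ≤ c / 2 * (|x i - z i| + T) := by gcongr
    have h8 : c * |x i - z i| ≤ (c + 2 * Γ) * T := by nlinarith
    have h9 : |x i - z i| ≤ (1 + 2 * Γ / c) * T := by
      rw [show (1 + 2 * Γ / c) * T = ((c + 2 * Γ) * T) / c by field_simp, le_div_iff₀ hc]; linarith
    rw [dist_eq_norm]
    calc ‖x - z‖ ≤ (2 + 2 * Γ / c) * T := by linarith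
      _ ≤ (2 + 2 * Γ / c) * (d * Δ) := by gcongr
      _ = _ := by ring

lemma seq_good (hd : 2 ≤ d) {lam N1 : ℝ} (hl : 0 < lam) (hl1 : lam ≤ 1) {Ω : ℕ → Set (Eu d)} {A : ℕ → Eu d → Matrix (Fin d) (Fin d) ℝ}
    {u : ℕ → Eu d → ℝ} (h : ∀ n : ℕ, Sol lam (1 / ((n : ℝ) + 1)) (Ω n) (A n) (u n)) (hΩ : ∀ n, ball (0 : Eu d) 2 ⊆ Ω n)
    (hm : ∀ n, ms (u n) 0 2 = 1)
    (hD : ∀ n, ∀ y, ‖y‖ ≤ 5 / 4 → 1 ≤ N1 * ms (u n) y (Real.sqrt lam / 8) ∧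
      ∀ s, 0 < s → s ≤ Real.sqrt lam / 16 → ms (u n) y (2 * s) ≤ N1 * ms (u n) y s) :
    ∃ φ : ℕ → ℕ, StrictMono φ ∧ ∃ (ι : Finset ℕ) (x : ℕ → Eu d) (r : ℕ → ℝ) (T : ℝ≥0∞),
      (∀ i ∈ ι, 0 < r i ∧ r i ≤ 1 / 4) ∧ ∑ i ∈ ι, (2 * r i) ^ (d - 1) ≤ 1 / 2 ∧ T ≠ ⊤ ∧
      ∀ᶠ n in Filter.atTop, μH[(d : ℝ) - 1] ({z ∈ closedBall (0 : Eu d) 1 | u (φ n) z = 0} \ ⋃ i ∈ ι, ball (x i) (r i)) ≤ T := by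
  obtain ⟨φ, hφ, a, W, ha, hW, hu, hpu, hpde⟩ := compact_lim (by omega) hl h hΩ hm
  refine ⟨φ, hφ, ?_⟩
  have hd0 : (0 : ℝ) < d := by positivity
  have hd2 : (2 : ℝ) ≤ d := by exact_mod_cast hd
  have hsq : 0 < Real.sqrt lam := Real.sqrt_pos.2 hl
  have hsq1 : Real.sqrt lam ≤ 1 := Real.sqrt_le_one.2 hl1
  have hWp : ∀ i, Continuous (pd i W) := fun i => (contDiff_pd_top hW i).continuous
  -- non-flatness
  have hflat : ∀ y ∈ closedBall (0 : Eu d) 1, ∃ l, pdl l W y ≠ 0 := by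
    intro y hy
    rw [mem_closedBall_zero_iff] at hy
    have hb : ∀ s ≤ Real.sqrt lam / 8, ball y s ⊆ closedBall (0 : Eu d) (9 / 8) := by
      intro s hs z hz
      rw [mem_ball, dist_eq_norm] at hz
      rw [mem_closedBall_zero_iff]
      have := norm_add_le (z - y) y
      rw [sub_add_cancel] at this
      linarith
    have hlim : ∀ s ≤ Real.sqrt lam / 8, Filter.Tendsto (fun n => ms (u (φ n)) y s) Filter.atTop (𝓝 (ms W y s)) :=
      fun s hs => ms_limit (fun n => (h (φ n)).c1.continuous) hW.continuous hu (hb s hs)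
    refine not_flat (N := N1) hW (s := Real.sqrt lam / 8) (by positivity) (by linarith) ?_ fun t ht ht2 => ?_
    · have h1 : 1 ≤ N1 * ms W y (Real.sqrt lam / 8) :=
        ge_of_tendsto' ((hlim _ le_rfl).const_mul N1) fun n => (hD (φ n) y (by linarith)).1
      refine lt_of_le_of_ne (ms_nonneg _ _ _) fun h0 => ?_
      rw [← h0, mul_zero] at h1
      linarith
    · exact le_of_tendsto_of_tendsto' (hlim _ ht2) ((hlim t (by linarith)).const_mul N1) fun n =>
        (hD (φ n) y (by linarith)).2 t ht (by linarith)
  have hnull := crit_null hl ha hW isOpen_ball hpde (S := closedBall (0 : Eu d) 1) (closedBall_subset_ball (by norm_num)) hflat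
  have hcomp : IsCompact {y ∈ closedBall (0 : Eu d) 1 | W y = 0 ∧ ∀ i, pd i W y = 0} := by
    refine (isCompact_closedBall (0 : Eu d) 1).inter_right (t := {y | W y = 0 ∧ ∀ i, pd i W y = 0}) ?_
    have e : {y | W y = 0 ∧ ∀ i, pd i W y = 0} = {y | W y = 0} ∩ ⋂ i, {y | pd i W y = 0} := by
      ext y; simp
    rw [e]
    exact (isClosed_eq hW.continuous continuous_const).inter (isClosed_iInter fun i => isClosed_eq (hWp i) continuous_const)
  set η : ℝ := (1 / 4) / 2 ^ (d - 1) with hη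
  have hη0 : 0 < η := by positivity
  have hη4 : η ≤ 1 / 4 := by
    rw [hη]; exact div_le_self (by norm_num) (one_le_pow₀ (by norm_num))
  obtain ⟨ι, x, r, hr, hsum, hcov⟩ := cover_null hcomp (t := (d : ℝ) - 1) (by linarith) hnull hη0
  have hcast : (d : ℝ) - 1 = ((d - 1 : ℕ) : ℝ) := by rw [Nat.cast_sub (by omega)]; simp
  -- the regular part
  set K' := closedBall (0 : Eu d) 1 \ ⋃ i ∈ ι, ball (x i) (r i) with hK'
  have hK'c : IsCompact K' := (isCompact_closedBall _ _).diff (isOpen_biUnion fun i _ => isOpen_ball)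
  obtain ⟨c, hc, hcl⟩ : ∃ c : ℝ, 0 < c ∧ ∀ z ∈ K', c ≤ |W z| ∨ ∃ i, c ≤ |pd i W z| := by
    have hcont : Continuous fun z => |W z| + ∑ i, |pd i W z| :=
      hW.continuous.abs.add (continuous_finsetSum _ fun i _ => (hWp i).abs)
    obtain ⟨c, hc, hcl⟩ := hK'c.exists_forall_le' (a := 0) hcont.continuousOn (fun z hz => by
      by_contra hcon
      push Not at hcon
      have h1 : 0 ≤ ∑ i, |pd i W z| := Finset.sum_nonneg fun i _ => abs_nonneg _
      have h2 : |W z| = 0 := by linarith [abs_nonneg (W z)]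
      have h3 : ∑ i, |pd i W z| = 0 := by linarith [abs_nonneg (W z)]
      rw [Finset.sum_eq_zero_iff_of_nonneg fun i _ => abs_nonneg _] at h3
      exact hz.2 (hcov ⟨hz.1, abs_eq_zero.1 h2, fun i => abs_eq_zero.1 (h3 i (Finset.mem_univ i))⟩))
    refine ⟨c / (d + 1), by positivity, fun z hz => ?_⟩
    by_contra hcon
    push Not at hcon
    have h1 := hcl z hz
    have h2 : ∑ i, |pd i W z| ≤ ∑ _i : Fin d, c / (d + 1) := Finset.sum_le_sum fun i _ => (hcon.2 i).le
    rw [Finset.sum_const, Finset.card_univ, Fintype.card_fin, nsmul_eq_mul] at h2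
    have h3 : c / (d + 1) + d * (c / (d + 1)) = c := by field_simp; ring
    linarith [hcon.1]
  -- bound for the gradient
  obtain ⟨Γ, hΓ0, hΓ⟩ : ∃ Γ : ℝ, 0 ≤ Γ ∧ ∀ z ∈ closedBall (0 : Eu d) 1, ∀ j, |pd j W z| ≤ Γ := by
    have : ∀ j, ∃ C, ∀ z ∈ closedBall (0 : Eu d) 1, ‖pd j W z‖ ≤ C := fun j =>
      (isCompact_closedBall (0 : Eu d) 1).exists_bound_of_continuousOn (hWp j).continuousOn
    choose C hC using this
    refine ⟨∑ j, |C j|, Finset.sum_nonneg fun _ _ => abs_nonneg _, fun z hz j => (hC j z hz).trans ((le_abs_self _).trans ?_)⟩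
    exact Finset.single_le_sum (f := fun j => |C j|) (fun _ _ => abs_nonneg _) (Finset.mem_univ j)
  -- modulus of continuity
  obtain ⟨ρ, hρ0, hρ8, hρ⟩ : ∃ ρ : ℝ, 0 < ρ ∧ ρ ≤ 1 / 8 ∧ ∀ j, ∀ z ∈ closedBall (0 : Eu d) (9 / 8), ∀ w ∈ closedBall (0 : Eu d) (9 / 8),
      dist z w < ρ → |pd j W z - pd j W w| ≤ c / (4 * d) := by
    have : ∀ j, ∃ ρ > 0, ∀ z ∈ closedBall (0 : Eu d) (9 / 8), ∀ w ∈ closedBall (0 : Eu d) (9 / 8),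
        dist z w < ρ → dist (pd j W z) (pd j W w) < c / (4 * d) := fun j =>
      Metric.uniformContinuousOn_iff.1 ((isCompact_closedBall (0 : Eu d) (9 / 8)).uniformContinuousOn_of_continuous (hWp j).continuousOn) _ (by positivity)
    choose ρ hρ0 hρ using this
    have hne : (Finset.univ : Finset (Fin d)).Nonempty := ⟨⟨0, by omega⟩, Finset.mem_univ _⟩
    refine ⟨min (1 / 8) (Finset.univ.inf' hne ρ), lt_min (by norm_num) ((Finset.lt_inf'_iff hne).2 fun j _ => hρ0 j), min_le_left _ _, fun j z hz w hw hzw => ?_⟩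
    have := hρ j z hz w hw (hzw.trans_le ((min_le_right _ _).trans (Finset.inf'_le _ (Finset.mem_univ j))))
    exact this.le
  obtain ⟨P, hPs, hPf, hPc⟩ := (isCompact_closedBall (0 : Eu d) 1).finite_cover_balls (e := ρ / 2) (by positivity)
  set V : Fin d → ℝ≥0∞ := fun i => ((((2 + 2 * Γ / c) * d).toNNReal : ℝ≥0∞) ^ ((d : ℝ) - 1)) *
      volume (closedBall (0 : {j : Fin d // j ≠ i} → ℝ) 1) with hV
  refine ⟨ι, x, r, ∑ p ∈ hPf.toFinset, ∑ i, V i, fun i hi => ⟨(hr i hi).1, (hr i hi).2.trans hη4⟩, ?_, ?_, ?_⟩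
  · rw [hcast] at hsum
    simp only [Real.rpow_natCast] at hsum
    simp only [mul_pow, ← Finset.mul_sum]
    calc (2 : ℝ) ^ (d - 1) * ∑ i ∈ ι, r i ^ (d - 1) ≤ 2 ^ (d - 1) * η := by gcongr
      _ = 1 / 4 := by rw [hη]; field_simp
      _ ≤ 1 / 2 := by norm_num
  · refine (ENNReal.sum_lt_top.2 fun p _ => ENNReal.sum_lt_top.2 fun i _ => ?_).ne
    refine ENNReal.mul_lt_top (ENNReal.rpow_lt_top_of_nonneg (by linarith) ENNReal.coe_ne_top) ?_
    exact (isCompact_closedBall _ _).measure_lt_top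
  · filter_upwards [hu c hc, Filter.eventually_all.2 fun i => hpu i (c / (4 * d)) (by positivity)] with n h1 h2
    have hsub : {z ∈ closedBall (0 : Eu d) 1 | u (φ n) z = 0} \ ⋃ i ∈ ι, ball (x i) (r i) ⊆
        ⋃ p ∈ hPf.toFinset, ⋃ i ∈ (Finset.univ : Finset (Fin d)), {z ∈ K' | u (φ n) z = 0 ∧ z ∈ ball p (ρ / 2) ∧ c ≤ |pd i W z|} := by
      rintro z ⟨⟨hz1, hz0⟩, hzn⟩
      obtain ⟨p, hp, hzp⟩ := mem_iUnion₂.1 (hPc hz1)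
      have h3 := h1 z (closedBall_subset_closedBall (by norm_num) hz1)
      rw [hz0, zero_sub, abs_neg] at h3
      rcases hcl z ⟨hz1, hzn⟩ with h4 | ⟨i, hi⟩
      · linarith
      · exact mem_biUnion (by simpa using hp) (mem_biUnion (Finset.mem_coe.2 (Finset.mem_univ i)) ⟨⟨hz1, hzn⟩, hz0, hzp, hi⟩)
    refine (measure_mono hsub).trans ((measure_biUnion_finset_le _ _).trans (Finset.sum_le_sum fun p hp => ?_))
    refine (measure_biUnion_finset_le _ _).trans (Finset.sum_le_sum fun i _ => ?_)
    have hp1 : ball p (ρ / 2) ⊆ closedBall (0 : Eu d) (9 / 8) := by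
      intro z hz
      have hp' : p ∈ closedBall (0 : Eu d) 1 := hPs (by simpa using hp)
      rw [mem_closedBall_zero_iff] at hp' ⊢
      rw [mem_ball, dist_eq_norm] at hz
      have := norm_add_le (z - p) p
      rw [sub_add_cancel] at this
      linarith
    refine graph_piece hd (h (φ n)).c1 (g := fun z j => pd j W z) i hc hΓ0 (convex_ball p (ρ / 2)) (fun z hz => hz.2.2.1)
      (fun z hz => hz.1.1) (fun z hz => hz.2.1) (fun z hz => hz.2.2.2) (fun z hz => hΓ z hz.1.1) fun z hz w hw j => ?_
    have h3 := h2 j w (hp1 hw)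
    have h4 := hρ j w (hp1 hw) z (hp1 hz.2.2.1) (by
      have h5 := hz.2.2.1
      rw [mem_ball] at hw h5
      have := dist_triangle_right w z p
      linarith)
    have h5 := abs_sub_le (pd j (u (φ n)) w) (pd j W w) (pd j W z)
    have h6 : c / (2 * d) = c / (4 * d) + c / (4 * d) := by field_simp; ring
    rw [h6]
    linarith

theorem one_step (d : ℕ) (hd : 2 ≤ d) {lam : ℝ} (hl : 0 < lam) (hl1 : lam ≤ 1) (N : ℝ) :
    ∃ δ : ℝ, 0 < δ ∧ ∃ C0 : ℝ, 0 < C0 ∧ ∀ (Ω : Set (Eu d)) (A : Eu d → Matrix (Fin d) (Fin d) ℝ) (v : Eu d → ℝ),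
      Sol lam δ Ω A v → IsOpen Ω → ball (0 : Eu d) 2 ⊆ Ω → 0 < ms v 0 2 → ms v 0 2 ≤ N * ms v 0 (Real.sqrt lam / 8) →
      ∃ (ι : Finset ℕ) (x : ℕ → Eu d) (r : ℕ → ℝ), (∀ i ∈ ι, 0 < r i ∧ r i ≤ 1 / 4) ∧ ∑ i ∈ ι, (2 * r i) ^ (d - 1) ≤ 1 / 2 ∧
        μH[(d : ℝ) - 1] ({z ∈ closedBall (0 : Eu d) 1 | v z = 0} \ ⋃ i ∈ ι, ball (x i) (r i)) ≤ ENNReal.ofReal C0 := by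
  by_contra hcon
  push Not at hcon
  choose Ω A v hS ho hΩ hp hN hbad using fun n : ℕ => hcon (1 / ((n : ℝ) + 1)) (by positivity) ((n : ℝ) + 1) (by positivity)
  obtain ⟨N1, hN1, hdoub⟩ := doubling d (by omega) hl hl1 (zero_le_one (α := ℝ)) N
  set c : ℕ → ℝ := fun n => (Real.sqrt (ms (v n) 0 2))⁻¹ with hc
  have hc0 : ∀ n, 0 < c n := fun n => inv_pos.2 (Real.sqrt_pos.2 (hp n))
  have hcm : ∀ n, c n ^ 2 * ms (v n) 0 2 = 1 := fun n => by
    rw [hc, inv_pow, Real.sq_sqrt (hp n).le, inv_mul_cancel₀ (hp n).ne']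
  have hle1 : ∀ n : ℕ, 1 / ((n : ℝ) + 1) ≤ 1 := fun n => by
    rw [div_le_one (by positivity)]; linarith [Nat.cast_nonneg (α := ℝ) n]
  have hms : ∀ n y s, ms (fun x => c n * v n x) y s = c n ^ 2 * ms (v n) y s := fun n y s => by
    have := ms_affine (v n) 0 y one_pos (c n) s
    simpa using this
  have hS' : ∀ n : ℕ, Sol lam (1 / ((n : ℝ) + 1)) (Ω n) (A n) (fun x => c n * v n x) := fun n => by
    have := (hS n).affine 0 one_pos (c n)
    simpa using this
  obtain ⟨φ, hφ, ι, x, r, T, hr, hsum, hT, hev⟩ := seq_good hd hl hl1 (N1 := N1) hS' hΩ (fun n => by rw [hms, hcm]) fun n y hy => by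
    have h1 := hdoub (A n) (v n) (Ω n) ((hS n).mono (hle1 n)) (ho n) (hΩ n) (hp n) (hN n) y hy
    have hcn : 0 ≤ c n ^ 2 := by positivity
    refine ⟨?_, fun s hs hs1 => ?_⟩
    · rw [hms, ← hcm n]
      nlinarith [mul_le_mul_of_nonneg_left h1.1 hcn]
    · rw [hms, hms]
      nlinarith [mul_le_mul_of_nonneg_left (h1.2 s hs hs1) hcn]
  have hlarge : ∀ᶠ n : ℕ in Filter.atTop, T.toReal ≤ (n : ℝ) := by
    exact Filter.eventually_atTop.2 ⟨⌈T.toReal⌉₊, fun n hn => (Nat.le_ceil _).trans (by exact_mod_cast hn)⟩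
  obtain ⟨n, h1, h2⟩ := (hev.and hlarge).exists
  have h3 := hbad (φ n) ι x r hr hsum
  have e : {z ∈ closedBall (0 : Eu d) 1 | c (φ n) * v (φ n) z = 0} = {z ∈ closedBall (0 : Eu d) 1 | v (φ n) z = 0} := by
    ext z; simp [(hc0 (φ n)).ne']
  rw [e] at h1
  have h4 := h3.trans_le h1
  rw [← ENNReal.ofReal_toReal hT] at h4
  have h5 := (ENNReal.ofReal_lt_ofReal_iff_of_nonneg (by positivity)).1 h4
  have h6 : (n : ℝ) ≤ (φ n : ℝ) := by exact_mod_cast hφ.le_apply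
  linarith

/-- Hausdorff premeasure at a fixed scale. -/
def preH (t : ℝ) (s : ℝ≥0∞) : OuterMeasure (Eu d) := OuterMeasure.mkMetric'.pre (fun S => ediam S ^ t) s

lemma preH_le_diam {t : ℝ} {s : ℝ≥0∞} {S : Set (Eu d)} (h : ediam S ≤ s) : preH t s S ≤ ediam S ^ t :=
  OuterMeasure.mkMetric'.pre_le h

lemma muH_eq (t : ℝ) (S : Set (Eu d)) : μH[t] S = ⨆ (s : ℝ≥0∞) (_ : 0 < s), preH t s S := by
  rw [← Measure.coe_toOuterMeasure, Measure.hausdorffMeasure, Measure.mkMetric_toOuterMeasure, OuterMeasure.mkMetric,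
    OuterMeasure.mkMetric']
  simp only [OuterMeasure.iSup_apply]
  rfl

lemma preH_le {t : ℝ} {s : ℝ≥0∞} (hs : 0 < s) (S : Set (Eu d)) : preH t s S ≤ μH[t] S := by
  rw [muH_eq]
  exact le_iSup₂ (f := fun (s : ℝ≥0∞) (_ : 0 < s) => preH t s S) s hs

/-- abstract iteration -/
lemma iterate_bound (hd : 2 ≤ d) {Q : Set (Eu d)} {C0 ρ0 : ℝ} (hC0 : 0 < C0) (hC1 : (2 : ℝ) ^ (d - 1) ≤ C0)
    (h : ∀ y ∈ Q, ∀ ρ, 0 < ρ → ρ ≤ ρ0 → ∃ (ι : Finset ℕ) (x : ℕ → Eu d) (r : ℕ → ℝ), (∀ i ∈ ι, 0 < r i ∧ r i ≤ 1 / 4) ∧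
      ∑ i ∈ ι, (2 * r i) ^ (d - 1) ≤ 1 / 2 ∧
      μH[(d : ℝ) - 1] ((Q ∩ closedBall y ρ) \ ⋃ i ∈ ι, ball (x i) (ρ * r i)) ≤ ENNReal.ofReal (C0 * ρ ^ (d - 1))) :
    ∀ y ∈ Q, ∀ ρ, 0 < ρ → ρ ≤ ρ0 → μH[(d : ℝ) - 1] (Q ∩ closedBall y ρ) ≤ ENNReal.ofReal (2 * C0 * ρ ^ (d - 1)) := by
  have hcast : (d : ℝ) - 1 = ((d - 1 : ℕ) : ℝ) := by rw [Nat.cast_sub (by omega)]; simp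
  have key : ∀ s : ℝ, 0 < s → ∀ n : ℕ, ∀ y ∈ Q, ∀ ρ, 0 < ρ → ρ ≤ ρ0 → 2 * ρ ≤ 2 ^ n * s →
      preH ((d : ℝ) - 1) (ENNReal.ofReal s) (Q ∩ closedBall y ρ) ≤ ENNReal.ofReal (2 * C0 * ρ ^ (d - 1)) := by
    intro s hs n
    induction n with
    | zero =>
      intro y _ ρ hρ _ hρs
      have hdiam : ediam (Q ∩ closedBall y ρ) ≤ ENNReal.ofReal (2 * ρ) := by
        refine (ediam_mono inter_subset_right).trans ?_
        refine ediam_le fun a ha b hb => ?_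
        rw [edist_dist]
        refine ENNReal.ofReal_le_ofReal ?_
        rw [mem_closedBall] at ha hb
        linarith [dist_triangle_right a b y]
      refine (preH_le_diam (hdiam.trans (ENNReal.ofReal_le_ofReal (by simpa using hρs)))).trans ?_
      rw [hcast, ENNReal.rpow_natCast]
      calc ediam (Q ∩ closedBall y ρ) ^ (d - 1) ≤ ENNReal.ofReal (2 * ρ) ^ (d - 1) := by gcongr
        _ = ENNReal.ofReal ((2 * ρ) ^ (d - 1)) := by rw [ENNReal.ofReal_pow (by positivity)]
        _ ≤ _ := by
          refine ENNReal.ofReal_le_ofReal ?_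
          rw [mul_pow]
          gcongr
          linarith
    | succ n ih =>
      intro y hy ρ hρ hρ0 hρs
      obtain ⟨ι, x, r, hr, hsum, hmu⟩ := h y hy ρ hρ hρ0
      set P := preH (d := d) ((d : ℝ) - 1) (ENNReal.ofReal s) with hP
      have hsub : Q ∩ closedBall y ρ ⊆ ((Q ∩ closedBall y ρ) \ ⋃ i ∈ ι, ball (x i) (ρ * r i)) ∪
          ⋃ i ∈ ι, Q ∩ ball (x i) (ρ * r i) := by
        intro z hz
        by_cases hzb : z ∈ ⋃ i ∈ ι, ball (x i) (ρ * r i)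
        · right
          obtain ⟨i, hi, hzi⟩ := mem_iUnion₂.1 hzb
          exact mem_iUnion₂.2 ⟨i, hi, hz.1, hzi⟩
        · exact Or.inl ⟨hz, hzb⟩
      have hi : ∀ i ∈ ι, P (Q ∩ ball (x i) (ρ * r i)) ≤ ENNReal.ofReal (2 * C0 * (2 * (ρ * r i)) ^ (d - 1)) := by
        intro i hi
        obtain ⟨hr0, hr4⟩ := hr i hi
        rcases (Q ∩ ball (x i) (ρ * r i)).eq_empty_or_nonempty with he | ⟨z, hz⟩
        · rw [he]; simp
        · have h1 : ρ * r i ≤ ρ * (1 / 4) := by gcongr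
          have h2 := ih z hz.1 (2 * (ρ * r i)) (by positivity) (by linarith) (by rw [pow_succ] at hρs; linarith)
          refine (P.mono ?_).trans h2
          intro w hw
          refine ⟨hw.1, ?_⟩
          have h3 := hw.2
          have h4 := hz.2
          rw [mem_ball] at h3 h4
          rw [mem_closedBall]
          linarith [dist_triangle_right w z (x i)]
      calc P (Q ∩ closedBall y ρ) ≤ _ := P.mono hsub
        _ ≤ _ := measure_union_le _ _
        _ ≤ ENNReal.ofReal (C0 * ρ ^ (d - 1)) + ∑ i ∈ ι, ENNReal.ofReal (2 * C0 * (2 * (ρ * r i)) ^ (d - 1)) :=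
          add_le_add ((preH_le (by positivity) _).trans hmu)
            ((measure_biUnion_finset_le _ _).trans (Finset.sum_le_sum hi))
        _ = ENNReal.ofReal (C0 * ρ ^ (d - 1) + ∑ i ∈ ι, 2 * C0 * (2 * (ρ * r i)) ^ (d - 1)) := by
          rw [ENNReal.ofReal_add (by positivity), ENNReal.ofReal_sum_of_nonneg]
          · intro i hi
            have := (hr i hi).1
            positivity
          · refine Finset.sum_nonneg fun i hi => ?_
            have := (hr i hi).1
            positivity
        _ ≤ _ := by
          refine ENNReal.ofReal_le_ofReal ?_
          have e : ∑ i ∈ ι, 2 * C0 * (2 * (ρ * r i)) ^ (d - 1) = 2 * C0 * ρ ^ (d - 1) * ∑ i ∈ ι, (2 * r i) ^ (d - 1) := by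
            rw [Finset.mul_sum]
            refine Finset.sum_congr rfl fun i _ => ?_
            rw [show 2 * (ρ * r i) = ρ * (2 * r i) by ring, mul_pow ρ]; ring
          rw [e]
          have h5 : 2 * C0 * ρ ^ (d - 1) * ∑ i ∈ ι, (2 * r i) ^ (d - 1) ≤ 2 * C0 * ρ ^ (d - 1) * (1 / 2) := by gcongr
          linarith
  intro y hy ρ hρ hρ0
  rw [muH_eq]
  refine iSup₂_le fun s hs => ?_
  obtain ⟨s', hs', hss⟩ : ∃ s' : ℝ, 0 < s' ∧ ENNReal.ofReal s' ≤ s := by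
    refine ⟨(min s 1).toReal, ENNReal.toReal_pos (lt_min hs one_pos).ne' (min_lt_of_right_lt ENNReal.one_lt_top).ne, ?_⟩
    rw [ENNReal.ofReal_toReal (min_lt_of_right_lt ENNReal.one_lt_top).ne]
    exact min_le_left _ _
  obtain ⟨n, hn⟩ := pow_unbounded_of_one_lt (2 * ρ / s') (one_lt_two (α := ℝ))
  rw [div_lt_iff₀ hs'] at hn
  exact (OuterMeasure.mkMetric'.mono_pre _ hss _).trans (key s' hs' n y hy ρ hρ hρ0 hn.le)

theorem local_bound (d : ℕ) (hd : 2 ≤ d) {lam M : ℝ} (hl : 0 < lam) (hl1 : lam ≤ 1) (hM : 0 ≤ M) (N : ℝ) :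
    ∃ C : ℝ, 0 < C ∧ ∀ (Ω : Set (Eu d)) (A : Eu d → Matrix (Fin d) (Fin d) ℝ) (u : Eu d → ℝ),
      Sol lam M Ω A u → IsOpen Ω → ball (0 : Eu d) 2 ⊆ Ω → 0 < ms u 0 2 → ms u 0 2 ≤ N * ms u 0 (Real.sqrt lam / 8) →
      μH[(d : ℝ) - 1] {z ∈ closedBall (0 : Eu d) 1 | u z = 0} ≤ ENNReal.ofReal C := by
  obtain ⟨N1, hN1, hdoub⟩ := doubling d (by omega) hl hl1 hM N
  have hN0 : 0 < N1 := by linarith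
  have hsq : 0 < Real.sqrt lam := Real.sqrt_pos.2 hl
  obtain ⟨m, hm⟩ := pow_unbounded_of_one_lt (16 / Real.sqrt lam) (one_lt_two (α := ℝ))
  rw [div_lt_iff₀ hsq] at hm
  obtain ⟨δ, hδ, C0, hC0, hone⟩ := one_step d hd hl hl1 (N1 ^ m)
  set ρ0 := min (1 / 2 ^ (m + 1)) (δ / (M + 1)) with hρ0
  have hρ0p : 0 < ρ0 := by positivity
  have hρ0h : ρ0 ≤ 1 / 2 ^ (m + 1) := min_le_left _ _
  have hρ02 : ρ0 ≤ 1 / 2 := hρ0h.trans (by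
    refine one_div_le_one_div_of_le (by norm_num) ?_
    calc (2 : ℝ) = 2 ^ 1 := by norm_num
      _ ≤ _ := pow_le_pow_right₀ (by norm_num) (by omega))
  have hρδ : ∀ ρ, ρ ≤ ρ0 → M * ρ ≤ δ := fun ρ hρ => by
    have h1 : ρ ≤ δ / (M + 1) := hρ.trans (min_le_right _ _)
    rw [le_div_iff₀ (by positivity)] at h1
    by_cases h0 : 0 ≤ ρ
    · linarith
    · push Not at h0; nlinarith
  have hcast : (d : ℝ) - 1 = ((d - 1 : ℕ) : ℝ) := by rw [Nat.cast_sub (by omega)]; simp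
  set C1 := max C0 (2 ^ (d - 1)) with hC1
  have hC1p : 0 < C1 := lt_max_of_lt_left hC0
  obtain ⟨P, hPs, hPf, hPc⟩ := (isCompact_closedBall (0 : Eu d) 1).finite_cover_balls (e := ρ0 / 2) (by positivity)
  refine ⟨hPf.toFinset.card * (2 * C1 * ρ0 ^ (d - 1)) + 1, by positivity, fun Ω A u hS hΩo hΩ hpos hdb => ?_⟩
  have hD := hdoub A u Ω hS hΩo hΩ hpos hdb
  set Q := {z ∈ closedBall (0 : Eu d) 1 | u z = 0} with hQ
  have hchain : ∀ y, ‖y‖ ≤ 5 / 4 → ∀ (k : ℕ) (s : ℝ), 0 < s → 2 ^ k * s ≤ Real.sqrt lam / 8 → ms u y (2 ^ k * s) ≤ N1 ^ k * ms u y s := by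
    intro y hy k
    induction k with
    | zero => intro s _ _; simp
    | succ k ih =>
      intro s hs hks
      rw [pow_succ] at hks
      have h1 := (hD y hy).2 (2 ^ k * s) (by positivity) (by linarith)
      have h2 := ih s hs (by have : 0 < 2 ^ k * s := by positivity
                             linarith)
      calc ms u y (2 ^ (k + 1) * s) = ms u y (2 * (2 ^ k * s)) := by rw [pow_succ]; ring_nf
        _ ≤ N1 * ms u y (2 ^ k * s) := h1
        _ ≤ N1 * (N1 ^ k * ms u y s) := by gcongr
        _ = _ := by rw [pow_succ]; ring
  have hposy : ∀ y, ‖y‖ ≤ 5 / 4 → ∀ s, 0 < s → 0 < ms u y s := by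
    intro y hy s hs
    have h1 : 0 < ms u y (Real.sqrt lam / 8) := by
      refine lt_of_le_of_ne (ms_nonneg _ _ _) fun h0 => ?_
      have := (hD y hy).1
      rw [← h0] at this
      linarith
    obtain ⟨k, hk⟩ := pow_unbounded_of_one_lt (Real.sqrt lam / 8 / s) (one_lt_two (α := ℝ))
    rw [div_lt_iff₀ hs] at hk
    have h2 := hchain y hy k (Real.sqrt lam / 8 / 2 ^ k) (by positivity) (by rw [mul_div_cancel₀ _ (by positivity)])
    rw [mul_div_cancel₀ _ (by positivity)] at h2
    have h3 : ms u y (Real.sqrt lam / 8 / 2 ^ k) ≤ ms u y s := ms_mono hS.c1.continuous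
      (ball_subset_ball (by rw [div_le_iff₀ (by positivity)]; linarith))
    have h4 : 0 < N1 ^ k * ms u y (Real.sqrt lam / 8 / 2 ^ k) := h1.trans_le h2
    exact (pos_of_mul_pos_right h4 (by positivity)).trans_le h3
  have hit := iterate_bound hd (Q := Q) (ρ0 := ρ0) hC1p (le_max_right _ _) fun y hy ρ hρ hρ1 => by
    have hy1 : ‖y‖ ≤ 1 := by simpa using hy.1
    have hy5 : ‖y‖ ≤ 5 / 4 := by linarith
    have hS' := (hS.affine y hρ 1).mono (hρδ ρ hρ1)
    have hmap : Continuous fun x : Eu d => y + ρ • x := by fun_prop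
    obtain ⟨ι, x, r, hr, hsum, hmu⟩ := hone _ _ _ hS' (hΩo.preimage hmap) (fun z hz => hΩ (by
        rw [mem_ball_zero_iff] at hz ⊢
        calc ‖y + ρ • z‖ ≤ ‖y‖ + ‖ρ • z‖ := norm_add_le _ _
          _ = ‖y‖ + ρ * ‖z‖ := by rw [norm_smul, Real.norm_of_nonneg hρ.le]
          _ < 2 := by nlinarith [norm_nonneg z])) (by
        rw [ms_affine _ _ _ hρ]
        have := hposy (y + ρ • 0) (by simpa using hy5) (ρ * 2) (by positivity)
        positivity) (by
        rw [ms_affine _ _ _ hρ, ms_affine _ _ _ hρ]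
        have h1 := hchain y hy5 m (ρ * (Real.sqrt lam / 8)) (by positivity) (by
          have h2 : ρ ≤ 1 / 2 ^ (m + 1) := hρ1.trans hρ0h
          rw [le_div_iff₀ (by positivity), pow_succ] at h2
          have h3 : 2 ^ m * ρ ≤ 1 := by nlinarith [pow_pos (two_pos (α := ℝ)) m]
          nlinarith)
        have h2 : ms u y (ρ * 2) ≤ ms u y (2 ^ m * (ρ * (Real.sqrt lam / 8))) := ms_mono hS.c1.continuous
          (ball_subset_ball (by nlinarith))
        have h3 := h2.trans h1
        rw [smul_zero, add_zero]
        have h4 : 0 ≤ (ρ ^ d)⁻¹ := by positivity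
        nlinarith [mul_le_mul_of_nonneg_left h3 h4])
    refine ⟨ι, fun i => y + ρ • x i, r, hr, hsum, ?_⟩
    have hlip : LipschitzWith ρ.toNNReal fun x : Eu d => y + ρ • x := by
      refine LipschitzWith.of_dist_le_mul fun a b => ?_
      rw [dist_add_left, dist_smul₀, Real.norm_of_nonneg hρ.le, Real.coe_toNNReal _ hρ.le]
    have him := hlip.hausdorffMeasure_image_le (d := (d : ℝ) - 1) (by rw [hcast]; positivity)
      ({z ∈ closedBall (0 : Eu d) 1 | 1 * u (y + ρ • z) = 0} \ ⋃ i ∈ ι, ball (x i) (r i))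
    refine (measure_mono ?_).trans (him.trans ((mul_le_mul_right hmu _).trans ?_))
    · rintro w ⟨⟨hwQ, hwb⟩, hwn⟩
      have ew : y + ρ • (-(ρ⁻¹ • y) + ρ⁻¹ • w) = w := affine_inv2 y w hρ.ne'
      set z := -(ρ⁻¹ • y) + ρ⁻¹ • w with hz
      have hzw : ∀ a : Eu d, ∀ t : ℝ, dist w (y + ρ • a) = ρ * dist z a := fun a t => by
        rw [← ew, dist_add_left, dist_smul₀, Real.norm_of_nonneg hρ.le]
      refine ⟨z, ⟨⟨?_, ?_⟩, fun hzb => hwn ?_⟩, ew⟩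
      · rw [mem_closedBall] at hwb ⊢
        have := hzw 0 0
        rw [smul_zero, add_zero] at this
        rw [this] at hwb
        exact le_of_mul_le_mul_left (by linarith) hρ
      · rw [one_mul, ew]; exact hwQ.2
      · obtain ⟨i, hi, hzi⟩ := mem_iUnion₂.1 hzb
        refine mem_iUnion₂.2 ⟨i, hi, ?_⟩
        rw [mem_ball] at hzi ⊢
        rw [hzw (x i) 0]
        gcongr
    · rw [hcast, ENNReal.rpow_natCast, ← ENNReal.ofReal, ← ENNReal.ofReal_pow hρ.le, ← ENNReal.ofReal_mul (by positivity)]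
      refine ENNReal.ofReal_le_ofReal ?_
      rw [mul_comm]
      gcongr
      exact le_max_left _ _
  have hcov : Q ⊆ ⋃ p ∈ hPf.toFinset, Q ∩ ball p (ρ0 / 2) := by
    intro z hz
    obtain ⟨p, hp, hzp⟩ := mem_iUnion₂.1 (hPc hz.1)
    exact mem_iUnion₂.2 ⟨p, by simpa using hp, hz, hzp⟩
  calc μH[(d : ℝ) - 1] Q ≤ ∑ p ∈ hPf.toFinset, μH[(d : ℝ) - 1] (Q ∩ ball p (ρ0 / 2)) :=
        (measure_mono hcov).trans (measure_biUnion_finset_le _ _)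
    _ ≤ ∑ p ∈ hPf.toFinset, ENNReal.ofReal (2 * C1 * ρ0 ^ (d - 1)) := by
      refine Finset.sum_le_sum fun p _ => ?_
      rcases (Q ∩ ball p (ρ0 / 2)).eq_empty_or_nonempty with he | ⟨z, hz⟩
      · rw [he]; simp
      · refine (measure_mono ?_).trans (hit z hz.1 ρ0 hρ0p le_rfl)
        intro w hw
        refine ⟨hw.1, ?_⟩
        have h3 := hw.2
        have h4 := hz.2
        rw [mem_ball] at h3 h4
        rw [mem_closedBall]
        linarith [dist_triangle_right w z p]
    _ = ENNReal.ofReal (hPf.toFinset.card * (2 * C1 * ρ0 ^ (d - 1))) := by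
      rw [Finset.sum_const, nsmul_eq_mul, ENNReal.ofReal_mul (p := (hPf.toFinset.card : ℝ)) (by positivity),
        ENNReal.ofReal_natCast]
    _ ≤ _ := ENNReal.ofReal_le_ofReal (by linarith)

lemma cut_sol {lam M : ℝ} (hM : 0 ≤ M) {A : Eu d → Matrix (Fin d) (Fin d) ℝ} (hA : MemA d lam M A) {ε : ℝ}
    (hε : 0 < ε) {u : Eu d → ℝ} (hu : IsWeakSol (fun x => A (ε⁻¹ • x)) (ball 0 2) u) {R : ℝ} (hR : 0 < R)
    (hR2 : R < 2) : ∃ w : Eu d → ℝ, Sol lam (M / ε) (ball 0 R) (fun x => A (ε⁻¹ • x)) w ∧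
      ∀ x ∈ ball (0 : Eu d) R, w x = u x := by
  let χ : ContDiffBump (0 : Eu d) := ⟨R, (R + 2) / 2, hR, by linarith⟩
  have hχ1 : ∀ x ∈ ball (0 : Eu d) R, χ x = 1 := fun x hx =>
    χ.one_of_mem_closedBall (ball_subset_closedBall hx)
  have hts : tsupport (χ : Eu d → ℝ) = closedBall 0 ((R + 2) / 2) := χ.tsupport_eq
  have hww : ∀ x ∈ ball (0 : Eu d) R, χ x * u x = u x := fun x hx => by rw [hχ1 x hx, one_mul]
  refine ⟨fun x => χ x * u x, ⟨⟨fun y => ⟨fun i j => ((hA.symm _).apply i j).symm, hA.ellip_low _, hA.ellip_high _⟩, fun x y i j => ?_⟩,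
    ?_, ?_, ?_⟩, hww⟩
  · refine (hA.lipschitz _ _ i j).trans (le_of_eq ?_)
    rw [← smul_sub, norm_smul, Real.norm_of_nonneg (by positivity)]
    field_simp
  · rw [contDiff_iff_contDiffAt]
    intro x
    by_cases hx : x ∈ ball (0 : Eu d) 2
    · exact χ.contDiff.contDiffAt.mul (hu.1.contDiffAt (isOpen_ball.mem_nhds hx))
    · have hx' : x ∉ tsupport (χ : Eu d → ℝ) := by
        rw [hts]
        exact fun h => hx (closedBall_subset_ball (by linarith) h)
      have h0 : (fun x => χ x * u x) =ᶠ[𝓝 x] fun _ => (0 : ℝ) := by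
        filter_upwards [notMem_tsupport_iff_eventuallyEq.1 hx'] with z hz
        rw [hz]; simp
      exact contDiffAt_const.congr_of_eventuallyEq h0
  · exact χ.hasCompactSupport.mul_right
  · intro ψ hψ hcs hsub
    have h1 := hu.2 ψ hψ hcs (hsub.trans (ball_subset_ball hR2.le))
    rw [← h1, ← integral_indicator measurableSet_ball]
    refine integral_congr_ae (Filter.Eventually.of_forall fun x => ?_)
    by_cases hx : x ∈ ball (0 : Eu d) R
    · have hx2 : x ∈ ball (0 : Eu d) 2 := ball_subset_ball hR2.le hx
      have he : (fun x => χ x * u x) =ᶠ[𝓝 x] u := by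
        filter_upwards [isOpen_ball.mem_nhds hx] with z hz using hww z hz
      simp only [indicator_of_mem hx2, bform, gradient_apply]
      simp only [pd_congr _ he]
    · have h0 : ∀ i, pd i ψ x = 0 := fun i => by
        have : x ∉ tsupport (pd i ψ) := fun h => hx (hsub (tsupport_pd ψ i h))
        exact image_eq_zero_of_notMem_tsupport this
      simp [indicator, bform, gradient_apply, h0]

lemma dbl_ms (hd : 0 < d) {u : Eu d → ℝ} {N : ℝ} {y : Eu d} {r : ℝ} (hr : 0 < r)
    (h : (⨍ x in ball y r, (u x) ^ 2) ≤ N * ⨍ x in ball y (r / 2), (u x) ^ 2) :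
    ms u y r ≤ N * 2 ^ d * ms u y (r / 2) := by
  haveI : Nontrivial (Eu d) := by
    haveI : Nonempty (Fin d) := ⟨⟨0, hd⟩⟩
    infer_instance
  have hv : ∀ s : ℝ, 0 < s → volume.real (ball y s) = s ^ d * volume.real (ball (0 : Eu d) 1) := fun s hs => by
    rw [Measure.real, Measure.addHaar_ball_of_pos _ _ hs, ENNReal.toReal_mul, ENNReal.toReal_ofReal (by positivity)]
    simp [Measure.real]
  have hv1 : 0 < volume.real (ball (0 : Eu d) 1) :=
    ENNReal.toReal_pos (measure_ball_pos _ _ one_pos).ne' measure_ball_lt_top.ne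
  rw [setAverage_eq, setAverage_eq, hv r hr, hv (r / 2) (by positivity), smul_eq_mul, smul_eq_mul] at h
  change _ * ms u y r ≤ N * (_ * ms u y (r / 2)) at h
  set V := volume.real (ball (0 : Eu d) 1)
  have h2 := mul_le_mul_of_nonneg_left h (by positivity : 0 ≤ r ^ d * V)
  have e1 : r ^ d * V * ((r ^ d * V)⁻¹ * ms u y r) = ms u y r := by field_simp
  have e2 : r ^ d * V * (N * (((r / 2) ^ d * V)⁻¹ * ms u y (r / 2))) = N * 2 ^ d * ms u y (r / 2) := by
    rw [div_pow]; field_simp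
  rwa [e1, e2] at h2

theorem nodal_aux (d : ℕ) (hd : 2 ≤ d) (lam M Ntil k : ℝ) (hlam0 : 0 < lam) (hlam1 : lam ≤ 1)
    (hM : 0 < M) (hN : 1 < Ntil) (hk : 1 ≤ k) :
    ∃ C : ℝ, 0 < C ∧
      ∀ A : EuclideanSpace ℝ (Fin d) → Matrix (Fin d) (Fin d) ℝ, MemA d lam M A →
      ∀ ε : ℝ, 0 < ε →
      ∀ u : EuclideanSpace ℝ (Fin d) → ℝ, IsWeakSol (fun x => A (ε⁻¹ • x)) (ball 0 2) u →
        (∃ x ∈ ball (0 : EuclideanSpace ℝ (Fin d)) 2, u x ≠ 0) →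
        (∀ y : EuclideanSpace ℝ (Fin d), ‖y‖ ≤ Real.sqrt lam / 2 → ∀ r : ℝ, 0 < r → r < 3 / 4 →
          (⨍ x in ball y r, (u x) ^ 2) ≤ Ntil * ⨍ x in ball y (r / 2), (u x) ^ 2) →
        ∀ r : ℝ, 0 < r → r < k * ε → r < 3 / 8 →
        ∀ x₀ : EuclideanSpace ℝ (Fin d), ‖x₀‖ ≤ Real.sqrt lam / 2 →
          μH[(d : ℝ) - 1] ({x ∈ ball (0 : EuclideanSpace ℝ (Fin d)) 2 | u x = 0} ∩ ball x₀ r)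
            ≤ ENNReal.ofReal (C * r ^ (d - 1)) := by
  have hsq : 0 < Real.sqrt lam := Real.sqrt_pos.2 hlam0
  have hsq1 : Real.sqrt lam ≤ 1 := Real.sqrt_le_one.2 hlam1
  have hcast : (d : ℝ) - 1 = ((d - 1 : ℕ) : ℝ) := by
    rw [Nat.cast_sub (by omega)]; simp
  obtain ⟨m, hm⟩ := pow_unbounded_of_one_lt (16 / Real.sqrt lam) (by norm_num : (1 : ℝ) < 2)
  obtain ⟨C, hC, hloc⟩ := local_bound d hd hlam0 hlam1 (by positivity : 0 ≤ k * M) ((Ntil * 2 ^ d) ^ m)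
  refine ⟨C, hC, fun A hA ε hε u hu hne hdbl r hr hrk hr8 x₀ hx₀ => ?_⟩
  obtain ⟨p, hp, hup⟩ := hne
  have hp2 : ‖p‖ < 2 := by simpa using hp
  obtain ⟨R, hR1, hR2⟩ := exists_between (max_lt hp2 (by norm_num : (3 / 2 : ℝ) < 2))
  have hRp : ‖p‖ < R := (le_max_left _ _).trans_lt hR1
  have hR32 : 3 / 2 < R := (le_max_right _ _).trans_lt hR1
  obtain ⟨w, hw, hwu⟩ := cut_sol hM.le hA hε hu (by linarith) hR2
  have cw := hw.c1.continuous
  have hball : ∀ s : ℝ, s ≤ 3 / 4 → ball x₀ s ⊆ ball (0 : Eu d) R := fun s hs => by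
    refine ball_subset_ball' ?_
    rw [dist_zero_right]; linarith
  have hmsw : ∀ s : ℝ, s ≤ 3 / 4 → ms w x₀ s = ms u x₀ s := fun s hs =>
    setIntegral_congr_fun measurableSet_ball fun x hx => by simp only [hwu x (hball s hs hx)]
  have hstep : ∀ s : ℝ, 0 < s → s < 3 / 4 → ms w x₀ s ≤ Ntil * 2 ^ d * ms w x₀ (s / 2) := fun s hs hs4 => by
    rw [hmsw s hs4.le, hmsw (s / 2) (by linarith)]
    exact dbl_ms (by omega) hs (hdbl x₀ hx₀ s hs hs4)
  have hiter : ∀ n : ℕ, ms w x₀ (r * 2) ≤ (Ntil * 2 ^ d) ^ n * ms w x₀ (r * 2 / 2 ^ n) := by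
    intro n
    induction n with
    | zero => simp
    | succ n ih =>
      have h1 := hstep (r * 2 / 2 ^ n) (by positivity) (by
        have : r * 2 / 2 ^ n ≤ r * 2 := div_le_self (by positivity) (one_le_pow₀ (by norm_num))
        linarith)
      calc _ ≤ _ := ih
        _ ≤ (Ntil * 2 ^ d) ^ n * (Ntil * 2 ^ d * ms w x₀ (r * 2 / 2 ^ n / 2)) := by gcongr
        _ = _ := by rw [div_div, ← pow_succ, pow_succ (Ntil * 2 ^ d)]; ring
  have hsol : Sol lam (k * M) {x | x₀ + r • x ∈ ball (0 : Eu d) R} (fun x => A (ε⁻¹ • (x₀ + r • x)))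
      (fun x => 1 * w (x₀ + r • x)) := by
    refine (hw.affine x₀ hr 1).mono ?_
    rw [div_mul_eq_mul_div, div_le_iff₀ hε]
    nlinarith
  have hrd : 0 < r ^ d := by positivity
  have hfin := hloc _ _ _ hsol (isOpen_ball.preimage (by fun_prop)) (by
      intro x hx
      have hx2 : ‖x‖ < 2 := by simpa using hx
      refine hball (r * 2) (by linarith) ?_
      rw [mem_ball, dist_eq_norm, add_sub_cancel_left, norm_smul, Real.norm_of_nonneg hr.le]
      gcongr) (by
      rw [ms_affine w x₀ 0 hr]
      have := ucp d (by omega) hlam0 hlam1 (by positivity) hw isOpen_ball (convex_ball _ _).isPreconnected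
        ⟨p, by simpa using hRp, by rw [hwu p (by simpa using hRp)]; exact hup⟩
        (y := x₀) (hball (3 / 4) le_rfl (mem_ball_self (by norm_num))) (s := r * 2) (by positivity)
      simp only [smul_zero, add_zero]
      positivity) (by
      rw [ms_affine w x₀ 0 hr, ms_affine w x₀ 0 hr]
      simp only [smul_zero, add_zero]
      have h1 : ms w x₀ (r * 2 / 2 ^ m) ≤ ms w x₀ (r * (Real.sqrt lam / 8)) := by
        refine ms_mono cw (ball_subset_ball ?_)
        rw [div_lt_iff₀ hsq] at hm
        rw [div_le_iff₀ (by positivity)]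
        nlinarith
      have h2 : ms w x₀ (r * 2) ≤ (Ntil * 2 ^ d) ^ m * ms w x₀ (r * (Real.sqrt lam / 8)) :=
        (hiter m).trans (by gcongr)
      have h4 : 0 ≤ (r ^ d)⁻¹ := by positivity
      have := mul_le_mul_of_nonneg_left h2 h4
      linarith)
  have hlip : LipschitzWith r.toNNReal fun x : Eu d => x₀ + r • x := by
    refine LipschitzWith.of_dist_le_mul fun a b => ?_
    rw [dist_add_left, dist_smul₀, Real.norm_of_nonneg hr.le, Real.coe_toNNReal _ hr.le]
  have him := hlip.hausdorffMeasure_image_le (d := (d : ℝ) - 1) (by rw [hcast]; positivity)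
    {z ∈ closedBall (0 : Eu d) 1 | 1 * w (x₀ + r • z) = 0}
  refine (measure_mono ?_).trans (him.trans ((mul_le_mul_right hfin _).trans ?_))
  · rintro q ⟨⟨_, hq0⟩, hqb⟩
    have ew : x₀ + r • (-(r⁻¹ • x₀) + r⁻¹ • q) = q := affine_inv2 x₀ q hr.ne'
    refine ⟨-(r⁻¹ • x₀) + r⁻¹ • q, ⟨?_, ?_⟩, ew⟩
    · set z := -(r⁻¹ • x₀) + r⁻¹ • q
      rw [mem_ball, ← ew, dist_eq_norm, add_sub_cancel_left, norm_smul, Real.norm_of_nonneg hr.le] at hqb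
      rw [mem_closedBall, dist_zero_right]
      nlinarith
    · rw [ew, hwu q (hball r (by linarith) hqb), hq0, mul_zero]
  · rw [hcast, ENNReal.rpow_natCast, mul_comm C, ENNReal.ofReal_mul (by positivity), ENNReal.ofReal_pow hr.le]
    exact le_of_eq rfl

/-- **Lemma 4.2.** Small-scale nodal set bound: for radii `r < kε`, `r < 3/8`, the nodal
set of `u_ε` in `B(x₀, r)` has measure at most `C(Ñ, k) r^{d-1}`. -/
theorem nodal_bound_small_scales
    (d : ℕ) (hd : 2 ≤ d) (lam M Ntil k : ℝ) (hlam0 : 0 < lam) (hlam1 : lam ≤ 1)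
    (hM : 0 < M) (hN : 1 < Ntil) (hk : 1 ≤ k) :
    ∃ C : ℝ, 0 < C ∧
      ∀ A : EuclideanSpace ℝ (Fin d) → Matrix (Fin d) (Fin d) ℝ, MemA d lam M A →
      ∀ ε : ℝ, 0 < ε →
      ∀ u : EuclideanSpace ℝ (Fin d) → ℝ, IsWeakSol (fun x => A (ε⁻¹ • x)) (ball 0 2) u →
        (∃ x ∈ ball (0 : EuclideanSpace ℝ (Fin d)) 2, u x ≠ 0) →
        (∀ y : EuclideanSpace ℝ (Fin d), ‖y‖ ≤ Real.sqrt lam / 2 → ∀ r : ℝ, 0 < r → r < 3 / 4 →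
          (⨍ x in ball y r, (u x) ^ 2) ≤ Ntil * ⨍ x in ball y (r / 2), (u x) ^ 2) →
        ∀ r : ℝ, 0 < r → r < k * ε → r < 3 / 8 →
        ∀ x₀ : EuclideanSpace ℝ (Fin d), ‖x₀‖ ≤ Real.sqrt lam / 2 →
          μH[(d : ℝ) - 1] ({x ∈ ball (0 : EuclideanSpace ℝ (Fin d)) 2 | u x = 0} ∩ ball x₀ r)
            ≤ ENNReal.ofReal (C * r ^ (d - 1)) := by
  exact nodal_aux d hd lam M Ntil k hlam0 hlam1 hM hN hk

end
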